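/- arXiv:2404.06327 — 6 statements merged into one kernel-verified Lean document; each statement's English description precedes it below -/
import Mathlib

section
/- There exist absolute constants K > 0 and c > 0 such that the following holds. For every additive Abelian group A (not necessarily finite), every integer r ≥ 1, every affine predicate P : {0,1}^r → {0,1} over A, every ε ∈ (0,1), every n ≥ 1, and every instance Φ of CSP(P) on n variables, Φ admits an (ε, s)-sparsifier with s ≤ K·n·r⁴·(log₂(2nr/ε))^c / ε². -/
/-- The value of a CSP instance (with predicate `P`, weights `w`, and constraint
tuples `t`) on an assignment `a`. -/
noncomputable def cspVal {n r m : ℕ} (P : (Fin r → Bool) → Bool) (w : Fin m → ℝ)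
    (t : Fin m → Fin r → Fin n) (a : Fin n → Bool) : ℝ :=
  ∑ j : Fin m, w j * (if P (fun k => a (t j k)) then 1 else 0)

/-- The value of a reweighted sub-instance, retaining only the constraints in `S`
with new weights `w`. -/
noncomputable def cspValOn {n r m : ℕ} (P : (Fin r → Bool) → Bool) (S : Finset (Fin m))
    (w : Fin m → ℝ) (t : Fin m → Fin r → Fin n) (a : Fin n → Bool) : ℝ :=
  ∑ j ∈ S, w j * (if P (fun k => a (t j k)) then 1 else 0)

section Chains

variable {ι : Type*} [DecidableEq ι]

/-- `IsDropSeq Y l` says that the family `Y` of supports admits members `A₁, …, Aₖ` such that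
`Aᵢ` contains the `i`-th entry of `l` but none of the earlier entries. -/
def IsDropSeq : Finset (Finset ι) → List ι → Prop
  | _, [] => True
  | Y, j :: l => (∃ A ∈ Y, j ∈ A) ∧ IsDropSeq (Y.filter (j ∉ ·)) l

/-- The elements of `F` covered by the family `Y`. -/
def coverIn (Y : Finset (Finset ι)) (F : Finset ι) : Finset ι :=
  F.filter fun j => ∃ A ∈ Y, j ∈ A

/-- The chain length of `Y` on `F`: the largest length of a drop sequence with entries in `F`. -/
noncomputable def chainLen (Y : Finset (Finset ι)) (F : Finset ι) : ℕ :=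
  sSup {k | ∃ l : List ι, IsDropSeq Y l ∧ (∀ j ∈ l, j ∈ F) ∧ l.length = k}

lemma mem_coverIn {Y : Finset (Finset ι)} {F : Finset ι} {j : ι} :
    j ∈ coverIn Y F ↔ j ∈ F ∧ ∃ A ∈ Y, j ∈ A := by
  simp [coverIn]

lemma IsDropSeq.mono {Y Z : Finset (Finset ι)} (h : Y ⊆ Z) {l : List ι} (hl : IsDropSeq Y l) :
    IsDropSeq Z l := by
  induction l generalizing Y Z with
  | nil => trivial
  | cons j l ih =>
    obtain ⟨⟨A, hA, hj⟩, hl⟩ := hl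
    exact ⟨⟨A, h hA, hj⟩, ih (Finset.filter_subset_filter _ h) hl⟩

lemma IsDropSeq.sublist {Y : Finset (Finset ι)} {l l' : List ι} (h : l'.Sublist l)
    (hl : IsDropSeq Y l) : IsDropSeq Y l' := by
  induction h generalizing Y with
  | slnil => trivial
  | cons j _ ih => exact (ih hl.2).mono (Finset.filter_subset _ _)
  | cons_cons j _ ih => exact ⟨hl.1, ih hl.2⟩

lemma IsDropSeq.exists_mem {Y : Finset (Finset ι)} {l : List ι} (hl : IsDropSeq Y l) {j : ι}
    (hj : j ∈ l) : ∃ A ∈ Y, j ∈ A :=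
  (hl.sublist (List.singleton_sublist.2 hj)).1

lemma IsDropSeq.nodup {Y : Finset (Finset ι)} {l : List ι} (hl : IsDropSeq Y l) : l.Nodup := by
  induction l generalizing Y with
  | nil => simp
  | cons j l ih =>
    refine List.nodup_cons.2 ⟨fun hj => ?_, ih hl.2⟩
    obtain ⟨A, hA, hjA⟩ := hl.2.exists_mem hj
    exact (Finset.mem_filter.1 hA).2 hjA

lemma IsDropSeq.append {X Y : Finset (Finset ι)} (hYX : Y ⊆ X) {l₁ l₂ : List ι}
    (h₁ : IsDropSeq X l₁) (hdisj : ∀ j ∈ l₁, ∀ A ∈ Y, j ∉ A) (h₂ : IsDropSeq Y l₂) :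
    IsDropSeq X (l₁ ++ l₂) := by
  induction l₁ generalizing X with
  | nil => exact h₂.mono hYX
  | cons j l ih =>
    refine ⟨h₁.1, ih (fun A hA => ?_) h₁.2 fun i hi => hdisj i (List.mem_cons_of_mem _ hi)⟩
    exact Finset.mem_filter.2 ⟨hYX hA, hdisj j List.mem_cons_self A hA⟩

lemma IsDropSeq.length_le_card {Y : Finset (Finset ι)} {F : Finset ι} {l : List ι}
    (hl : IsDropSeq Y l) (hF : ∀ j ∈ l, j ∈ F) : l.length ≤ F.card := by
  rw [← List.toFinset_card_of_nodup hl.nodup]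
  exact Finset.card_le_card fun j hj => hF j (List.mem_toFinset.1 hj)

lemma bddAbove_dropSeq_lengths (Y : Finset (Finset ι)) (F : Finset ι) :
    BddAbove {k | ∃ l : List ι, IsDropSeq Y l ∧ (∀ j ∈ l, j ∈ F) ∧ l.length = k} := by
  refine ⟨F.card, ?_⟩
  rintro _ ⟨l, hl, hF, rfl⟩
  exact hl.length_le_card hF

lemma IsDropSeq.length_le_chainLen {Y : Finset (Finset ι)} {F : Finset ι} {l : List ι}
    (hl : IsDropSeq Y l) (hF : ∀ j ∈ l, j ∈ F) : l.length ≤ chainLen Y F :=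
  le_csSup (bddAbove_dropSeq_lengths Y F) ⟨l, hl, hF, rfl⟩

lemma exists_dropSeq_length_eq (Y : Finset (Finset ι)) (F : Finset ι) :
    ∃ l : List ι, IsDropSeq Y l ∧ (∀ j ∈ l, j ∈ F) ∧ l.length = chainLen Y F :=
  Nat.sSup_mem (s := {k | ∃ l : List ι, IsDropSeq Y l ∧ (∀ j ∈ l, j ∈ F) ∧ l.length = k})
    ⟨0, [], trivial, by simp, rfl⟩ (bddAbove_dropSeq_lengths Y F)

lemma chainLen_le_card (Y : Finset (Finset ι)) (F : Finset ι) : chainLen Y F ≤ F.card := by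
  obtain ⟨l, hl, hF, h⟩ := exists_dropSeq_length_eq Y F
  exact h ▸ hl.length_le_card hF

lemma chainLen_mono (Y : Finset (Finset ι)) {F G : Finset ι} (h : F ⊆ G) :
    chainLen Y F ≤ chainLen Y G := by
  obtain ⟨l, hl, hF, hlen⟩ := exists_dropSeq_length_eq Y F
  exact hlen ▸ hl.length_le_chainLen fun j hj => h (hF j hj)

lemma chainLen_filter_succ_le {Y : Finset (Finset ι)} {F : Finset ι} {j : ι}
    (hj : j ∈ coverIn Y F) : chainLen (Y.filter (j ∉ ·)) F + 1 ≤ chainLen Y F := by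
  obtain ⟨l, hl, hF, hlen⟩ := exists_dropSeq_length_eq (Y.filter (j ∉ ·)) F
  obtain ⟨hjF, hA⟩ := mem_coverIn.1 hj
  have h : IsDropSeq Y (j :: l) := ⟨hA, hl⟩
  simpa [hlen] using h.length_le_chainLen (F := F) (by simpa [hjF] using hF)

lemma chainLen_sdiff_add_le {X Y : Finset (Finset ι)} (hYX : Y ⊆ X) (F : Finset ι) :
    chainLen X (F \ coverIn Y F) + chainLen Y F ≤ chainLen X F := by
  obtain ⟨l₁, hl₁, hF₁, hlen₁⟩ := exists_dropSeq_length_eq X (F \ coverIn Y F)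
  obtain ⟨l₂, hl₂, hF₂, hlen₂⟩ := exists_dropSeq_length_eq Y F
  rw [← hlen₁, ← hlen₂, ← List.length_append]
  refine (hl₁.append hYX (fun j hj A hA hjA => ?_) hl₂).length_le_chainLen fun j hj => ?_
  · have := Finset.mem_sdiff.1 (hF₁ j hj)
    exact this.2 (mem_coverIn.2 ⟨this.1, A, hA, hjA⟩)
  · rcases List.mem_append.1 hj with h | h
    · exact (Finset.mem_sdiff.1 (hF₁ j h)).1
    · exact hF₂ j h

lemma chainLen_union_le (Y : Finset (Finset ι)) (F G : Finset ι) :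
    chainLen Y (F ∪ G) ≤ chainLen Y F + G.card := by
  obtain ⟨l, hl, hF, hlen⟩ := exists_dropSeq_length_eq Y (F ∪ G)
  rw [← hlen, List.length_eq_length_filter_add (fun j => decide (j ∈ F))]
  refine add_le_add ((hl.sublist List.filter_sublist).length_le_chainLen fun j hj => ?_)
    ((hl.sublist List.filter_sublist).length_le_card fun j hj => ?_)
  · simpa using (List.mem_filter.1 hj).2
  · have h := List.mem_filter.1 hj
    have h2 : j ∉ F := by simpa using h.2
    exact (Finset.mem_union.1 (hF j h.1)).resolve_left h2

/-- `F` is `d`-dense for `X` if every subfamily of `X` covers a part of `F` whose weight is at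
least `d` times its chain length. -/
def IsDense (X : Finset (Finset ι)) (u : ι → ℝ) (d : ℝ) (F : Finset ι) : Prop :=
  ∀ Y ⊆ X, d * chainLen Y F ≤ ∑ j ∈ coverIn Y F, u j

lemma exists_isDense_between (X : Finset (Finset ι)) {u : ι → ℝ} {d : ℝ}
    (hd : 0 < d) {H V : Finset ι} (hHV : H ⊆ V) (hH : ∀ j ∈ H, d ≤ u j) :
    ∃ F, H ⊆ F ∧ F ⊆ V ∧ IsDense X u d F ∧
      ∑ j ∈ V \ F, u j ≤ d * ((chainLen X V : ℝ) - chainLen X F) := by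
  obtain ⟨F, hF, hmax⟩ := Finset.exists_max_image (V.powerset.filter (H ⊆ ·))
    (fun F => ∑ j ∈ F, u j - d * chainLen X F) ⟨V, by simp [hHV]⟩
  simp only [Finset.mem_filter, Finset.mem_powerset] at hF hmax
  refine ⟨F, hF.2, hF.1, fun Y hY => ?_, ?_⟩
  · set T := coverIn Y F with hT
    have hTF : T ⊆ F := Finset.filter_subset _ _
    have hle := hmax (F \ (T \ H)) ⟨Finset.sdiff_subset.trans hF.1, fun j hj => by
      simp [hF.2 hj, hj]⟩
    have h1 : chainLen X (F \ (T \ H)) ≤ chainLen X (F \ T) + (T ∩ H).card :=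
      (chainLen_mono X (by intro j; simp only [Finset.mem_sdiff, Finset.mem_union,
        Finset.mem_inter]; tauto)).trans (chainLen_union_le X _ _)
    have h2 := chainLen_sdiff_add_le hY F
    have h3 : ∑ j ∈ F \ (T \ H), u j + ∑ j ∈ T \ H, u j = ∑ j ∈ F, u j :=
      Finset.sum_sdiff (Finset.sdiff_subset.trans hTF)
    have h4 : ∑ j ∈ T ∩ H, u j + ∑ j ∈ T \ H, u j = ∑ j ∈ T, u j :=
      Finset.sum_inter_add_sum_sdiff T H u
    have h5 : (T ∩ H).card * d ≤ ∑ j ∈ T ∩ H, u j := by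
      simpa using Finset.card_nsmul_le_sum (T ∩ H) u d
        fun j hj => hH j (Finset.mem_inter.1 hj).2
    rw [← hT] at h2
    have h6 : (chainLen X (F \ (T \ H)) : ℝ) + chainLen Y F ≤
        chainLen X F + (T ∩ H).card := by
      exact_mod_cast (by omega : chainLen X (F \ (T \ H)) + chainLen Y F ≤
        chainLen X F + (T ∩ H).card)
    have h7 := mul_le_mul_of_nonneg_left h6 hd.le
    linarith
  · have hle := hmax V ⟨subset_rfl, hHV⟩
    have h3 : ∑ j ∈ V \ F, u j + ∑ j ∈ F, u j = ∑ j ∈ V, u j := Finset.sum_sdiff hF.1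
    linarith

/-- The traces on `F` of the members of `Y` whose weight on `F` is at most `x`. -/
noncomputable def lightTraces (Y : Finset (Finset ι)) (F : Finset ι) (u : ι → ℝ) (x : ℝ) :
    Finset (Finset ι) :=
  (Y.image (· ∩ F)).filter fun B => ∑ j ∈ B, u j ≤ x

lemma sum_mul_card_lightTraces_filter (Y : Finset (Finset ι)) (F : Finset ι) (u : ι → ℝ) (x : ℝ) :
    ∑ j ∈ coverIn Y F, u j * (lightTraces (Y.filter (j ∉ ·)) F u x).card =
      ∑ B ∈ lightTraces Y F u x, (∑ j ∈ coverIn Y F, u j - ∑ j ∈ B, u j) := by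
  have h1 : ∀ j ∈ coverIn Y F, lightTraces (Y.filter (j ∉ ·)) F u x =
      (lightTraces Y F u x).filter (j ∉ ·) := by
    intro j hj
    have hjF := (mem_coverIn.1 hj).1
    ext B
    simp only [lightTraces, Finset.mem_filter, Finset.mem_image]
    constructor
    · rintro ⟨⟨A, ⟨hA, hjA⟩, rfl⟩, hB⟩
      exact ⟨⟨⟨A, hA, rfl⟩, hB⟩, fun h => hjA (Finset.mem_inter.1 h).1⟩
    · rintro ⟨⟨⟨A, hA, rfl⟩, hB⟩, hj⟩
      exact ⟨⟨A, ⟨hA, fun h => hj (Finset.mem_inter.2 ⟨h, hjF⟩)⟩, rfl⟩, hB⟩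
  have h2 : ∀ B ∈ lightTraces Y F u x, B ⊆ coverIn Y F := by
    intro B hB j hj
    obtain ⟨A, hA, rfl⟩ := Finset.mem_image.1 (Finset.mem_filter.1 hB).1
    have hj := Finset.mem_inter.1 hj
    exact mem_coverIn.2 ⟨hj.2, A, hA, hj.1⟩
  calc ∑ j ∈ coverIn Y F, u j * (lightTraces (Y.filter (j ∉ ·)) F u x).card
      = ∑ j ∈ coverIn Y F, ∑ B ∈ lightTraces Y F u x, if j ∉ B then u j else 0 := by
        refine Finset.sum_congr rfl fun j hj => ?_
        rw [h1 j hj, ← Finset.sum_filter, Finset.sum_const, nsmul_eq_mul, mul_comm]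
    _ = ∑ B ∈ lightTraces Y F u x, ∑ j ∈ coverIn Y F, if j ∉ B then u j else 0 :=
        Finset.sum_comm
    _ = _ := by
        refine Finset.sum_congr rfl fun B hB => ?_
        rw [← Finset.sum_filter, ← Finset.sum_sdiff (h2 B hB), add_sub_cancel_right]
        congr 1
        ext j; simp

variable [Fintype ι]

lemma card_image_inter_le (Y : Finset (Finset ι)) (F : Finset ι) {k : ℕ} (hk : chainLen Y F ≤ k) :
    (Y.image (· ∩ F)).card ≤ (Fintype.card ι + 1) ^ k := by
  induction k generalizing Y with
  | zero =>
    rw [pow_zero, Finset.card_le_one]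
    have hempty : ∀ A ∈ Y, A ∩ F = ∅ := fun A hA => by
      by_contra hne
      obtain ⟨j, hj⟩ := Finset.nonempty_iff_ne_empty.2 hne
      have hj := Finset.mem_inter.1 hj
      have := chainLen_filter_succ_le (mem_coverIn.2 ⟨hj.2, A, hA, hj.1⟩)
      omega
    simp only [Finset.mem_image, forall_exists_index, and_imp]
    rintro _ A hA rfl _ B hB rfl
    rw [hempty A hA, hempty B hB]
  | succ k ih =>
    have hsub : Y.image (· ∩ F) ⊆ insert (coverIn Y F)
        ((coverIn Y F).biUnion fun j => (Y.filter (j ∉ ·)).image (· ∩ F)) := by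
      intro B hB
      obtain ⟨A, hA, rfl⟩ := Finset.mem_image.1 hB
      by_cases h : coverIn Y F ⊆ A
      · refine Finset.mem_insert.2 (Or.inl ?_)
        ext j
        refine ⟨fun hj => ?_, fun hj => ?_⟩
        · have hj := Finset.mem_inter.1 hj
          exact mem_coverIn.2 ⟨hj.2, A, hA, hj.1⟩
        · exact Finset.mem_inter.2 ⟨h hj, (mem_coverIn.1 hj).1⟩
      · obtain ⟨j, hj, hjA⟩ := Finset.not_subset.1 h
        refine Finset.mem_insert_of_mem (Finset.mem_biUnion.2 ⟨j, hj, ?_⟩)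
        exact Finset.mem_image_of_mem _ (Finset.mem_filter.2 ⟨hA, hjA⟩)
    calc (Y.image (· ∩ F)).card ≤ _ := Finset.card_le_card hsub
      _ ≤ ((coverIn Y F).biUnion fun j => (Y.filter (j ∉ ·)).image (· ∩ F)).card + 1 :=
          Finset.card_insert_le _ _
      _ ≤ (coverIn Y F).card * (Fintype.card ι + 1) ^ k + 1 := by
          gcongr
          refine Finset.card_biUnion_le_card_mul _ _ _ fun j hj => ih _ ?_
          have := chainLen_filter_succ_le hj
          omega
      _ ≤ Fintype.card ι * (Fintype.card ι + 1) ^ k + (Fintype.card ι + 1) ^ k := by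
          gcongr
          · exact Finset.card_le_univ _
          · exact Nat.one_le_pow _ _ (by omega)
      _ = (Fintype.card ι + 1) ^ (k + 1) := by ring

lemma card_lightTraces_le_choose {X : Finset (Finset ι)} {u : ι → ℝ} {d : ℝ}
    (hu : ∀ j, 0 ≤ u j) (hd : 0 < d) {F : Finset ι} (hF : IsDense X u d F) (α k : ℕ)
    {Y : Finset (Finset ι)} (hY : Y ⊆ X) (hk : chainLen Y F ≤ α + k) :
    (lightTraces Y F u (α * d)).card ≤ (α + k).choose α * (Fintype.card ι + 1) ^ α := by
  induction k generalizing Y with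
  | zero =>
    simpa [lightTraces] using (Finset.card_filter_le _ _).trans (card_image_inter_le Y F hk)
  | succ k ih =>
    rcases hk.lt_or_eq with hlt | heq
    · refine (ih hY (by omega)).trans ?_
      gcongr
      omega
    set D := ∑ j ∈ coverIn Y F, u j with hD
    set f := (lightTraces Y F u (α * d)).card
    set B := (α + k).choose α * (Fintype.card ι + 1) ^ α with hB
    have hDd : d * (α + k + 1) ≤ D := by
      have := hF Y hY
      rw [heq] at this
      push_cast at this
      linarith
    have h1 : (D - α * d) * f ≤ D * B := by
      have hl : (D - α * d) * f ≤
          ∑ C ∈ lightTraces Y F u (α * d), (D - ∑ j ∈ C, u j) := by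
        rw [mul_comm, ← nsmul_eq_mul]
        refine Finset.card_nsmul_le_sum _ _ _ fun C hC => ?_
        have := (Finset.mem_filter.1 hC).2
        linarith
      rw [hD, ← sum_mul_card_lightTraces_filter, ← hD] at hl
      refine hl.trans ?_
      rw [hD, Finset.sum_mul]
      refine Finset.sum_le_sum fun j hj => mul_le_mul_of_nonneg_left ?_ (hu j)
      have h2 := chainLen_filter_succ_le hj
      exact_mod_cast ih ((Finset.filter_subset _ _).trans hY) (by omega)
    have hDpos : 0 < D := lt_of_lt_of_le (by positivity) hDd
    have h2 : ((k : ℝ) + 1) * f ≤ (α + k + 1) * B := by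
      have hf : (0 : ℝ) ≤ f := Nat.cast_nonneg _
      have h3 : D * (k + 1) ≤ (α + k + 1) * (D - α * d) := by
        have := mul_le_mul_of_nonneg_left hDd (Nat.cast_nonneg (α := ℝ) α)
        linarith
      have h4 := mul_le_mul_of_nonneg_right h3 hf
      have h5 := mul_le_mul_of_nonneg_left h1 (by positivity : (0 : ℝ) ≤ α + k + 1)
      refine le_of_mul_le_mul_left ?_ hDpos
      linarith
    have h3 : (k + 1) * f ≤ (α + k + 1) * B := by exact_mod_cast h2
    have h4 : (k + 1) * (α + (k + 1)).choose α = (α + k + 1) * (α + k).choose α := by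
      have := Nat.add_one_mul_choose_eq (α + k) k
      rw [Nat.choose_symm_add, Nat.choose_symm_add]
      rw [← add_assoc]
      linarith
    refine Nat.le_of_mul_le_mul_left (h3.trans (le_of_eq ?_)) (Nat.succ_pos k)
    rw [hB, ← mul_assoc, ← h4, mul_assoc]

lemma card_lightTraces_le {X : Finset (Finset ι)} {u : ι → ℝ} {d : ℝ}
    (hu : ∀ j, 0 ≤ u j) (hd : 0 < d) {F : Finset ι} (hF : IsDense X u d F) (α : ℕ) :
    (lightTraces X F u (α * d)).card ≤ (Fintype.card ι + 1) ^ (2 * α) := by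
  rcases le_total (chainLen X F) α with h | h
  · refine (card_lightTraces_le_choose hu hd hF α 0 subset_rfl (by simpa using h)).trans ?_
    simp only [add_zero, Nat.choose_self, one_mul]
    exact Nat.pow_le_pow_right (by omega) (by omega)
  · obtain ⟨k, hk⟩ := Nat.exists_eq_add_of_le h
    refine (card_lightTraces_le_choose hu hd hF α k subset_rfl hk.le).trans ?_
    rw [two_mul, pow_add, ← hk]
    gcongr
    refine (Nat.choose_le_pow _ _).trans ?_
    gcongr
    exact ((chainLen_le_card X F).trans (Finset.card_le_univ F)).trans (Nat.le_succ _)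

end Chains

lemma exists_subset_sum_prod_le {ι κ : Type*} [DecidableEq ι] (K : Finset κ) (x : κ → ι → ℝ)
    (p : ι → ℝ) (γ : ℝ) (T : Finset ι) (hp : ∀ j ∈ T, 0 ≤ p j ∧ p j ≤ 1) (β : κ → ℝ) :
    ∃ S ⊆ T, ∑ k ∈ K, β k * ∏ j ∈ S, x k j + γ * S.card ≤
      ∑ k ∈ K, β k * ∏ j ∈ T, (1 + p j * (x k j - 1)) + γ * ∑ j ∈ T, p j := by
  induction T using Finset.induction_on generalizing β with
  | empty => exact ⟨∅, subset_rfl, by simp⟩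
  | insert i T hi ih =>
    have hp' : ∀ j ∈ T, 0 ≤ p j ∧ p j ≤ 1 := fun j hj => hp j (Finset.mem_insert_of_mem hj)
    obtain ⟨hp0, hp1⟩ := hp i (Finset.mem_insert_self i T)
    set E₀ := ∑ k ∈ K, β k * ∏ j ∈ T, (1 + p j * (x k j - 1)) with hE₀
    set E₁ := ∑ k ∈ K, (β k * x k i) * ∏ j ∈ T, (1 + p j * (x k j - 1)) with hE₁
    have hsplit : ∑ k ∈ K, β k * ∏ j ∈ insert i T, (1 + p j * (x k j - 1)) =
        (1 - p i) * E₀ + p i * E₁ := by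
      rw [hE₀, hE₁, Finset.mul_sum, Finset.mul_sum, ← Finset.sum_add_distrib]
      refine Finset.sum_congr rfl fun k _ => ?_
      rw [Finset.prod_insert hi]
      ring
    rw [hsplit, Finset.sum_insert hi]
    set Q := ∑ j ∈ T, p j
    by_cases hle : E₀ ≤ E₁ + γ
    · obtain ⟨S, hS, h⟩ := ih hp' β
      refine ⟨S, hS.trans (Finset.subset_insert _ _), h.trans ?_⟩
      have := mul_le_mul_of_nonneg_left hle hp0
      linarith
    · obtain ⟨S, hS, h⟩ := ih hp' fun k => β k * x k i
      have hiS : i ∉ S := fun h => hi (hS h)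
      refine ⟨insert i S, Finset.insert_subset_insert _ hS, ?_⟩
      rw [Finset.card_insert_of_notMem hiS]
      have h1 : ∑ k ∈ K, β k * ∏ j ∈ insert i S, x k j =
          ∑ k ∈ K, (β k * x k i) * ∏ j ∈ S, x k j :=
        Finset.sum_congr rfl fun k _ => by rw [Finset.prod_insert hiS]; ring
      rw [h1]
      have := mul_le_mul_of_nonneg_left (not_le.1 hle).le (sub_nonneg.2 hp1)
      push_cast
      linarith

lemma sum_exp_neg_le {κ : Type*} (K : Finset κ) (U : κ → ℝ) {d M : ℝ} (hd : 0 < d) (hM : 2 ≤ M)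
    (hU : ∀ B ∈ K, d ≤ U B)
    (hcount : ∀ α : ℕ, ((K.filter fun B => U B ≤ α * d).card : ℝ) ≤ M ^ (2 * α)) :
    ∑ B ∈ K, Real.exp (-(7 * Real.log M * (U B / d))) ≤ 1 / 4 := by
  classical
  have hM0 : 0 < M := by linarith
  have hlog : 0 ≤ Real.log M := Real.log_nonneg (by linarith)
  set a : κ → ℕ := fun B => ⌊U B / d⌋₊ with ha
  have ha1 : ∀ B ∈ K, 1 ≤ a B := fun B hB =>
    (Nat.one_le_floor_iff _).2 ((one_le_div hd).2 (hU B hB))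
  have hterm : ∀ B ∈ K, Real.exp (-(7 * Real.log M * (U B / d))) ≤ (M ^ (7 * a B))⁻¹ := by
    intro B hB
    have h1 : (a B : ℝ) ≤ U B / d := Nat.floor_le (div_nonneg (hd.le.trans (hU B hB)) hd.le)
    have h2 : (M ^ (7 * a B))⁻¹ = Real.exp (-(7 * Real.log M * a B)) := by
      rw [Real.exp_neg, ← Real.exp_log (pow_pos hM0 _), Real.log_pow]
      push_cast
      ring_nf
    rw [h2]
    gcongr
  obtain ⟨n, hn⟩ : ∃ n, ∀ B ∈ K, a B ∈ Finset.Ico 1 n := by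
    refine ⟨K.sup a + 1, fun B hB => Finset.mem_Ico.2 ⟨ha1 B hB, ?_⟩⟩
    exact Nat.lt_succ_of_le (Finset.le_sup hB)
  calc ∑ B ∈ K, Real.exp (-(7 * Real.log M * (U B / d)))
      ≤ ∑ B ∈ K, (M ^ (7 * a B))⁻¹ := Finset.sum_le_sum hterm
    _ = ∑ α ∈ Finset.Ico 1 n, ∑ B ∈ K.filter (a · = α), (M ^ (7 * a B))⁻¹ :=
        (Finset.sum_fiberwise_of_maps_to hn _).symm
    _ ≤ ∑ α ∈ Finset.Ico 1 n, (1 / 8 : ℝ) ^ α := by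
        refine Finset.sum_le_sum fun α hα => ?_
        have hα := (Finset.mem_Ico.1 hα).1
        have h1 : ∑ B ∈ K.filter (a · = α), (M ^ (7 * a B))⁻¹ =
            (K.filter (a · = α)).card * (M ^ (7 * α))⁻¹ := by
          rw [← nsmul_eq_mul, ← Finset.sum_const]
          exact Finset.sum_congr rfl fun B hB => by rw [(Finset.mem_filter.1 hB).2]
        have h2 : ((K.filter (a · = α)).card : ℝ) ≤ M ^ (4 * α) := by
          refine le_trans (Nat.cast_le.2 (Finset.card_le_card fun B hB => ?_))
            ((hcount (α + 1)).trans (pow_le_pow_right₀ (by linarith) (by omega)))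
          have hB := Finset.mem_filter.1 hB
          refine Finset.mem_filter.2 ⟨hB.1, ?_⟩
          have h3 := (Nat.lt_floor_add_one (U B / d)).le
          rw [div_le_iff₀ hd] at h3
          rw [← hB.2]
          exact_mod_cast h3
        rw [h1]
        calc _ ≤ M ^ (4 * α) * (M ^ (7 * α))⁻¹ := by gcongr
          _ = (1 / M ^ 3) ^ α := by
            rw [← div_eq_mul_inv, show 7 * α = 4 * α + 3 * α by ring, pow_add, one_div, inv_pow,
              ← pow_mul]
            field_simp
          _ ≤ _ := by
            gcongr
            calc (8 : ℝ) = 2 ^ 3 := by norm_num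
              _ ≤ M ^ 3 := by gcongr
    _ ≤ (1 / 8) ^ 1 / (1 - 1 / 8) := geom_sum_Ico_le_of_lt_one (by norm_num) (by norm_num)
    _ ≤ 1 / 4 := by norm_num

lemma le_sum_inter_of_isDense {ι : Type*} [DecidableEq ι] {X : Finset (Finset ι)} {u : ι → ℝ}
    {d : ℝ} (hd : 0 < d) {F : Finset ι} (hF : IsDense X u d F) {A : Finset ι} (hA : A ∈ X)
    (hne : (A ∩ F).Nonempty) : d ≤ ∑ j ∈ A ∩ F, u j := by
  have hcov : coverIn {A} F = A ∩ F := by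
    ext j; simp [mem_coverIn, and_comm]
  obtain ⟨j, hj⟩ := hne
  have h1 : 1 ≤ chainLen {A} F := by
    have := chainLen_filter_succ_le (hcov ▸ hj)
    omega
  have h2 := hF {A} (by simpa using hA)
  rw [hcov] at h2
  refine le_trans ?_ h2
  exact le_mul_of_one_le_right hd.le (by exact_mod_cast h1)

lemma exp_mul_prod_le {ι : Type*} [DecidableEq ι] {T A : Finset ι} {p u : ι → ℝ} {θ s σ b U : ℝ}
    (hs0 : 0 ≤ s) (hs1 : s ≤ 1) (hσ : |σ| = 1) (hθ : 0 ≤ θ) (hp : ∀ j ∈ T, 0 ≤ p j ∧ p j ≤ 1)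
    (hpu : ∀ j ∈ T, p j * s = θ * u j) (hU : ∑ j ∈ T ∩ A, u j ≤ U) :
    Real.exp (-(σ * θ * ∑ j ∈ T ∩ A, u j) - b) *
      ∏ j ∈ T, (1 + p j * ((if j ∈ A then Real.exp (σ * s) else 1) - 1)) ≤
    Real.exp (θ * s * U - b) := by
  have hσ2 : σ ^ 2 = 1 := by rw [← sq_abs, hσ, one_pow]
  have hexp : Real.exp (σ * s) - 1 ≤ σ * s + s ^ 2 := by
    have h := (abs_le.1 (Real.abs_exp_sub_one_sub_id_le (x := σ * s) (by
      rw [abs_mul, hσ, one_mul, abs_of_nonneg hs0]; exact hs1))).2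
    rw [mul_pow, hσ2] at h
    linarith
  have hprod : ∏ j ∈ T, (1 + p j * ((if j ∈ A then Real.exp (σ * s) else 1) - 1)) ≤
      Real.exp (∑ j ∈ T ∩ A, (σ * θ * u j + θ * s * u j)) := by
    rw [← Finset.filter_mem_eq_inter, Finset.sum_filter, Real.exp_sum]
    refine Finset.prod_le_prod (fun j hj => ?_) fun j hj => ?_
    · split_ifs
      · have := mul_nonneg (hp j hj).1 (Real.exp_pos (σ * s)).le
        linarith [(hp j hj).2]
      · simp
    · split_ifs
      · have h1 : p j * (Real.exp (σ * s) - 1) ≤ σ * θ * u j + θ * s * u j :=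
          (mul_le_mul_of_nonneg_left hexp (hp j hj).1).trans
            (le_of_eq (by linear_combination (σ + s) * hpu j hj))
        have h2 := Real.add_one_le_exp (σ * θ * u j + θ * s * u j)
        linarith
      · simp
  refine (mul_le_mul_of_nonneg_left hprod (Real.exp_pos _).le).trans ?_
  rw [← Real.exp_add, Finset.sum_add_distrib, ← Finset.mul_sum, ← Finset.mul_sum]
  have := mul_le_mul_of_nonneg_left hU (mul_nonneg hθ hs0)
  gcongr
  linarith

section Sampling

variable {ι : Type*} [DecidableEq ι] [Fintype ι] [Nonempty ι]

lemma exists_uniform_sample {X : Finset (Finset ι)} {u : ι → ℝ} {d : ℝ} (hu : ∀ j, 0 ≤ u j)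
    (hd : 0 < d) {F : Finset ι} (hF : IsDense X u d F) {T : Finset ι} (hTF : T ⊆ F) {ε ρ : ℝ}
    (hε0 : 0 < ε) (hε1 : ε ≤ 1) (hρ : ρ * ε ^ 2 = 28 * Real.log (Fintype.card ι + 1))
    (hT : ∀ j ∈ T, ρ * u j ≤ d) :
    ∃ S ⊆ T, (S.card : ℝ) ≤ 2 * (ρ / d * ∑ j ∈ T, u j) ∧
      ∀ A ∈ X, |d / ρ * (S ∩ A).card - ∑ j ∈ T ∩ A, u j| ≤ ε * ∑ j ∈ A ∩ F, u j := by
  set M : ℝ := Fintype.card ι + 1 with hM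
  have hM2 : 2 ≤ M := by
    have : (1 : ℝ) ≤ Fintype.card ι := by exact_mod_cast Fintype.card_pos
    linarith
  have hlog : 0 < Real.log M := Real.log_pos (by linarith)
  have hρ0 : 0 < ρ := by
    have : 0 < ρ * ε ^ 2 := by rw [hρ]; positivity
    exact (pos_iff_pos_of_mul_pos this).2 (by positivity)
  set P : ℝ := ρ / d * ∑ j ∈ T, u j with hP
  have hP0 : 0 ≤ P := mul_nonneg (by positivity) (Finset.sum_nonneg fun j _ => hu j)
  rcases hP0.eq_or_lt with hP0 | hPpos
  · refine ⟨∅, Finset.empty_subset _, by simp [← hP0], fun A _ => ?_⟩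
    have h0 : ∑ j ∈ T, u j = 0 :=
      (mul_eq_zero.1 hP0.symm).resolve_left (by positivity)
    have h1 : ∑ j ∈ T ∩ A, u j = 0 := by
      refine Finset.sum_eq_zero fun j hj => ?_
      exact (Finset.sum_eq_zero_iff_of_nonneg fun j _ => hu j).1 h0 j (Finset.mem_inter.1 hj).1
    simpa [h1] using mul_nonneg hε0.le (Finset.sum_nonneg fun j _ => hu j)
  set s : ℝ := ε / 2 with hs
  set θ : ℝ := s * ρ / d with hθ
  have hθ0 : 0 < θ := by positivity
  set Q := (X.image (· ∩ F)).filter (·.Nonempty) with hQ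
  set U : Finset ι → ℝ := fun B => ∑ j ∈ B, u j with hU
  set K : Finset (Finset ι × ℝ) := Q ×ˢ {1, -1} with hK
  set β : Finset ι × ℝ → ℝ := fun k =>
    Real.exp (-(k.2 * θ * ∑ j ∈ T ∩ k.1, u j) - θ * ε * U k.1) with hβ
  set x : Finset ι × ℝ → ι → ℝ := fun k j => if j ∈ k.1 then Real.exp (k.2 * s) else 1 with hx
  set p : ι → ℝ := fun j => ρ * u j / d with hp
  have hp01 : ∀ j ∈ T, 0 ≤ p j ∧ p j ≤ 1 := fun j hj =>
    ⟨div_nonneg (mul_nonneg hρ0.le (hu j)) hd.le, (div_le_one hd).2 (hT j hj)⟩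
  have hpsum : ∑ j ∈ T, p j = P := by
    rw [hP, Finset.mul_sum]
    exact Finset.sum_congr rfl fun j _ => by rw [hp]; ring
  have habs : ∀ k ∈ K, |k.2| = 1 := fun k hk => by
    have := (Finset.mem_product.1 hk).2
    simp only [Finset.mem_insert, Finset.mem_singleton] at this
    rcases this with h | h <;> simp [h]
  have hUd : ∀ B ∈ Q, d ≤ U B := by
    intro B hB
    obtain ⟨hB, hne⟩ := Finset.mem_filter.1 hB
    obtain ⟨A, hA, rfl⟩ := Finset.mem_image.1 hB
    exact le_sum_inter_of_isDense hd hF hA hne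
  have hmean : ∑ k ∈ K, β k * ∏ j ∈ T, (1 + p j * (x k j - 1)) ≤ 1 / 2 := by
    have hterm : ∀ k ∈ K, β k * ∏ j ∈ T, (1 + p j * (x k j - 1)) ≤
        Real.exp (-(7 * Real.log M * (U k.1 / d))) := by
      intro k hk
      refine (exp_mul_prod_le (U := U k.1) (by positivity) (by linarith) (habs k hk) hθ0.le hp01
        (fun j _ => by rw [hp, hθ]; ring) ?_).trans (le_of_eq ?_)
      · exact Finset.sum_le_sum_of_subset_of_nonneg Finset.inter_subset_right fun j _ _ => hu j
      · congr 1
        rw [hθ, hs]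
        field_simp
        linear_combination (-(U k.1)) * hρ
    refine (Finset.sum_le_sum hterm).trans ?_
    rw [hK, Finset.sum_product]
    have h1 := sum_exp_neg_le Q U hd hM2 hUd fun α => by
      have h2 := card_lightTraces_le hu hd hF α
      refine le_trans (Nat.cast_le.2 (Finset.card_le_card ?_)) (?_ :
        ((lightTraces X F u (α * d)).card : ℝ) ≤ _)
      · exact Finset.filter_subset_filter _ (Finset.filter_subset _ _)
      · rw [hM]
        exact_mod_cast h2
    have h3 : ∀ B : Finset ι, ∑ y ∈ ({1, -1} : Finset ℝ),
        Real.exp (-(7 * Real.log M * (U (B, y).1 / d))) =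
          2 * Real.exp (-(7 * Real.log M * (U B / d))) := fun B => by
      rw [Finset.sum_pair (by norm_num)]
      ring
    simp only [h3, ← Finset.mul_sum]
    linarith
  obtain ⟨S, hST, hS⟩ := exists_subset_sum_prod_le K x p (1 / (2 * P)) T hp01 β
  rw [hpsum] at hS
  have hS1 : ∑ k ∈ K, β k * ∏ j ∈ S, x k j + 1 / (2 * P) * S.card ≤ 1 := by
    refine hS.trans ?_
    have : 1 / (2 * P) * P = 1 / 2 := by field_simp
    linarith
  have hnn : ∀ k ∈ K, 0 ≤ β k * ∏ j ∈ S, x k j := fun k _ =>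
    mul_nonneg (Real.exp_pos _).le (Finset.prod_nonneg fun j _ => by
      rw [hx]; dsimp only; split_ifs <;> positivity)
  refine ⟨S, hST, ?_, fun A hA => ?_⟩
  · have h1 := Finset.sum_nonneg hnn
    have h2 : 1 / (2 * P) * S.card ≤ 1 := by linarith
    rwa [one_div, inv_mul_le_iff₀ (by positivity), mul_one] at h2
  · have hTA : T ∩ (A ∩ F) = T ∩ A := by
      ext j; simp only [Finset.mem_inter]; have := @hTF j; tauto
    have hSA : S ∩ (A ∩ F) = S ∩ A := by
      ext j; simp only [Finset.mem_inter]; have := @hTF j; have := @hST j; tauto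
    rcases (A ∩ F).eq_empty_or_nonempty with he | hne
    · rw [← hSA, ← hTA, he]; simp
    have hmem : A ∩ F ∈ Q := Finset.mem_filter.2 ⟨Finset.mem_image_of_mem _ hA, hne⟩
    have key : ∀ σ ∈ ({1, -1} : Finset ℝ),
        σ * (d / ρ * (S ∩ A).card - ∑ j ∈ T ∩ A, u j) ≤ ε * ∑ j ∈ A ∩ F, u j := by
      intro σ hσ
      have hk : (A ∩ F, σ) ∈ K := Finset.mem_product.2 ⟨hmem, hσ⟩
      have h1 : β (A ∩ F, σ) * ∏ j ∈ S, x (A ∩ F, σ) j ≤ 1 := by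
        have h2 := Finset.single_le_sum hnn hk
        have h3 : 0 ≤ 1 / (2 * P) * S.card := by positivity
        linarith
      have h4 : ∏ j ∈ S, x (A ∩ F, σ) j = Real.exp ((S ∩ A).card * (σ * s)) := by
        rw [hx, Real.exp_nat_mul]
        dsimp only
        rw [← Finset.prod_filter, Finset.prod_const, Finset.filter_mem_eq_inter, hSA]
      rw [h4, hβ, ← Real.exp_add, Real.exp_le_one_iff, hTA] at h1
      dsimp only at h1
      have h5 : σ * (d / ρ * (S ∩ A).card - ∑ j ∈ T ∩ A, u j) =
          ((S ∩ A).card * (σ * s) - σ * θ * ∑ j ∈ T ∩ A, u j) / θ := by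
        have hs0 : s ≠ 0 := by positivity
        rw [hθ]; field_simp
      rw [h5, div_le_iff₀ hθ0]
      linarith
    have h1 := key 1 (by simp)
    have h2 := key (-1) (by simp)
    rw [abs_le]
    constructor <;> linarith

end Sampling

lemma sum_scales_min_le {w μ : ℝ} (hw : 0 ≤ w) (hμ : 0 < μ) (q n : ℕ) :
    ∑ i ∈ Finset.range n, (if μ * 2 ^ i ≤ 2 ^ q * w then min w (μ * 2 ^ i) else 0) ≤
      (q + 2) * w := by
  induction q with
  | zero =>
    have h : ∀ n : ℕ, ∑ i ∈ Finset.range n, (if μ * 2 ^ i ≤ w then min w (μ * 2 ^ i) else 0) ≤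
        min (2 * w) (μ * 2 ^ n) := by
      intro n
      induction n with
      | zero => simpa using ⟨hw, hμ.le⟩
      | succ n ih =>
        rw [Finset.sum_range_succ, pow_succ]
        have h0 : 0 < μ * 2 ^ n := by positivity
        obtain ⟨ih1, ih2⟩ := le_min_iff.1 ih
        split_ifs with h
        · rw [min_eq_right h]
          exact le_min (by linarith) (by linarith)
        · exact le_min (by linarith) (by linarith)
    simpa using (h n).trans (min_le_left _ _)
  | succ q ih =>
    have hsplit : ∀ i, (if μ * 2 ^ i ≤ 2 ^ (q + 1) * w then min w (μ * 2 ^ i) else 0) ≤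
        (if μ * 2 ^ i ≤ 2 ^ q * w then min w (μ * 2 ^ i) else 0) +
          if 2 ^ q * w < μ * 2 ^ i ∧ μ * 2 ^ i ≤ 2 ^ (q + 1) * w then w else 0 := by
      intro i
      have h0 : 0 ≤ min w (μ * 2 ^ i) := le_min hw (by positivity)
      have h1 := min_le_left w (μ * 2 ^ i)
      split_ifs <;> first | linarith | (exfalso; simp_all)
    have hone : ∑ i ∈ Finset.range n,
        (if 2 ^ q * w < μ * 2 ^ i ∧ μ * 2 ^ i ≤ 2 ^ (q + 1) * w then w else 0) ≤ w := by
      rw [← Finset.sum_filter, Finset.sum_const, nsmul_eq_mul]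
      refine mul_le_of_le_one_left hw ?_
      have : ∀ i i' : ℕ, i < i' → 2 ^ q * w < μ * 2 ^ i → μ * 2 ^ i' ≤ 2 ^ (q + 1) * w → False := by
        intro i i' hlt h1 h2
        have h3 : μ * 2 ^ (i + 1) ≤ μ * 2 ^ i' := by
          gcongr
          · norm_num
          · omega
        rw [pow_succ] at h3 h2
        linarith
      have hc : ((Finset.range n).filter fun i =>
          2 ^ q * w < μ * 2 ^ i ∧ μ * 2 ^ i ≤ 2 ^ (q + 1) * w).card ≤ 1 := by
        refine Finset.card_le_one.2 fun a ha b hb => ?_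
        have ha := (Finset.mem_filter.1 ha).2
        have hb := (Finset.mem_filter.1 hb).2
        rcases lt_trichotomy a b with h | h | h
        · exact (this a b h ha.1 hb.2).elim
        · exact h
        · exact (this b a h hb.1 ha.2).elim
      exact_mod_cast hc
    refine (Finset.sum_le_sum fun i _ => hsplit i).trans ?_
    rw [Finset.sum_add_distrib]
    push_cast
    linarith

lemma sum_scales_sub_le {g : ℝ → ℝ} {L : ℝ} (hg0 : ∀ x, 0 ≤ g x) (hgL : ∀ x, g x ≤ L) (μ : ℝ)
    (q n : ℕ) : ∑ i ∈ Finset.range n, (g (μ * 2 ^ i / 2 ^ q) - g (μ * 2 ^ i)) ≤ q * L := by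
  induction q with
  | zero => simp
  | succ q ih =>
    have h : ∑ i ∈ Finset.range n, (g (μ * 2 ^ i / 2 ^ (q + 1)) - g (μ * 2 ^ i / 2 ^ q)) ≤ L := by
      have h1 : ∀ i, g (μ * 2 ^ i / 2 ^ q) = g (μ * 2 ^ (i + 1) / 2 ^ (q + 1)) := fun i => by
        congr 1
        rw [pow_succ, pow_succ]
        field_simp
      simp only [h1]
      rw [Finset.sum_range_sub' (fun i => g (μ * 2 ^ i / 2 ^ (q + 1)))]
      have := hg0 (μ * 2 ^ n / 2 ^ (q + 1))
      have := hgL (μ * 2 ^ 0 / 2 ^ (q + 1))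
      linarith
    have h2 : ∑ i ∈ Finset.range n, (g (μ * 2 ^ i / 2 ^ (q + 1)) - g (μ * 2 ^ i)) =
        ∑ i ∈ Finset.range n, (g (μ * 2 ^ i / 2 ^ (q + 1)) - g (μ * 2 ^ i / 2 ^ q)) +
          ∑ i ∈ Finset.range n, (g (μ * 2 ^ i / 2 ^ q) - g (μ * 2 ^ i)) := by
      rw [← Finset.sum_add_distrib]
      exact Finset.sum_congr rfl fun i _ => by ring
    rw [h2]
    push_cast
    linarith

lemma one_le_of_mul_sq_eq_log {ι : Type*} [Fintype ι] [Nonempty ι] {ε ρ : ℝ} (hε0 : 0 < ε) (hε1 : ε ≤ 1)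
    (hρ : ρ * ε ^ 2 = 28 * Real.log (Fintype.card ι + 1)) : 1 ≤ ρ := by
  have h1 : Real.log 2 ≤ Real.log (Fintype.card ι + 1) := by
    have : (1 : ℝ) ≤ Fintype.card ι := by exact_mod_cast Fintype.card_pos
    exact Real.log_le_log (by norm_num) (by linarith)
  have h2 := Real.log_two_gt_d9
  have h3 : 0 < ε ^ 2 := by positivity
  have h4 : ε ^ 2 ≤ 1 := pow_le_one₀ hε0.le hε1
  by_contra! h
  have := mul_lt_mul_of_pos_right h h3
  linarith

section Sparsifier

variable {ι : Type*} [DecidableEq ι] [Fintype ι] [Nonempty ι]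

lemma exists_layer_sample {X : Finset (Finset ι)} {w : ι → ℝ} {d : ℝ} (hw : ∀ j, 0 ≤ w j)
    (hd : 0 < d) {F : Finset ι} (hF : IsDense X (fun j => min (w j) d) d F) {T : Finset ι}
    (hTF : T ⊆ F) {ε ρ : ℝ} (hε0 : 0 < ε) (hε1 : ε ≤ 1)
    (hρ : ρ * ε ^ 2 = 28 * Real.log (Fintype.card ι + 1)) :
    ∃ S ⊆ T, ∃ v : ι → ℝ, (∀ j, 0 ≤ v j) ∧
      (S.card : ℝ) ≤ 2 * (ρ / d * ∑ j ∈ T, min (w j) d) ∧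
      ∀ A ∈ X, |∑ j ∈ S ∩ A, v j - ∑ j ∈ T ∩ A, w j| ≤ ε * ∑ j ∈ A ∩ F, min (w j) d := by
  have hρ1 : 1 ≤ ρ := one_le_of_mul_sq_eq_log hε0 hε1 hρ
  have hρ0 : 0 < ρ := by linarith
  set hi := T.filter fun j => d ≤ ρ * w j with hhi
  set lo := T.filter fun j => ¬ d ≤ ρ * w j with hlo
  have hmin : ∀ j ∈ lo, min (w j) d = w j := fun j hj => by
    have h1 := not_le.1 (Finset.mem_filter.1 hj).2
    have h2 := le_mul_of_one_le_left (hw j) hρ1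
    exact min_eq_left (by linarith)
  obtain ⟨S, hS, hcard, hdev⟩ := exists_uniform_sample (u := fun j => min (w j) d)
    (fun j => le_min (hw j) hd.le) hd hF ((Finset.filter_subset _ T).trans hTF : lo ⊆ F)
    hε0 hε1 hρ (fun j hj => by
      rw [hmin j hj]
      exact (not_le.1 (Finset.mem_filter.1 hj).2).le)
  have hdisj : Disjoint hi S :=
    (Finset.disjoint_filter_filter_not T T _).mono_right hS
  refine ⟨hi ∪ S, Finset.union_subset (Finset.filter_subset _ _)
    (hS.trans (Finset.filter_subset _ _)), fun j => if d ≤ ρ * w j then w j else d / ρ,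
    fun j => ?_, ?_, fun A hA => ?_⟩
  · dsimp only
    split_ifs
    · exact hw j
    · positivity
  · rw [Finset.card_union_of_disjoint hdisj, Nat.cast_add]
    have h1 : (hi.card : ℝ) ≤ ρ / d * ∑ j ∈ hi, min (w j) d := by
      rw [Finset.mul_sum, ← nsmul_one, ← Finset.sum_const]
      refine Finset.sum_le_sum fun j hj => ?_
      have h2 := (Finset.mem_filter.1 hj).2
      rw [div_mul_eq_mul_div, one_le_div hd]
      rcases min_cases (w j) d with h | h
      · rw [h.1]; exact h2
      · rw [h.1]; exact le_mul_of_one_le_left hd.le hρ1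
    have h2 : ∑ j ∈ hi, min (w j) d + ∑ j ∈ lo, min (w j) d = ∑ j ∈ T, min (w j) d :=
      Finset.sum_filter_add_sum_filter_not _ _ _
    have h3 : 0 ≤ ρ / d * ∑ j ∈ hi, min (w j) d :=
      mul_nonneg (by positivity) (Finset.sum_nonneg fun j _ => le_min (hw j) hd.le)
    rw [← h2, mul_add]
    linarith
  · have h1 : ∑ j ∈ (hi ∪ S) ∩ A, (if d ≤ ρ * w j then w j else d / ρ) =
        ∑ j ∈ hi ∩ A, w j + d / ρ * (S ∩ A).card := by
      rw [Finset.union_inter_distrib_right, Finset.sum_union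
        (hdisj.mono Finset.inter_subset_left Finset.inter_subset_left)]
      congr 1
      · refine Finset.sum_congr rfl fun j hj => if_pos ?_
        exact (Finset.mem_filter.1 (Finset.mem_inter.1 hj).1).2
      · rw [mul_comm, ← nsmul_eq_mul, ← Finset.sum_const]
        refine Finset.sum_congr rfl fun j hj => if_neg ?_
        exact (Finset.mem_filter.1 (hS (Finset.mem_inter.1 hj).1)).2
    have h2 : ∑ j ∈ T ∩ A, w j = ∑ j ∈ hi ∩ A, w j + ∑ j ∈ lo ∩ A, min (w j) d := by
      rw [← Finset.filter_union_filter_not_eq (fun j => d ≤ ρ * w j) T,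
        Finset.union_inter_distrib_right, Finset.sum_union
        ((Finset.disjoint_filter_filter_not T T _).mono Finset.inter_subset_left
          Finset.inter_subset_left)]
      congr 1
      exact Finset.sum_congr rfl fun j hj => (hmin j (Finset.mem_inter.1 hj).1).symm
    rw [h1, h2, add_sub_add_left_eq_sub]
    exact hdev A hA

theorem exists_sparsifier (X : Finset (Finset ι)) {w : ι → ℝ} (hw : ∀ j, 0 ≤ w j) {L : ℝ}
    (hL : ∀ F, (chainLen X F : ℝ) ≤ L) {q : ℕ} (hq : Fintype.card ι ≤ 2 ^ q) {ε ρ : ℝ}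
    (hε0 : 0 < ε) (hε1 : ε ≤ 1)
    (hρ : ρ * (ε / (q + 2)) ^ 2 = 28 * Real.log (Fintype.card ι + 1)) :
    ∃ (S : Finset ι) (v : ι → ℝ), (∀ j, 0 ≤ v j) ∧ (∀ j ∈ S, 0 < w j) ∧
      (S.card : ℝ) ≤ 2 * ρ * (2 * (q * L) + 2) ∧
      ∀ A ∈ X, |∑ j ∈ S ∩ A, v j - ∑ j ∈ A, w j| ≤ ε * ∑ j ∈ A, w j := by
  classical
  have hq2 : (0 : ℝ) < q + 2 := by positivity
  have hε'0 : 0 < ε / (q + 2) := by positivity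
  have hε'1 : ε / (q + 2) ≤ 1 := by
    rw [div_le_one hq2]
    have : (0 : ℝ) ≤ q := Nat.cast_nonneg q
    linarith
  have hρ1 : 1 ≤ ρ := one_le_of_mul_sq_eq_log hε'0 hε'1 hρ
  have hρ0 : 0 < ρ := by linarith
  set W : Finset ι := Finset.univ.filter fun j => 0 < w j with hW
  obtain ⟨μ, hμ, hμw⟩ : ∃ μ : ℝ, 0 < μ ∧ ∀ j ∈ W, μ ≤ w j := by
    rcases W.eq_empty_or_nonempty with h | h
    · exact ⟨1, one_pos, by simp [h]⟩
    · obtain ⟨i, hi, hmin⟩ := Finset.exists_min_image W w h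
      exact ⟨w i, (Finset.mem_filter.1 hi).2, hmin⟩
  obtain ⟨n, hn⟩ : ∃ n : ℕ, ∀ j, 2 ^ q * w j < μ * 2 ^ n := by
    obtain ⟨i, -, hmax⟩ := Finset.exists_max_image Finset.univ w Finset.univ_nonempty
    obtain ⟨n, hn⟩ := pow_unbounded_of_one_lt (2 ^ q * w i / μ) (one_lt_two (α := ℝ))
    refine ⟨n, fun j => ?_⟩
    rw [div_lt_iff₀ hμ] at hn
    have := mul_le_mul_of_nonneg_left (hmax j (Finset.mem_univ j)) (by positivity : (0:ℝ) ≤ 2 ^ q)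
    linarith
  set d : ℕ → ℝ := fun i => μ * 2 ^ i with hd
  have hd0 : ∀ i, 0 < d i := fun i => by positivity
  have hdsucc : ∀ i, d (i + 1) = 2 * d i := fun i => by rw [hd]; ring
  set V : ℝ → Finset ι := fun x => Finset.univ.filter fun j => x ≤ w j with hV
  have hmemV : ∀ x j, j ∈ V x ↔ x ≤ w j := fun x j => by simp [hV]
  have hF := fun i => exists_isDense_between X (u := fun j => min (w j) (d i)) (hd0 i)
    (H := V (d i)) (V := V (d i / 2 ^ q))
    (fun j hj => (hmemV _ _).2 ((div_le_self (hd0 i).le (one_le_pow₀ one_le_two)).trans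
      ((hmemV _ _).1 hj))) (fun j hj => le_min ((hmemV _ _).1 hj) le_rfl)
  choose F hHF hFV hdense hloss using hF
  have hmemF : ∀ i, ∀ j ∈ F i, d i ≤ 2 ^ q * w j := fun i j hj => by
    have := (hmemV _ _).1 (hFV i hj)
    rwa [div_le_iff₀' (by positivity)] at this
  set top : ι → ℕ := fun j => Nat.findGreatest (fun i => j ∈ F i) n with htop
  set T : ℕ → Finset ι := fun i => W.filter fun j => top j = i with hT
  have htopF : ∀ j ∈ W, j ∈ F (top j) := fun j hj =>
    Nat.findGreatest_spec (P := fun i => j ∈ F i) (Nat.zero_le n)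
      (hHF 0 ((hmemV _ _).2 (by simpa [hd] using hμw j hj)))
  have htopn : ∀ j ∈ W, top j < n := fun j hj => by
    refine lt_of_le_of_ne (Nat.findGreatest_le n) fun h => ?_
    have h1 := hmemF _ j (htopF j hj)
    rw [h] at h1
    exact absurd (hn j) (not_lt.2 h1)
  have hTF : ∀ i, T i ⊆ F i := fun i j hj => by
    obtain ⟨hjW, rfl⟩ := Finset.mem_filter.1 hj
    exact htopF j hjW
  have hTsucc : ∀ i, ∀ j ∈ T i, j ∉ F (i + 1) := fun i j hj => by
    obtain ⟨hjW, rfl⟩ := Finset.mem_filter.1 hj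
    exact Nat.findGreatest_is_greatest (P := fun i => j ∈ F i) (Nat.lt_succ_self _) (htopn j hjW)
  have hsample := fun i => exists_layer_sample hw (hd0 i) (hdense i) (hTF i) hε'0 hε'1 hρ
  choose Sl hSlT vl hvl hSlcard hSldev using hsample
  set S : Finset ι := W.filter fun j => j ∈ Sl (top j) with hS
  have hfib : ∀ i, S.filter (top · = i) = Sl i := fun i => by
    ext j
    simp only [hS, Finset.mem_filter]
    constructor
    · rintro ⟨⟨_, h⟩, rfl⟩
      exact h
    · intro h
      obtain ⟨hjW, rfl⟩ := Finset.mem_filter.1 (hSlT i h)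
      exact ⟨⟨hjW, h⟩, rfl⟩
  have hSW : ∀ j ∈ S, j ∈ W := fun j hj => (Finset.mem_filter.1 hj).1
  refine ⟨S, fun j => vl (top j) j, fun j => hvl _ j,
    fun j hj => (Finset.mem_filter.1 (hSW j hj)).2, ?_, fun A hA => ?_⟩
  · set g : ℝ → ℝ := fun x => chainLen X (V x) with hg
    have hlayer : ∀ i, ρ / d i * ∑ j ∈ T i, min (w j) (d i) ≤
        ρ * ((T i).card * (2 / 2 ^ q) +
          2 * (g (2 * μ * 2 ^ i / 2 ^ q) - g (2 * μ * 2 ^ i))) := by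
      intro i
      have hdi : 2 * μ * 2 ^ i = d (i + 1) := by rw [hd]; ring
      rw [hdi]
      have h1 : ∑ j ∈ (T i).filter (· ∈ V (d (i + 1) / 2 ^ q)), min (w j) (d i) ≤
          d (i + 1) * (g (d (i + 1) / 2 ^ q) - g (d (i + 1))) := by
        calc _ ≤ ∑ j ∈ V (d (i + 1) / 2 ^ q) \ F (i + 1), min (w j) (d i) := by
              refine Finset.sum_le_sum_of_subset_of_nonneg (fun j hj => ?_)
                fun j _ _ => le_min (hw j) (hd0 i).le
              obtain ⟨h1, h2⟩ := Finset.mem_filter.1 hj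
              exact Finset.mem_sdiff.2 ⟨h2, hTsucc i j h1⟩
          _ ≤ ∑ j ∈ V (d (i + 1) / 2 ^ q) \ F (i + 1), min (w j) (d (i + 1)) := by
              refine Finset.sum_le_sum fun j _ => min_le_min_left _ ?_
              linarith [hdsucc i, hd0 i]
          _ ≤ _ := (hloss (i + 1)).trans (by
              have h2 : (chainLen X (V (d (i + 1))) : ℝ) ≤ chainLen X (F (i + 1)) :=
                Nat.cast_le.2 (chainLen_mono X (hHF (i + 1)))
              have := (hd0 (i + 1)).le
              gcongr)
      have h2 : ∑ j ∈ (T i).filter (· ∉ V (d (i + 1) / 2 ^ q)), min (w j) (d i) ≤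
          (T i).card * (d (i + 1) / 2 ^ q) := by
        refine (Finset.sum_le_card_nsmul _ _ (d (i + 1) / 2 ^ q) fun j hj => ?_).trans ?_
        · have h3 := (Finset.mem_filter.1 hj).2
          rw [hmemV, not_le] at h3
          exact (min_le_left _ _).trans h3.le
        · rw [nsmul_eq_mul]
          have := (hd0 (i + 1)).le
          gcongr
          exact Finset.filter_subset _ _
      rw [← Finset.sum_filter_add_sum_filter_not (T i) (· ∈ V (d (i + 1) / 2 ^ q))]
      calc _ ≤ ρ / d i * (d (i + 1) * (g (d (i + 1) / 2 ^ q) - g (d (i + 1))) +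
            (T i).card * (d (i + 1) / 2 ^ q)) := by
              have := (hd0 i).le
              gcongr
        _ = _ := by
          have := (hd0 i).ne'
          generalize g (d (i + 1) / 2 ^ q) = y
          generalize g (d (i + 1)) = z
          rw [hdsucc]
          field_simp
          ring
    have hTcard : ∑ i ∈ Finset.range n, ((T i).card : ℝ) ≤ 2 ^ q := by
      have h1 := Finset.card_eq_sum_card_fiberwise (s := W) (f := top) (t := Finset.range n)
        fun j hj => by simpa using htopn j hj
      have h2 : ∑ i ∈ Finset.range n, (T i).card ≤ 2 ^ q := by
        rw [← h1]
        exact (Finset.card_le_univ W).trans hq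
      exact_mod_cast h2
    have hScard : (S.card : ℝ) = ∑ i ∈ Finset.range n, ((Sl i).card : ℝ) := by
      have h1 := Finset.card_eq_sum_card_fiberwise (s := S) (f := top) (t := Finset.range n)
        fun j hj => by simpa using htopn j (hSW j hj)
      simp only [hfib] at h1
      exact_mod_cast h1
    rw [hScard]
    calc ∑ i ∈ Finset.range n, ((Sl i).card : ℝ)
        ≤ ∑ i ∈ Finset.range n, 2 * (ρ * ((T i).card * (2 / 2 ^ q) +
          2 * (g (2 * μ * 2 ^ i / 2 ^ q) - g (2 * μ * 2 ^ i)))) :=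
          Finset.sum_le_sum fun i _ => (hSlcard i).trans
            (mul_le_mul_of_nonneg_left (hlayer i) zero_le_two)
      _ = 2 * ρ * ((∑ i ∈ Finset.range n, ((T i).card : ℝ)) * (2 / 2 ^ q) +
          2 * ∑ i ∈ Finset.range n, (g (2 * μ * 2 ^ i / 2 ^ q) - g (2 * μ * 2 ^ i))) := by
          rw [Finset.sum_mul, Finset.mul_sum, ← Finset.sum_add_distrib, Finset.mul_sum]
          exact Finset.sum_congr rfl fun i _ => by ring
      _ ≤ 2 * ρ * (2 ^ q * (2 / 2 ^ q) + 2 * (q * L)) := by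
          have := sum_scales_sub_le (g := g) (fun x => Nat.cast_nonneg _) (fun x => hL _)
            (2 * μ) q n
          gcongr
      _ = _ := by
          rw [mul_div_cancel₀ _ (by positivity)]
          ring
  · have h1 : ∑ j ∈ S ∩ A, vl (top j) j = ∑ i ∈ Finset.range n, ∑ j ∈ Sl i ∩ A, vl i j := by
      rw [← Finset.sum_fiberwise_of_maps_to (s := S ∩ A) (t := Finset.range n) (g := top)
        fun j hj => by simpa using htopn j (hSW j (Finset.mem_inter.1 hj).1)]
      refine Finset.sum_congr rfl fun i _ => ?_
      rw [← Finset.filter_inter, hfib]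
      refine Finset.sum_congr rfl fun j hj => ?_
      rw [(Finset.mem_filter.1 (hSlT i (Finset.mem_inter.1 hj).1)).2]
    have h2 : ∑ j ∈ A, w j = ∑ i ∈ Finset.range n, ∑ j ∈ T i ∩ A, w j := by
      have h3 : ∑ j ∈ W ∩ A, w j = ∑ j ∈ A, w j :=
        Finset.sum_subset Finset.inter_subset_right fun j hjA hj => by
          have h4 : j ∉ W := fun h => hj (Finset.mem_inter.2 ⟨h, hjA⟩)
          have h5 : ¬ 0 < w j := fun h => h4 (Finset.mem_filter.2 ⟨Finset.mem_univ j, h⟩)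
          exact le_antisymm (not_lt.1 h5) (hw j)
      rw [← h3, ← Finset.sum_fiberwise_of_maps_to (s := W ∩ A) (t := Finset.range n) (g := top)
        fun j hj => by simpa using htopn j (Finset.mem_inter.1 hj).1]
      refine Finset.sum_congr rfl fun i _ => ?_
      rw [← Finset.filter_inter]
    have h3 : ∀ i, ∑ j ∈ A ∩ F i, min (w j) (d i) ≤
        ∑ j ∈ A, if μ * 2 ^ i ≤ 2 ^ q * w j then min (w j) (μ * 2 ^ i) else 0 := by
      intro i
      rw [← Finset.sum_filter]
      refine Finset.sum_le_sum_of_subset_of_nonneg (fun j hj => ?_)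
        fun j _ _ => le_min (hw j) (hd0 i).le
      obtain ⟨hjA, hjF⟩ := Finset.mem_inter.1 hj
      exact Finset.mem_filter.2 ⟨hjA, hmemF i j hjF⟩
    calc |∑ j ∈ S ∩ A, vl (top j) j - ∑ j ∈ A, w j|
        = |∑ i ∈ Finset.range n, (∑ j ∈ Sl i ∩ A, vl i j - ∑ j ∈ T i ∩ A, w j)| := by
          rw [h1, h2, Finset.sum_sub_distrib]
      _ ≤ ∑ i ∈ Finset.range n, ε / (q + 2) *
          ∑ j ∈ A, if μ * 2 ^ i ≤ 2 ^ q * w j then min (w j) (μ * 2 ^ i) else 0 :=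
          (Finset.abs_sum_le_sum_abs _ _).trans (Finset.sum_le_sum fun i _ =>
            (hSldev i A hA).trans (mul_le_mul_of_nonneg_left (h3 i) hε'0.le))
      _ = ε / (q + 2) * ∑ j ∈ A, ∑ i ∈ Finset.range n,
          if μ * 2 ^ i ≤ 2 ^ q * w j then min (w j) (μ * 2 ^ i) else 0 := by
          rw [← Finset.mul_sum, Finset.sum_comm]
      _ ≤ ε / (q + 2) * ∑ j ∈ A, (q + 2) * w j := by
          gcongr with j _
          exact sum_scales_min_le (hw j) hμ q n
      _ = ε * ∑ j ∈ A, w j := by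
          rw [← Finset.mul_sum]
          field_simp

end Sparsifier

section AffineChains

variable {ι A : Type*} [DecidableEq ι] [AddCommGroup A] {n : ℕ}

lemma IsDropSeq.exists_injOn {φ : (Fin n → ℕ) × ℕ →+ (ι → A)} {Y : Finset (Finset ι)}
    (hY : ∀ B ∈ Y, ∃ y ≤ 1, ∀ j, j ∈ B ↔ φ y j ≠ 0) {l : List ι} (hl : IsDropSeq Y l) :
    ∃ Q : Finset ((Fin n → ℕ) × ℕ), Q.card = 2 ^ l.length ∧ (∀ y ∈ Q, y ≤ l.length • 1) ∧
      Set.InjOn φ Q ∧ ∀ j, (∀ B ∈ Y, j ∉ B) → ∀ y ∈ Q, φ y j = 0 := by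
  induction l generalizing Y with
  | nil => exact ⟨{0}, by simp, by simp, by simp, by simp⟩
  | cons j l ih =>
    obtain ⟨⟨B, hB, hjB⟩, hl⟩ := hl
    obtain ⟨Q, hcard, hle, hinj, hzero⟩ := ih (fun C hC => hY C (Finset.mem_filter.1 hC).1) hl
    obtain ⟨y₀, hy₀, hsupp⟩ := hY B hB
    have hj : ∀ y ∈ Q, φ y j = 0 := hzero j fun C hC => (Finset.mem_filter.1 hC).2
    have hj₀ : ∀ y ∈ Q, φ (y₀ + y) j ≠ 0 := fun y hy => by
      rw [map_add, Pi.add_apply, hj y hy, add_zero]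
      exact (hsupp j).1 hjB
    have hdisj : Disjoint Q (Q.image (y₀ + ·)) := by
      refine Finset.disjoint_left.2 fun y hy hy' => ?_
      obtain ⟨z, hz, rfl⟩ := Finset.mem_image.1 hy'
      exact hj₀ z hz (hj _ hy)
    refine ⟨Q ∪ Q.image (y₀ + ·), ?_, fun y hy => ?_, ?_, fun i hi y hy => ?_⟩
    · rw [Finset.card_union_of_disjoint hdisj,
        Finset.card_image_of_injective _ (add_right_injective y₀), hcard, List.length_cons]
      ring
    · rw [List.length_cons, succ_nsmul']
      rcases Finset.mem_union.1 hy with hy | hy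
      · exact (hle y hy).trans le_add_self
      · obtain ⟨z, hz, rfl⟩ := Finset.mem_image.1 hy
        exact add_le_add hy₀ (hle z hz)
    · intro y hy y' hy' h
      rw [Finset.mem_coe, Finset.mem_union, Finset.mem_image] at hy hy'
      rcases hy with hy | ⟨z, hz, rfl⟩ <;> rcases hy' with hy' | ⟨z', hz', rfl⟩
      · exact hinj hy hy' h
      · exact (hj₀ z' hz' (by rw [← hj y hy]; exact (congrFun h j).symm)).elim
      · exact (hj₀ z hz (by rw [← hj y' hy']; exact congrFun h j)).elim
      · rw [map_add, map_add] at h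
        rw [hinj hz hz' (add_left_cancel h)]
    · have hQ : ∀ y ∈ Q, φ y i = 0 := hzero i fun C hC => hi C (Finset.mem_filter.1 hC).1
      rcases Finset.mem_union.1 hy with hy | hy
      · exact hQ y hy
      · obtain ⟨z, hz, rfl⟩ := Finset.mem_image.1 hy
        rw [map_add, Pi.add_apply, hQ z hz, add_zero]
        exact not_not.1 (mt (hsupp i).2 (hi B hB))

lemma two_pow_chainLen_le {φ : (Fin n → ℕ) × ℕ →+ (ι → A)} {Y : Finset (Finset ι)}
    (hY : ∀ B ∈ Y, ∃ y ≤ 1, ∀ j, j ∈ B ↔ φ y j ≠ 0) (F : Finset ι) :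
    2 ^ chainLen Y F ≤ (chainLen Y F + 1) ^ (n + 1) := by
  obtain ⟨l, hl, -, hlen⟩ := exists_dropSeq_length_eq Y F
  obtain ⟨Q, hcard, hle, -, -⟩ := hl.exists_injOn hY
  rw [hlen] at hcard hle
  rw [← hcard]
  set k := chainLen Y F
  refine (Finset.card_le_card (t := Finset.Icc 0 (fun _ => k) ×ˢ Finset.Icc 0 k)
    fun y hy => ?_).trans (le_of_eq ?_)
  · have h1 : ∀ v, y.1 v ≤ k := fun v => by simpa using (hle y hy).1 v
    have h2 : y.2 ≤ k := by simpa using (hle y hy).2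
    exact Finset.mem_product.2 ⟨Finset.mem_Icc.2 ⟨fun _ => Nat.zero_le _, h1⟩,
      Finset.mem_Icc.2 ⟨Nat.zero_le _, h2⟩⟩
  · rw [Finset.card_product, Pi.card_Icc]
    simp [pow_succ]

lemma le_of_two_pow_le {k : ℕ} (hn : 1 ≤ n) (h : 2 ^ k ≤ (k + 1) ^ (n + 1)) :
    (k : ℝ) ≤ 10 * n * Real.logb 2 (2 * n) := by
  have hn' : (1 : ℝ) ≤ n := by exact_mod_cast hn
  have hk : (0 : ℝ) ≤ k := Nat.cast_nonneg k
  have h2 := Real.log_two_gt_d9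
  have h3 := Real.log_two_lt_d9
  set x := Real.log n with hx
  have hx0 : 0 ≤ x := Real.log_nonneg hn'
  have h1 : k * Real.log 2 ≤ (n + 1) * Real.log (k + 1) := by
    have h4 : (2 : ℝ) ^ k ≤ (k + 1) ^ (n + 1) := by exact_mod_cast h
    have h5 := Real.log_le_log (by positivity) h4
    rw [Real.log_pow, Real.log_pow] at h5
    exact_mod_cast h5
  have h4 : Real.log (k + 1) ≤ Real.log (4 * (n + 1)) + ((k + 1) / (4 * (n + 1)) - 1) := by
    have h5 := Real.log_le_sub_one_of_pos (by positivity : 0 < ((k : ℝ) + 1) / (4 * (n + 1)))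
    rw [Real.log_div (by positivity) (by positivity)] at h5
    linarith
  have h5 : Real.log (4 * (n + 1)) ≤ 3 * Real.log 2 + x := by
    have h6 : Real.log (2 ^ 3 * n) = 3 * Real.log 2 + x := by
      rw [Real.log_mul (by norm_num) (by positivity), Real.log_pow, ← hx, Nat.cast_ofNat]
    rw [← h6]
    exact Real.log_le_log (by positivity) (by linarith)
  have h6 : ((n : ℝ) + 1) * Real.log (k + 1) ≤
      (n + 1) * (3 * Real.log 2 + x) + ((k + 1) / 4 - (n + 1)) := by
    calc _ ≤ ((n : ℝ) + 1) * ((3 * Real.log 2 + x) + ((k + 1) / (4 * (n + 1)) - 1)) := by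
          gcongr
          linarith
      _ = _ := by field_simp
  have h7 : ((n : ℝ) + 1) * (3 * Real.log 2 + x) ≤ 2 * n * (3 * (Real.log 2 + x)) := by
    gcongr
    · linarith
    · linarith
  have h8 : Real.logb 2 (2 * n) * Real.log 2 = Real.log 2 + x := by
    rw [Real.logb, div_mul_cancel₀ _ (by linarith), Real.log_mul (by norm_num) (by positivity)]
  have h9 : k * 0.44 ≤ 6 * n * (Real.log 2 + x) := by
    have := mul_le_mul_of_nonneg_left h2.le hk
    linarith
  rw [← h8] at h9
  have h10 : 0 ≤ n * Real.logb 2 (2 * n) :=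
    mul_nonneg (by linarith) (Real.logb_nonneg (by norm_num) (by linarith))
  have h11 := mul_le_mul_of_nonneg_left h3.le h10
  linarith

end AffineChains

/-- The set of constraint tuples satisfied by the assignment `a`. -/
def satisfied {n r : ℕ} (P : (Fin r → Bool) → Bool) (a : Fin n → Bool) :
    Finset (Fin r → Fin n) :=
  Finset.univ.filter fun τ => P (fun k => a (τ k)) = true

lemma chainLen_satisfied_le {A : Type*} [AddCommGroup A] {n r : ℕ} (hn : 1 ≤ n)
    {P : (Fin r → Bool) → Bool} {av : Fin r → A} {b : A}
    (hP : ∀ x : Fin r → Bool, (P x = true ↔ (∑ i, if x i then av i else 0) ≠ b))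
    (F : Finset (Fin r → Fin n)) :
    (chainLen (Finset.univ.image (satisfied P)) F : ℝ) ≤ 10 * n * Real.logb 2 (2 * n) := by
  let φ : (Fin n → ℕ) × ℕ →+ ((Fin r → Fin n) → A) :=
    { toFun := fun y τ => ∑ k, y.1 (τ k) • av k - y.2 • b
      map_zero' := by ext; simp
      map_add' := fun y z => by
        ext τ
        simp only [Prod.fst_add, Prod.snd_add, Pi.add_apply, add_smul, Finset.sum_add_distrib]
        abel }
  refine le_of_two_pow_le hn (two_pow_chainLen_le (φ := φ) (fun B hB => ?_) F)
  obtain ⟨a, -, rfl⟩ := Finset.mem_image.1 hB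
  refine ⟨(fun v => if a v then 1 else 0, 1), ⟨fun v => ?_, le_rfl⟩, fun τ => ?_⟩
  · dsimp only
    split_ifs <;> simp
  · simp only [satisfied, Finset.mem_filter, Finset.mem_univ, true_and, hP]
    simp [φ, sub_eq_zero, ite_smul]

lemma cspVal_eq_sum_satisfied {n r m : ℕ} (P : (Fin r → Bool) → Bool) (w : Fin m → ℝ)
    (t : Fin m → Fin r → Fin n) (a : Fin n → Bool) :
    cspVal P w t a = ∑ τ ∈ satisfied P a, ∑ j with t j = τ, w j := by
  rw [cspVal, satisfied, Finset.sum_filter, ← Finset.sum_fiberwise Finset.univ t]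
  refine Finset.sum_congr rfl fun τ _ => ?_
  have h : ∀ j ∈ Finset.univ.filter (t · = τ), w j * (if P (fun k => a (t j k)) then 1 else 0) =
      w j * (if P (fun k => a (τ k)) then 1 else 0) := fun j hj => by
    rw [(Finset.mem_filter.1 hj).2]
  rw [Finset.sum_congr rfl h, ← Finset.sum_mul, mul_ite, mul_one, mul_zero]

lemma size_bound {n r Λ ε ρ q L ℓ s : ℝ} (hn : 1 ≤ n) (hr : 1 ≤ r) (hΛ : 1 ≤ Λ) (hε : 0 < ε)
    (hq0 : 0 ≤ q) (hq : q ≤ r * Λ) (hL : L ≤ 10 * n * Λ) (hℓ : ℓ ≤ q + 1)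
    (hρ0 : 0 ≤ ρ) (hρ : ρ * (ε / (q + 2)) ^ 2 = 28 * ℓ) (hs : s ≤ 2 * ρ * (2 * (q * L) + 2)) :
    s ≤ 22176 * n * r ^ 4 * Λ ^ 5 / ε ^ 2 := by
  have hrΛ : 1 ≤ r * Λ := one_le_mul_of_one_le_of_one_le hr hΛ
  have h1 : ρ ≤ 504 * (r * Λ) ^ 3 / ε ^ 2 := by
    rw [le_div_iff₀ (by positivity)]
    have h2 : ρ * ε ^ 2 = 28 * ℓ * (q + 2) ^ 2 := by
      rw [← hρ]
      field_simp
    rw [h2]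
    calc 28 * ℓ * (q + 2) ^ 2 ≤ 28 * (2 * (r * Λ)) * (3 * (r * Λ)) ^ 2 := by
          gcongr <;> linarith
      _ = _ := by ring
  have h2 : 2 * (q * L) + 2 ≤ 22 * (r * n * Λ ^ 2) := by
    have h3 : q * L ≤ (r * Λ) * (10 * n * Λ) :=
      (mul_le_mul_of_nonneg_left hL hq0).trans (by gcongr)
    have h4 : 1 ≤ (r * Λ) * (n * Λ) :=
      one_le_mul_of_one_le_of_one_le hrΛ (one_le_mul_of_one_le_of_one_le hn hΛ)
    linarith
  calc s ≤ 2 * ρ * (2 * (q * L) + 2) := hs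
    _ ≤ 2 * ρ * (22 * (r * n * Λ ^ 2)) := by gcongr
    _ ≤ 2 * (504 * (r * Λ) ^ 3 / ε ^ 2) * (22 * (r * n * Λ ^ 2)) := by gcongr
    _ = _ := by ring

/-- near-linear size sparsifiers for CSPs over affine predicates over
arbitrary (possibly infinite) Abelian groups, with polynomial dependence on the arity. -/
theorem stmt_5 :
    ∃ K c : ℝ, 0 < K ∧ 0 < c ∧
      ∀ (A : Type) [AddCommGroup A],
      ∀ (r : ℕ), 1 ≤ r →
      ∀ P : (Fin r → Bool) → Bool,
        (∃ (av : Fin r → A) (b : A), ∀ x : Fin r → Bool,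
          (P x = true ↔ (∑ i, if x i then av i else 0) ≠ b)) →
      ∀ ε : ℝ, 0 < ε → ε < 1 → ∀ n : ℕ, 1 ≤ n →
      ∀ (m : ℕ) (w : Fin m → ℝ) (t : Fin m → Fin r → Fin n), (∀ j, 0 ≤ w j) →
      ∃ (S : Finset (Fin m)) (w' : Fin m → ℝ),
        (∀ j ∈ S, 0 ≤ w' j) ∧
        (S.card : ℝ) ≤ K * n * (r : ℝ) ^ 4 *
          (Real.logb 2 (2 * (n : ℝ) * (r : ℝ) / ε)) ^ c / ε ^ 2 ∧
        ∀ a : Fin n → Bool,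
          (1 - ε) * cspVal P w t a ≤ cspValOn P S w' t a ∧
          cspValOn P S w' t a ≤ (1 + ε) * cspVal P w t a := by
  refine ⟨22176, 5, by norm_num, by norm_num, ?_⟩
  rintro A _ r hr P ⟨av, b, hP⟩ ε hε0 hε1 n hn m w t hw
  have : NeZero n := ⟨by omega⟩
  have hn' : (1 : ℝ) ≤ n := by exact_mod_cast hn
  have hr' : (1 : ℝ) ≤ r := by exact_mod_cast hr
  set Λ := Real.logb 2 (2 * (n : ℝ) * (r : ℝ) / ε) with hΛ
  have hΛn : Real.logb 2 (2 * n) ≤ Λ := by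
    refine Real.logb_le_logb_of_le (by norm_num) (by positivity) ?_
    rw [le_div_iff₀ hε0]
    calc 2 * (n : ℝ) * ε ≤ 2 * n * 1 := by gcongr
      _ ≤ 2 * n * r := by gcongr
  have hlogn : Real.logb 2 (2 * n) = 1 + Real.logb 2 n := by
    rw [Real.logb_mul (by norm_num) (by positivity), Real.logb_self_eq_one (by norm_num)]
  have hlogn0 : 0 ≤ Real.logb 2 n := Real.logb_nonneg (by norm_num) hn'
  have hΛ1 : 1 ≤ Λ := by linarith
  set q := r * Nat.clog 2 n with hq
  have hqΛ : (q : ℝ) ≤ r * Λ := by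
    have h1 := Real.natCeil_logb_natCast 2 n
    have h2 := Nat.ceil_lt_add_one hlogn0
    rw [Nat.cast_ofNat] at h1
    rw [h1] at h2
    rw [hq, Nat.cast_mul]
    gcongr
    linarith
  have hcard : Fintype.card (Fin r → Fin n) ≤ 2 ^ q := by
    rw [Fintype.card_fun, Fintype.card_fin, Fintype.card_fin, hq, mul_comm, pow_mul]
    exact Nat.pow_le_pow_left (Nat.le_pow_clog (by norm_num) n) r
  have hlog : Real.log (Fintype.card (Fin r → Fin n) + 1) ≤ q + 1 := by
    have h1 : (Fintype.card (Fin r → Fin n) : ℝ) + 1 ≤ 2 ^ (q + 1) := by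
      have h2 : Fintype.card (Fin r → Fin n) + 1 ≤ 2 ^ (q + 1) := by
        have := Nat.one_le_two_pow (n := q)
        rw [pow_succ]
        omega
      exact_mod_cast h2
    have h2 := Real.log_le_log (by positivity) h1
    rw [Real.log_pow] at h2
    have h3 := Real.log_two_lt_d9
    have h4 : ((q + 1 : ℕ) : ℝ) * Real.log 2 ≤ (q + 1 : ℕ) :=
      mul_le_of_le_one_right (Nat.cast_nonneg _) (by linarith)
    push_cast at h2 h4
    linarith
  set W : (Fin r → Fin n) → ℝ := fun τ => ∑ j with t j = τ, w j with hW
  have hρ : 28 * Real.log (Fintype.card (Fin r → Fin n) + 1) / (ε / (q + 2)) ^ 2 *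
      (ε / (q + 2)) ^ 2 = 28 * Real.log (Fintype.card (Fin r → Fin n) + 1) :=
    div_mul_cancel₀ _ (by positivity)
  have hρ0 : 0 ≤ 28 * Real.log (Fintype.card (Fin r → Fin n) + 1) / (ε / (q + 2)) ^ 2 := by
    have : 0 ≤ Real.log ((Fintype.card (Fin r → Fin n) : ℝ) + 1) :=
      Real.log_nonneg (by linarith [Nat.cast_nonneg (α := ℝ) (Fintype.card (Fin r → Fin n))])
    positivity
  obtain ⟨S, v, hv, hSW, hScard, hdev⟩ := exists_sparsifier
    (Finset.univ.image (satisfied (n := n) P)) (w := W)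
    (fun τ => Finset.sum_nonneg fun j _ => hw j) (chainLen_satisfied_le hn hP) hcard hε0 hε1.le hρ
  have hrep : Set.SurjOn t (Finset.univ : Finset (Fin m)) S := fun τ hτ => by
    by_contra! h
    refine (hSW τ hτ).ne' (Finset.sum_eq_zero fun j hj => ?_)
    exact (h ⟨j, Finset.mem_coe.2 (Finset.mem_univ j), (Finset.mem_filter.1 hj).2⟩).elim
  obtain ⟨T, -, hinj, rfl⟩ := Finset.exists_subset_injOn_image_eq_of_surjOn _ _ hrep
  refine ⟨T, fun j => v (t j), fun j _ => hv _, ?_, fun a => ?_⟩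
  · rw [← Finset.card_image_of_injOn hinj, show (5 : ℝ) = ((5 : ℕ) : ℝ) by norm_num,
      Real.rpow_natCast]
    exact size_bound hn' hr' hΛ1 hε0 (Nat.cast_nonneg q) hqΛ (by gcongr) hlog hρ0 hρ hScard
  · have h1 : cspValOn P T (fun j => v (t j)) t a =
        ∑ τ ∈ T.image t ∩ satisfied P a, v τ := by
      rw [cspValOn, ← Finset.filter_mem_eq_inter, Finset.sum_filter, Finset.sum_image hinj]
      simp [satisfied]
    have h2 := abs_le.1 (hdev _ (Finset.mem_image_of_mem _ (Finset.mem_univ a)))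
    rw [h1, cspVal_eq_sum_satisfied]
    constructor <;> linarith [h2.1, h2.2]
end

section
/- Let B be a d × ℓ matrix with integer entries, let k be the rank of B (over ℚ), and let M ≥ 1 be such that every square submatrix of B has determinant of absolute value at most M. Then there exist a positive integer M' ≤ M, vectors u₁,…,u_k ∈ ℤ^d, and vectors v₁,…,v_{d−k} ∈ ℤ^d all of whose entries have absolute value at most M, such that for every x ∈ ℤ^d: x lies in the lattice generated by the columns of B (i.e., x = B·y for some y ∈ ℤ^ℓ) if and only if M' divides ⟨u_i, x⟩ for every i ∈ {1,…,k} and ⟨v_j, x⟩ = 0 for every j ∈ {1,…,d−k}. -/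
open Matrix

/-- Every matrix over a field factors through a submatrix consisting of `A.rank` of its rows. -/
theorem Matrix.exists_eq_mul_submatrix_rows {m n K : Type*} [Field K] [Fintype m] [Fintype n]
    {k : ℕ} (A : Matrix m n K) (hk : A.rank = k) :
    ∃ (f : Fin k → m) (C : Matrix m (Fin k) K),
      Function.Injective f ∧ A = C * A.submatrix f id := by
  rw [A.rank_eq_finrank_span_row] at hk
  subst hk
  obtain ⟨r, hr, hspan, hind⟩ :=
    Submodule.exists_fun_fin_finrank_span_eq K (Set.range A.row)
  choose f hf using hr
  have hmem : ∀ p, ∃ c : Fin _ → K, ∑ i, c i • r i = A.row p := fun p => by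
    rw [← Submodule.mem_span_range_iff_exists_fun, hspan]
    exact Submodule.subset_span ⟨p, rfl⟩
  choose C hC using hmem
  refine ⟨f, of C, fun a b hab => hind.injective (by rw [← hf a, ← hf b, hab]), ?_⟩
  ext p q
  rw [← row_apply A, ← hC p]
  simp [mul_apply, ← hf, row_apply]

/-- A matrix of rank `k` over a field has a nonsingular `k × k` submatrix, and the full matrix is
recovered from the rows and columns of that submatrix. -/
theorem Matrix.exists_submatrix_det_ne_zero {m n K : Type*} [Field K] [Fintype m] [Fintype n]
    {k : ℕ} (A : Matrix m n K) (hk : A.rank = k) :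
    ∃ (f : Fin k → m) (g : Fin k → n), Function.Injective f ∧ Function.Injective g ∧
      (A.submatrix f g).det ≠ 0 ∧
      A.submatrix id g * (A.submatrix f g).adjugate * A.submatrix f id =
        (A.submatrix f g).det • A := by
  obtain ⟨f, C, hf, hC⟩ := A.exists_eq_mul_submatrix_rows hk
  have hrow : (A.submatrix f id).rank = k := by
    refine le_antisymm ((rank_submatrix_le A f id).trans hk.le) ?_
    conv_lhs => rw [← hk, hC]
    exact rank_mul_le_right _ _
  obtain ⟨g, Z, hg, hZ⟩ := (A.submatrix f id)ᵀ.exists_eq_mul_submatrix_rows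
    ((rank_transpose _).trans hrow)
  have hZ' : A.submatrix f id = A.submatrix f g * Zᵀ := by
    have h := congrArg transpose hZ
    rw [transpose_mul] at h
    exact h
  have hAg : A.submatrix id g = C * A.submatrix f g := by
    conv_lhs => rw [hC]
    rfl
  have hrank : (A.submatrix f g).rank = k := by
    refine le_antisymm ((rank_submatrix_le A f g).trans hk.le) ?_
    conv_lhs => rw [← hrow, hZ']
    exact rank_mul_le_left _ _
  refine ⟨f, g, hf, hg, ?_, ?_⟩
  · have hli : LinearIndependent K (A.submatrix f g).row := by
      rw [linearIndependent_iff_card_eq_finrank_span, Set.finrank, ← rank_eq_finrank_span_row,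
        hrank, Fintype.card_fin]
    rw [linearIndependent_rows_iff_isUnit, isUnit_iff_isUnit_det] at hli
    exact hli.ne_zero
  · rw [hAg, Matrix.mul_assoc C, mul_adjugate, Matrix.mul_smul, Matrix.mul_one, Matrix.smul_mul,
      ← hC]

/-- An integer matrix of rank `k` over `ℚ` has a nonsingular `k × k` submatrix, and the full matrix
is recovered up to a scalar from the rows and columns of that submatrix. -/
theorem Matrix.exists_submatrix_det_ne_zero_int {m n : Type*} [Fintype m] [Fintype n]
    {k : ℕ} (B : Matrix m n ℤ) (hk : (B.map ((↑) : ℤ → ℚ)).rank = k) :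
    ∃ (f : Fin k → m) (g : Fin k → n), Function.Injective f ∧ Function.Injective g ∧
      (B.submatrix f g).det ≠ 0 ∧
      B.submatrix id g * (B.submatrix f g).adjugate * B.submatrix f id =
        (B.submatrix f g).det • B := by
  obtain ⟨f, g, hf, hg, hdet, h⟩ := (B.map ((↑) : ℤ → ℚ)).exists_submatrix_det_ne_zero hk
  have hd : ((B.map ((↑) : ℤ → ℚ)).submatrix f g).det = ((B.submatrix f g).det : ℚ) :=
    (Int.cast_det (B.submatrix f g)).symm
  have ha : ((B.map ((↑) : ℤ → ℚ)).submatrix f g).adjugate =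
      (B.submatrix f g).adjugate.map ((↑) : ℤ → ℚ) :=
    ((Int.castRingHom ℚ).map_adjugate (B.submatrix f g)).symm
  rw [hd] at hdet h
  rw [ha] at h
  refine ⟨f, g, hf, hg, by exact_mod_cast hdet, ?_⟩
  ext p q
  have hpq := congrFun (congrFun h p) q
  simp only [mul_apply, submatrix_apply, map_apply, smul_apply, smul_eq_mul, id] at hpq ⊢
  exact_mod_cast hpq

/-- Among the integer combinations of the columns of `N`, a `k`-tuple of minimal nonzero
determinant generates the column lattice of `N`. -/
theorem Matrix.exists_det_dvd_adjugate_mulVec {k l : Type*} [Fintype k] [DecidableEq k] [Fintype l]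
    (N : Matrix k l ℤ) (Y₀ : Matrix l k ℤ) (h₀ : (N * Y₀).det ≠ 0) :
    ∃ Y : Matrix l k ℤ, (N * Y).det ≠ 0 ∧ |(N * Y).det| ≤ |(N * Y₀).det| ∧
      ∀ y i, (N * Y).det ∣ ((N * Y).adjugate *ᵥ (N *ᵥ y)) i := by
  classical
  obtain ⟨Y, hY, hmin⟩ := WellFounded.has_min
    (measure fun Y : Matrix l k ℤ => (N * Y).det.natAbs).wf {Y | (N * Y).det ≠ 0} ⟨Y₀, h₀⟩
  have hmin' : ∀ Z : Matrix l k ℤ, (N * Z).det ≠ 0 → |(N * Y).det| ≤ |(N * Z).det| := by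
    intro Z hZ
    have h : ¬ (N * Z).det.natAbs < (N * Y).det.natAbs := hmin Z hZ
    rw [Int.abs_eq_natAbs, Int.abs_eq_natAbs]
    exact_mod_cast not_lt.mp h
  refine ⟨Y, hY, hmin' Y₀ h₀, fun y i => ?_⟩
  rw [← cramer_eq_adjugate_mulVec]
  set D := (N * Y).det with hD
  set c := cramer (N * Y) (N *ᵥ y) i with hc
  set z : l → ℤ := y - (c / D) • Y.col i with hz
  have hupd : N * Y.updateCol i z = (N * Y).updateCol i (N *ᵥ z) := by
    ext a b
    by_cases hb : b = i
    · subst hb; simp [mul_apply, mulVec, dotProduct]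
    · simp [mul_apply, updateCol_ne hb]
  have hdet : (N * Y.updateCol i z).det = c % D := by
    have hself : cramer (N * Y) (N *ᵥ Y.col i) i = D := by
      rw [cramer_apply]
      have : N *ᵥ Y.col i = (N * Y).col i := by
        ext a; simp [mul_apply, mulVec, dotProduct]
      rw [this]
      exact congrArg det (updateCol_eq_self _ _)
    rw [hupd, ← cramer_apply, hz, mulVec_sub, mulVec_smul, map_sub, map_smul, Pi.sub_apply,
      Pi.smul_apply, hself, ← hc, smul_eq_mul, Int.emod_def, mul_comm]
  by_contra hdvd
  have hne : c % D ≠ 0 := fun h => hdvd (Int.dvd_of_emod_eq_zero h)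
  have hle := hmin' (Y.updateCol i z) (by rwa [hdet])
  rw [hdet, abs_of_nonneg (Int.emod_nonneg c hY)] at hle
  exact absurd (Int.emod_lt_abs c hY) (not_lt.mpr hle)

theorem Finset.sum_extend_zero_mul {ι κ R : Type*} [Fintype ι] [Fintype κ]
    [NonUnitalNonAssocSemiring R] {f : ι → κ} (hf : Function.Injective f) (a : ι → R) (x : κ → R) :
    ∑ p, Function.extend f a 0 p * x p = ∑ i, a i * x (f i) := by
  refine (Fintype.sum_of_injective f hf _ _ (fun p hp => ?_) (fun i => ?_)).symm
  · rw [Function.extend_apply' _ _ _ (fun h => hp h)]; simp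
  · rw [hf.extend_apply]


/-- membership in the lattice generated by the columns of an integer
matrix is characterized by k modular equations (modulo a single M' ≤ M) and d−k
linear equations, with small coefficients. -/
theorem stmt_8 (d l k : ℕ) (B : Matrix (Fin d) (Fin l) ℤ)
    (hk : (B.map ((↑) : ℤ → ℚ)).rank = k)
    (M : ℤ) (hM : 1 ≤ M)
    (hsub : ∀ (s : ℕ) (f : Fin s → Fin d) (g : Fin s → Fin l),
      Function.Injective f → Function.Injective g → |(B.submatrix f g).det| ≤ M) :
    ∃ M' : ℤ, 1 ≤ M' ∧ M' ≤ M ∧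
      ∃ (u : Fin k → Fin d → ℤ) (v : Fin (d - k) → Fin d → ℤ),
        (∀ i p, |u i p| ≤ M) ∧ (∀ j p, |v j p| ≤ M) ∧
        ∀ x : Fin d → ℤ,
          (∃ y : Fin l → ℤ, x = B.mulVec y) ↔
            ((∀ i, M' ∣ ∑ p, u i p * x p) ∧ ∀ j, (∑ p, v j p * x p) = 0) := by
  obtain ⟨f, g, hf, hg, hD₀, hrec⟩ := B.exists_submatrix_det_ne_zero_int hk
  set A := B.submatrix f g with hA
  set N := B.submatrix f id with hN
  have hNg : N * (1 : Matrix (Fin l) (Fin l) ℤ).submatrix id g = A := by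
    ext a b
    simp [mul_apply, one_apply, hN, hA]
  obtain ⟨Y, hY, hYle, hdvd⟩ := N.exists_det_dvd_adjugate_mulVec _ (hNg.symm ▸ hD₀)
  rw [hNg] at hYle
  set C := N * Y with hC
  have hcard : Fintype.card {p // p ∉ Set.range f} = d - k := by
    have hrange : Fintype.card {p // p ∈ Set.range f} = k := by
      rw [← Fintype.card_congr (Equiv.ofInjective f hf), Fintype.card_fin]
    rw [Fintype.card_subtype_compl, hrange, Fintype.card_fin]
  let e : Fin (d - k) ≃ {p // p ∉ Set.range f} := (Fintype.equivFinOfCardEq hcard).symm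
  let w : Fin d → Fin k → ℤ := fun p => B.submatrix id g p ᵥ* A.adjugate
  have hw : ∀ p a, w p a = (A.updateRow a (B.submatrix id g p)).det := fun p a => by
    rw [← cramer_transpose_apply, cramer_eq_adjugate_mulVec, ← adjugate_transpose,
      mulVec_transpose]
  have hrec' : ∀ p y, w p ⬝ᵥ (N *ᵥ y) = A.det * (B *ᵥ y) p := fun p y => by
    have h := congrFun (congrArg (· *ᵥ y) hrec) p
    simp only [smul_mulVec, Pi.smul_apply, smul_eq_mul] at h
    rw [← h, ← mulVec_mulVec]
    rfl
  have hM' : |C.det| ≤ M := hYle.trans (hsub k f g hf hg)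
  refine ⟨|C.det|, Int.one_le_abs hY, hM',
    fun i => Function.extend f (fun a => C.adjugate i a % C.det) 0,
    fun j => Pi.single (e j).1 A.det - Function.extend f (w (e j)) 0,
    fun i p => ?_, fun j p => ?_, fun x => ?_⟩
  · beta_reduce
    by_cases hp : ∃ a, f a = p
    · obtain ⟨a, rfl⟩ := hp
      rw [hf.extend_apply, abs_of_nonneg (Int.emod_nonneg _ hY)]
      exact (Int.emod_lt_abs _ hY).le.trans hM'
    · rw [Function.extend_apply' _ _ _ hp, Pi.zero_apply, abs_zero]
      exact zero_le_one.trans hM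
  · beta_reduce
    rw [Pi.sub_apply]
    by_cases hp : ∃ a, f a = p
    · obtain ⟨a, rfl⟩ := hp
      have hne : f a ≠ (e j).1 := fun h => (e j).2 ⟨a, h⟩
      rw [hf.extend_apply, Pi.single_eq_of_ne hne, zero_sub, abs_neg, hw]
      have hupd : A.updateRow a (B.submatrix id g (e j)) =
          B.submatrix (Function.update f a (e j)) g := by
        ext b c
        by_cases hb : b = a
        · subst hb; simp
        · simp [updateRow_ne hb, Function.update_of_ne hb, hA]
      rw [hupd]
      refine hsub k _ g ?_ hg
      intro b c hbc
      have hnr : ∀ b, f b ≠ (e j).1 := fun b h => (e j).2 ⟨b, h⟩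
      by_cases hb : b = a <;> by_cases hc : c = a
      · rw [hb, hc]
      · subst hb
        rw [Function.update_self, Function.update_of_ne hc] at hbc
        exact absurd hbc.symm (hnr c)
      · subst hc
        rw [Function.update_self, Function.update_of_ne hb] at hbc
        exact absurd hbc (hnr b)
      · rw [Function.update_of_ne hb, Function.update_of_ne hc] at hbc
        exact hf hbc
    · rw [Function.extend_apply' _ _ _ hp, Pi.zero_apply, sub_zero]
      by_cases hpe : p = (e j).1
      · subst hpe
        rw [Pi.single_eq_same]
        exact hsub k f g hf hg
      · rw [Pi.single_eq_of_ne hpe, abs_zero]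
        exact zero_le_one.trans hM
  · have hu : ∀ i, (|C.det| ∣ ∑ p, Function.extend f (fun a => C.adjugate i a % C.det) 0 p * x p) ↔
        C.det ∣ (C.adjugate *ᵥ (x ∘ f)) i := fun i => by
      rw [Finset.sum_extend_zero_mul hf, abs_dvd, ← Int.modEq_zero_iff_dvd,
        ← Int.modEq_zero_iff_dvd]
      have hmod : ∑ a, C.adjugate i a % C.det * x (f a) ≡ (C.adjugate *ᵥ (x ∘ f)) i
          [ZMOD C.det] :=
        Int.ModEq.sum fun a _ => (Int.mod_modEq _ _).mul_right _
      exact ⟨hmod.symm.trans, hmod.trans⟩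
    have hv : ∀ j, (∑ p, (Pi.single (e j).1 A.det - Function.extend f (w (e j)) 0 :
        Fin d → ℤ) p * x p) = A.det * x (e j) - w (e j) ⬝ᵥ (x ∘ f) := fun j => by
      simp only [Pi.sub_apply, sub_mul, Finset.sum_sub_distrib, Finset.sum_extend_zero_mul hf]
      simp [Pi.single_apply, dotProduct]
    simp only [hu, hv]
    constructor
    · rintro ⟨y, rfl⟩
      have hcomp : (B *ᵥ y) ∘ f = N *ᵥ y := rfl
      refine ⟨fun i => hcomp ▸ hdvd y i, fun j => ?_⟩
      rw [hcomp, hrec', sub_self]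
    · rintro ⟨h₁, h₂⟩
      choose z hz using h₁
      have hxf : x ∘ f = N *ᵥ (Y *ᵥ z) := by
        have h : C.det • (x ∘ f) = C.det • (C *ᵥ z) := by
          have hadj : C.adjugate *ᵥ (x ∘ f) = C.det • z := funext hz
          rw [← mulVec_smul, ← hadj, mulVec_mulVec, mul_adjugate, smul_mulVec, one_mulVec]
        rw [mulVec_mulVec, ← hC]
        exact smul_right_injective _ hY h
      refine ⟨Y *ᵥ z, funext fun p => ?_⟩
      by_cases hp : p ∈ Set.range f
      · obtain ⟨a, rfl⟩ := hp
        exact congrFun hxf a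
      · have h := h₂ (e.symm ⟨p, hp⟩)
        rw [e.apply_symm_apply, hxf, hrec', ← mul_sub] at h
        exact sub_eq_zero.mp ((mul_eq_zero.mp h).resolve_left hD₀)
end

section
/- Let P : {0,1}^r → {0,1} be a symmetric predicate with P(x) = P₀(|x|), and suppose P is aperiodic: there exist k₁, k₂, k₃ ∈ {0,…,r} with P₀(k₁) = P₀(k₂) = 0, with k₃ = 2k₂ − k₁ or k₃ = 2k₁ − k₂, and with P₀(k₃) = 1. Then P has a projection to AND₂. -/
/-- The input that is `true` on the first `c` positions, `u` on the next `d`, `v` on the next `d`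
and `false` afterwards. -/
def blockInput (c d : ℕ) (u v : Bool) (i : ℕ) : Bool :=
  if i < c then true else if i < c + d then u else if i < c + d + d then v else false

theorem card_filter_blockInput {r c d : ℕ} (h : c + d + d ≤ r) (u v : Bool) :
    (Finset.univ.filter fun i : Fin r => blockInput c d u v i = true).card =
      c + (if u then d else 0) + (if v then d else 0) := by
  obtain ⟨e, rfl⟩ := Nat.exists_eq_add_of_le h
  have h_one : ∀ i ∈ Finset.range c, (if blockInput c d u v i = true then 1 else 0) = 1 := by
    intro i hi
    simp [blockInput, Finset.mem_range.mp hi]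
  have h_u : ∀ i ∈ Finset.range d,
      (if blockInput c d u v (c + i) = true then 1 else 0) = if u then 1 else 0 := by
    intro i hi
    simp [blockInput, Finset.mem_range.mp hi]
  have h_v : ∀ i ∈ Finset.range d,
      (if blockInput c d u v (c + d + i) = true then 1 else 0) = if v then 1 else 0 := by
    intro i hi
    have h_c : ¬ c + d + i < c := by omega
    simp [blockInput, Finset.mem_range.mp hi, h_c]
  have h_zero : ∀ i ∈ Finset.range e,
      (if blockInput c d u v (c + d + d + i) = true then 1 else 0) = 0 := by
    intro i _
    have h_c : ¬ c + d + d + i < c := by omega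
    have h_d : ¬ c + d + d + i < c + d := by omega
    simp [blockInput, h_c, h_d]
  rw [Finset.card_filter,
    Fin.sum_univ_eq_sum_range (fun i => if blockInput c d u v i = true then 1 else 0),
    Finset.sum_range_add, Finset.sum_range_add, Finset.sum_range_add, Finset.sum_congr rfl h_one,
    Finset.sum_congr rfl h_u, Finset.sum_congr rfl h_v, Finset.sum_congr rfl h_zero]
  simp

/-- A symmetric predicate vanishing at `a` and `b` but not at the next term of the arithmetic
progression `a, b, 2b - a` has a projection to AND₂. -/
theorem exists_projection_and_of_progression {r : ℕ} {P : (Fin r → Bool) → Bool} {P₀ : ℕ → Bool}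
    (hsym : ∀ x : Fin r → Bool, P x = P₀ ((Finset.univ.filter fun i => x i = true).card))
    {a b c : ℕ} (ha : a ≤ r) (hc : c ≤ r) (hPa : P₀ a = false) (hPb : P₀ b = false)
    (habc : (c : ℤ) = 2 * (b : ℤ) - (a : ℤ)) (hPc : P₀ c = true) :
    ∃ ρ : Fin r → (Bool × Bool) → Bool,
      (∀ i, ρ i = (fun _ => false) ∨ ρ i = (fun _ => true) ∨
        ρ i = (fun p => p.1) ∨ ρ i = (fun p => !p.1) ∨
        ρ i = (fun p => p.2) ∨ ρ i = (fun p => !p.2)) ∧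
      ∀ y₁ y₂ : Bool, P (fun i => ρ i (y₁, y₂)) = (y₁ && y₂) := by
  rcases le_total a b with h | h
  · obtain ⟨d, rfl⟩ := Nat.exists_eq_add_of_le h
    obtain rfl : c = a + d + d := by omega
    refine ⟨fun i p => blockInput a d p.1 p.2 i, fun i => ?_, fun y₁ y₂ => ?_⟩
    · simp only [blockInput]
      split_ifs <;> simp
    · rw [hsym, card_filter_blockInput hc]
      cases y₁ <;> cases y₂ <;> simp [hPa, hPb, hPc]
  · obtain ⟨d, rfl⟩ := Nat.exists_eq_add_of_le h
    obtain rfl : b = c + d := by omega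
    refine ⟨fun i p => blockInput c d (!p.1) (!p.2) i, fun i => ?_, fun y₁ y₂ => ?_⟩
    · simp only [blockInput]
      split_ifs <;> simp
    · rw [hsym, card_filter_blockInput ha]
      cases y₁ <;> cases y₂ <;> simp [hPa, hPb, hPc]

/-- an aperiodic symmetric Boolean predicate has a projection to AND₂. -/
theorem stmt_10 (r : ℕ) (P : (Fin r → Bool) → Bool) (P₀ : ℕ → Bool)
    (hsym : ∀ x : Fin r → Bool, P x = P₀ ((Finset.univ.filter fun i => x i = true).card))
    (k₁ k₂ k₃ : ℕ) (h₁ : k₁ ≤ r) (h₂ : k₂ ≤ r) (h₃ : k₃ ≤ r)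
    (hP₁ : P₀ k₁ = false) (hP₂ : P₀ k₂ = false)
    (hk : (k₃ : ℤ) = 2 * (k₂ : ℤ) - (k₁ : ℤ) ∨ (k₃ : ℤ) = 2 * (k₁ : ℤ) - (k₂ : ℤ))
    (hP₃ : P₀ k₃ = true) :
    ∃ ρ : Fin r → (Bool × Bool) → Bool,
      (∀ i, ρ i = (fun _ => false) ∨ ρ i = (fun _ => true) ∨
        ρ i = (fun p => p.1) ∨ ρ i = (fun p => !p.1) ∨
        ρ i = (fun p => p.2) ∨ ρ i = (fun p => !p.2)) ∧
      ∀ y₁ y₂ : Bool, P (fun i => ρ i (y₁, y₂)) = (y₁ && y₂) := by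
  rcases hk with hk | hk
  · exact exists_projection_and_of_progression hsym h₁ h₃ hP₁ hP₂ hk hP₃
  · exact exists_projection_and_of_progression hsym h₂ h₃ hP₂ hP₁ hk hP₃
end

section
/- Let P : {0,1}^r → {0,1} be a symmetric periodic predicate that has at least one unsatisfying assignment. Then there exist integers ℓ and c with 1 ≤ ℓ ≤ r+1 and 0 ≤ c ≤ r such that for every x ∈ {0,1}^r, P(x) = 1 if and only if |x| is not congruent to c modulo ℓ. -/
/-- A set of naturals in `[0, r]` closed under reflection of one element in another, containing `a`
and `a + d`, contains every element of `[0, r]` congruent to `a` modulo `d`. -/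
lemma reflection_closed_of_modEq {r : ℕ} {Z : ℕ → Prop}
    (hZ : ∀ i j k, i ≤ r → j ≤ r → k ≤ r → Z i → Z j → k + i = 2 * j → Z k)
    {a d : ℕ} (had : a + d ≤ r) (ha : Z a) (hd : Z (a + d))
    {k : ℕ} (hk : k ≤ r) (hmod : k ≡ a [MOD d]) : Z k := by
  have up : ∀ n b, b + d ≤ r → Z b → Z (b + d) → b + n * d ≤ r → Z (b + n * d) := by
    intro n
    induction n with
    | zero => intro b _ hb _ _; simpa using hb
    | succ n ih =>
      intro b hbr hb hbd hn
      rw [Nat.succ_mul] at hn ⊢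
      rcases Nat.eq_zero_or_pos n with rfl | hpos
      · simpa using hbd
      · have hle : d ≤ n * d := Nat.le_mul_of_pos_left d hpos
        have hb2 : Z (b + d + d) :=
          hZ b (b + d) _ (by omega) hbr (by omega) hb hbd (by ring)
        have := ih (b + d) (by omega) hbd hb2 (by omega)
        rwa [show b + (n * d + d) = b + d + n * d by ring]
  have down : ∀ n b, b + n * d = a → Z b ∧ Z (b + d) := by
    intro n
    induction n with
    | zero =>
      intro b hb
      obtain rfl : b = a := by simpa using hb
      exact ⟨ha, hd⟩
    | succ n ih =>
      intro b hb
      rw [Nat.succ_mul] at hb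
      obtain ⟨h₁, h₂⟩ := ih (b + d) (by omega)
      exact ⟨hZ (b + d + d) (b + d) b (by omega) (by omega) (by omega) h₂ h₁ (by ring), h₁⟩
  rcases le_total a k with hle | hle
  · obtain ⟨n, hn⟩ := (Nat.modEq_iff_dvd' hle).1 hmod.symm
    obtain rfl : k = a + n * d := by rw [mul_comm]; omega
    exact up n a had ha hd hk
  · obtain ⟨n, hn⟩ := (Nat.modEq_iff_dvd' hle).1 hmod
    exact (down n k (by rw [mul_comm]; omega)).1

/-- A nonempty reflection-closed subset of `[0, r]` is the trace of a residue class. -/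
lemma exists_modEq_of_reflection_closed {r : ℕ} {Z : ℕ → Prop}
    (hZ : ∀ i j k, i ≤ r → j ≤ r → k ≤ r → Z i → Z j → k + i = 2 * j → Z k)
    {c : ℕ} (hcr : c ≤ r) (hc : Z c) :
    ∃ l a : ℕ, 1 ≤ l ∧ l ≤ r + 1 ∧ a ≤ r ∧ ∀ k ≤ r, Z k ↔ k ≡ a [MOD l] := by
  classical
  by_cases hgap : ∃ d, 0 < d ∧ ∃ a, a + d ≤ r ∧ Z a ∧ Z (a + d)
  · obtain ⟨hpos, a, had, ha, hd⟩ := Nat.find_spec hgap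
    have hmin : ∀ i j, i ≤ j → j < i + Nat.find hgap → j ≤ r → Z i → Z j → i = j := by
      intro i j hij hlt hj hi hj'
      by_contra hne
      refine Nat.find_min hgap (m := j - i) (by omega) ⟨by omega, i, by omega, hi, ?_⟩
      rwa [Nat.add_sub_cancel' hij]
    generalize Nat.find hgap = d at *
    refine ⟨d, a, hpos, by omega, by omega, fun k hk => ⟨fun hZk => ?_, fun h =>
      reflection_closed_of_modEq hZ had ha hd hk h⟩⟩
    rcases le_total a k with hle | hle
    · have hs := Nat.mod_lt (k - a) hpos
      have hs' := Nat.mod_le (k - a) d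
      have hmod : k - (k - a) % d ≡ a [MOD d] := by
        refine ((Nat.modEq_iff_dvd' (by omega)).2 ?_).symm
        rw [show k - (k - a) % d - a = k - a - (k - a) % d by omega]
        exact Nat.dvd_sub_mod _
      have hZ' := reflection_closed_of_modEq hZ had ha hd (by omega) hmod
      rwa [hmin _ k (by omega) (by omega) hk hZ' hZk] at hmod
    · have hs := Nat.mod_lt (a - k) hpos
      have hs' := Nat.mod_le (a - k) d
      have hmod : k + (a - k) % d ≡ a [MOD d] := by
        refine (Nat.modEq_iff_dvd' (by omega)).2 ?_
        rw [show a - (k + (a - k) % d) = a - k - (a - k) % d by omega]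
        exact Nat.dvd_sub_mod _
      have hZ' := reflection_closed_of_modEq hZ had ha hd (by omega) hmod
      rwa [← hmin k _ (by omega) (by omega) (by omega) hZk hZ'] at hmod
  · refine ⟨r + 1, c, by omega, le_rfl, hcr, fun k hk => ⟨fun hZk => ?_, fun h => ?_⟩⟩
    · by_contra hne
      have hkc : k ≠ c := by rintro rfl; exact hne rfl
      rcases lt_or_gt_of_ne hkc with hlt | hlt
      · exact hgap ⟨c - k, by omega, k, by omega, hZk, by rwa [Nat.add_sub_cancel' hlt.le]⟩
      · exact hgap ⟨k - c, by omega, c, by omega, hc, by rwa [Nat.add_sub_cancel' hlt.le]⟩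
    · rwa [h.eq_of_lt_of_lt (by omega) (by omega)]


/-- a symmetric periodic predicate with at least one unsatisfying
assignment is exactly the predicate "|x| is not congruent to c modulo ℓ" for some
1 ≤ ℓ ≤ r+1 and 0 ≤ c ≤ r. -/
theorem stmt_11 (r : ℕ) (P : (Fin r → Bool) → Bool) (P₀ : ℕ → Bool)
    (hsym : ∀ x : Fin r → Bool, P x = P₀ ((Finset.univ.filter fun i => x i = true).card))
    (hper : ∀ k₁ k₂ k₃ : ℕ, k₁ ≤ r → k₂ ≤ r → k₃ ≤ r →
      P₀ k₁ = false → P₀ k₂ = false →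
      ((k₃ : ℤ) = 2 * (k₂ : ℤ) - (k₁ : ℤ) ∨ (k₃ : ℤ) = 2 * (k₁ : ℤ) - (k₂ : ℤ)) →
      P₀ k₃ = false)
    (hunsat : ∃ x : Fin r → Bool, P x = false) :
    ∃ ℓ c : ℕ, 1 ≤ ℓ ∧ ℓ ≤ r + 1 ∧ c ≤ r ∧
      ∀ x : Fin r → Bool,
        (P x = true ↔ ¬ ((Finset.univ.filter fun i => x i = true).card ≡ c [MOD ℓ])) := by
  have hcard : ∀ x : Fin r → Bool, (Finset.univ.filter fun i => x i = true).card ≤ r :=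
    fun x => (Finset.card_le_univ _).trans_eq (Fintype.card_fin r)
  obtain ⟨x₀, hx₀⟩ := hunsat
  rw [hsym] at hx₀
  obtain ⟨l, c, hl, hlr, hcr, h⟩ :=
    exists_modEq_of_reflection_closed (r := r) (Z := fun k => P₀ k = false)
      (fun i j k hi hj hk hZi hZj hijk => hper i j k hi hj hk hZi hZj (Or.inl (by omega)))
      (hcard x₀) hx₀
  refine ⟨l, c, hl, hlr, hcr, fun x => ?_⟩
  rw [← h _ (hcard x), hsym, Bool.not_eq_false]
end

section
/- There exist absolute constants K > 0 and c > 0 such that the following holds. For every integer r ≥ 1, every symmetric periodic predicate P : {0,1}^r → {0,1}, every ε ∈ (0,1), every n ≥ 1, and every instance Φ of CSP(P) on n variables, Φ admits an (ε, s)-sparsifier with s ≤ K·n·(log₂(2r))²·(log₂(2nr/ε))^c / ε². -/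
/-- Abel summation: a sum with nonnegative upper-level sums stays nonnegative after
multiplication by the level function. -/
theorem sum_mul_nonneg_of_upper_sums_nonneg {E : Type*} (b : E → ℝ) :
    ∀ (A : Finset E) (κ : E → ℝ), (∀ e ∈ A, 0 ≤ κ e) →
      (∀ τ : ℝ, 0 ≤ ∑ e ∈ A with τ ≤ κ e, b e) → 0 ≤ ∑ e ∈ A, κ e * b e := by
  intro A
  induction A using Finset.strongInduction with
  | H A ih =>
    intro κ hκ hb
    rcases A.eq_empty_or_nonempty with rfl | hA
    · simp
    obtain ⟨e₀, he₀, hmin⟩ := A.exists_min_image κ hA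
    have hlt : (A.filter fun e => κ e₀ < κ e) ⊂ A :=
      Finset.filter_ssubset.2 ⟨e₀, he₀, by simp⟩
    have key : ∑ e ∈ A, κ e * b e =
        κ e₀ * ∑ e ∈ A, b e + ∑ e ∈ A with κ e₀ < κ e, (κ e - κ e₀) * b e := by
      rw [Finset.sum_filter, Finset.mul_sum, ← Finset.sum_add_distrib]
      refine Finset.sum_congr rfl fun e he => ?_
      split_ifs with h
      · ring
      · have : κ e = κ e₀ := le_antisymm (not_lt.1 h) (hmin e he)
        rw [this]; ring
    have h1 : 0 ≤ ∑ e ∈ A, b e := by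
      have := hb (κ e₀)
      rwa [Finset.filter_true_of_mem fun e he => hmin e he] at this
    have h2 := ih _ hlt (fun e => κ e - κ e₀)
      (fun e he => sub_nonneg.2 (Finset.mem_filter.1 he).2.le) (fun τ => by
        rw [Finset.filter_filter]
        by_cases hτ : 0 < τ
        · convert hb (τ + κ e₀) using 2
          ext e
          simp only [Finset.mem_filter, and_congr_right_iff]
          intro _
          constructor
          · rintro ⟨-, h⟩; linarith
          · intro h; constructor <;> linarith
        · by_cases hne : (A.filter fun e => κ e₀ < κ e).Nonempty
          · obtain ⟨e₁, he₁, hmin₁⟩ := Finset.exists_min_image _ κ hne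
            convert hb (κ e₁) using 2
            ext e
            simp only [Finset.mem_filter] at he₁ hmin₁ ⊢
            refine and_congr_right fun he => ⟨fun h => hmin₁ e ⟨he, h.1⟩, fun h => ?_⟩
            have := he₁.2
            constructor <;> linarith
          · rw [Finset.not_nonempty_iff_eq_empty] at hne
            rw [← Finset.filter_filter, hne]; simp)
    rw [key]
    exact add_nonneg (mul_nonneg (hκ _ he₀) h1) h2

/-- A monotone supermodular set function is dominated by a modular function whose density with
respect to `w` has only tight upper level sets. -/
theorem exists_density_tight {E : Type*} [DecidableEq E] (w : E → ℝ) :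
    ∀ (A : Finset E) (g : Finset E → ℝ), (∀ e ∈ A, 0 < w e) → g ∅ = 0 → Monotone g →
      (∀ S T, g S + g T ≤ g (S ∪ T) + g (S ∩ T)) →
      ∃ z : E → ℝ, (∀ e ∈ A, 0 ≤ z e) ∧ (∀ S ⊆ A, g S ≤ ∑ e ∈ S, w e * z e) ∧
        ∀ θ : ℝ, ∑ e ∈ A with θ < z e, w e * z e = g (A.filter fun e => θ < z e) := by
  intro A
  induction A using Finset.strongInduction with
  | H A ih =>
    intro g hw g0 gm gs
    rcases A.eq_empty_or_nonempty with rfl | hA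
    · refine ⟨fun _ => 0, by simp, ?_, by simp [g0]⟩
      intro S hS
      rw [Finset.subset_empty.1 hS]; simp [g0]
    obtain ⟨T, hT, hmax⟩ := (A.powerset.filter Finset.Nonempty).exists_max_image
      (fun T => g T / ∑ e ∈ T, w e) ⟨A, by simp [hA]⟩
    simp only [Finset.mem_filter, Finset.mem_powerset] at hT hmax
    obtain ⟨hTA, hTne⟩ := hT
    set ζ := g T / ∑ e ∈ T, w e with hζ
    have wpos : ∀ S ⊆ A, S.Nonempty → 0 < ∑ e ∈ S, w e := fun S hS hne =>
      Finset.sum_pos (fun e he => hw e (hS he)) hne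
    have gT : g T = ζ * ∑ e ∈ T, w e := by
      rw [hζ, div_mul_cancel₀ _ (wpos T hTA hTne).ne']
    have gle : ∀ S ⊆ A, g S ≤ ζ * ∑ e ∈ S, w e := by
      intro S hS
      rcases S.eq_empty_or_nonempty with rfl | hne
      · simp [g0]
      · exact (div_le_iff₀ (wpos S hS hne)).1 (hmax S ⟨hS, hne⟩)
    have gnn : ∀ S, 0 ≤ g S := fun S => g0 ▸ gm (Finset.empty_subset S)
    have ζnn : 0 ≤ ζ := div_nonneg (gnn T) (wpos T hTA hTne).le
    have hss : A \ T ⊂ A := Finset.sdiff_ssubset hTA hTne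
    obtain ⟨z, z0, zdom, ztight⟩ := ih (A \ T) hss (fun S => g (S ∪ T) - g T)
      (fun e he => hw e (Finset.sdiff_subset he)) (by simp)
      (fun S S' h => sub_le_sub_right (gm (Finset.union_subset_union_left h)) _)
      (fun S S' => by
        have := gs (S ∪ T) (S' ∪ T)
        rw [← Finset.union_union_distrib_right, ← Finset.inter_union_distrib_right] at this
        linarith)
    have zle : ∀ e ∈ A \ T, z e ≤ ζ := by
      by_contra! hcon
      obtain ⟨e, he, hez⟩ := hcon
      set F := (A \ T).filter fun e => ζ < z e with hF
      have hFA : F ⊆ A := (Finset.filter_subset _ _).trans Finset.sdiff_subset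
      have hdis : Disjoint F T :=
        Finset.disjoint_of_subset_left (Finset.filter_subset _ _) Finset.sdiff_disjoint
      have h1 := ztight ζ
      have h2 : ζ * ∑ e ∈ F, w e < ∑ e ∈ F, w e * z e := by
        rw [Finset.mul_sum]
        refine Finset.sum_lt_sum_of_nonempty ⟨e, by simp [hF, hez, Finset.mem_sdiff.1 he]⟩ ?_
        intro i hi
        rw [mul_comm]
        exact mul_lt_mul_of_pos_left (Finset.mem_filter.1 hi).2 (hw i (hFA hi))
      have h3 := gle (F ∪ T) (Finset.union_subset hFA hTA)
      rw [Finset.sum_union hdis] at h3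
      simp only [← hF] at h1
      linarith
    have hsplit : ∀ S ⊆ A, ∑ e ∈ S, w e * (if e ∈ T then ζ else z e) =
        ζ * ∑ e ∈ S ∩ T, w e + ∑ e ∈ S \ T, w e * z e := by
      intro S _
      rw [← Finset.sum_inter_add_sum_sdiff S T, Finset.mul_sum]
      congr 1
      · refine Finset.sum_congr rfl fun e he => ?_
        rw [if_pos (Finset.mem_inter.1 he).2, mul_comm]
      · refine Finset.sum_congr rfl fun e he => ?_
        rw [if_neg (Finset.mem_sdiff.1 he).2]
    refine ⟨fun e => if e ∈ T then ζ else z e, ?_, ?_, ?_⟩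
    · intro e he
      dsimp only
      split_ifs with h
      · exact ζnn
      · exact z0 e (Finset.mem_sdiff.2 ⟨he, h⟩)
    · intro S hS
      rw [hsplit S hS]
      have h1 := gle (S ∩ T) (Finset.inter_subset_left.trans hS)
      have h2 := zdom (S \ T) (Finset.sdiff_subset_sdiff hS le_rfl)
      rw [Finset.sdiff_union_self_eq_union] at h2
      have h3 := gs S T
      linarith
    · intro θ
      rw [hsplit _ (Finset.filter_subset _ _)]
      rcases lt_or_ge θ ζ with h | h
      · have e1 : (A.filter fun e => θ < if e ∈ T then ζ else z e) ∩ T = T := by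
          ext e
          simp only [Finset.mem_inter, Finset.mem_filter]
          constructor
          · exact fun h => h.2
          · intro he; simp [he, hTA he, h]
        have e2 : (A.filter fun e => θ < if e ∈ T then ζ else z e) \ T =
            (A \ T).filter fun e => θ < z e := by
          ext e
          simp only [Finset.mem_sdiff, Finset.mem_filter]
          constructor
          · rintro ⟨⟨h1, h2⟩, h3⟩; rw [if_neg h3] at h2; exact ⟨⟨h1, h3⟩, h2⟩
          · rintro ⟨⟨h1, h3⟩, h2⟩; rw [if_neg h3]; exact ⟨⟨h1, h2⟩, h3⟩
        rw [e1, e2, ztight θ, ← gT, ← e2, Finset.sdiff_union_self_eq_union]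
        have : T ⊆ A.filter fun e => θ < if e ∈ T then ζ else z e :=
          Finset.inter_eq_right.1 e1
        rw [Finset.union_eq_left.2 this]; ring
      · have : (A.filter fun e => θ < if e ∈ T then ζ else z e) = ∅ := by
          refine Finset.filter_false_of_mem fun e he => ?_
          split_ifs with hT
          · exact not_lt.2 h
          · exact not_lt.2 ((zle e (Finset.mem_sdiff.2 ⟨he, hT⟩)).trans h)
        rw [this]; simp [g0]

/-- Zeros of a periodic function on `{0, …, r}` are the zeros of an affine map to `ZMod q`. -/
theorem exists_affine_zmod_of_periodic (r : ℕ) (hr : 1 ≤ r) (P₀ : ℕ → Bool)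
    (h : ∀ k₁ k₂ k₃ : ℕ, k₁ ≤ r → k₂ ≤ r → k₃ ≤ r → P₀ k₁ = false → P₀ k₂ = false →
      ((k₃ : ℤ) = 2 * (k₂ : ℤ) - (k₁ : ℤ) ∨ (k₃ : ℤ) = 2 * (k₁ : ℤ) - (k₂ : ℤ)) →
      P₀ k₃ = false) :
    ∃ (q : ℕ) (α β : ZMod q), 1 ≤ q ∧ q ≤ 2 * r ∧
      ∀ k : ℕ, k ≤ r → (P₀ k = true ↔ α * (k : ZMod q) + β ≠ 0) := by
  classical
  by_cases h0 : ∃ b ≤ r, P₀ b = false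
  swap
  · refine ⟨2, 0, 1, by omega, by omega, fun k hk => ?_⟩
    push Not at h0
    simpa using h0 k hk
  obtain ⟨b, hb, hPb⟩ := h0
  by_cases h1 : ∃ d, 0 < d ∧ ∃ x, x + d ≤ r ∧ P₀ x = false ∧ P₀ (x + d) = false
  · obtain ⟨dpos, x, hxr, hx, hxd⟩ := Nat.find_spec h1
    have hmin := fun k (hk : k < Nat.find h1) => Nat.find_min h1 hk
    set d := Nat.find h1
    have up : ∀ i : ℕ, x + d * i + d ≤ r →
        P₀ (x + d * i) = false ∧ P₀ (x + d * i + d) = false := by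
      intro i
      induction i with
      | zero => intro _; simpa using ⟨hx, hxd⟩
      | succ i ih =>
        intro hi
        rw [mul_add, mul_one] at hi ⊢
        obtain ⟨ha, hb⟩ := ih (by omega)
        refine ⟨by rwa [← add_assoc], h (x + d * i) (x + d * i + d) _ (by omega) (by omega)
          (by omega) ha hb (Or.inl (by push_cast; ring))⟩
    have up' : ∀ i : ℕ, x + d * i ≤ r → P₀ (x + d * i) = false := by
      intro i hi
      rcases i with _ | i
      · simpa using hx
      · rw [mul_add, mul_one, ← add_assoc] at hi ⊢
        exact (up i hi).2
    have down : ∀ i y : ℕ, y + d * i = x → P₀ y = false ∧ P₀ (y + d) = false := by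
      intro i
      induction i with
      | zero => intro y hy; simp at hy; subst hy; exact ⟨hx, hxd⟩
      | succ i ih =>
        intro y hy
        rw [mul_add, mul_one] at hy
        obtain ⟨ha, hb⟩ := ih (y + d) (by omega)
        refine ⟨h (y + d) (y + d + d) y (by omega) ?_ (by omega) ha hb
          (Or.inr (by push_cast; ring)), ha⟩
        rcases i with _ | i
        · omega
        · rw [mul_add, mul_one] at hy; omega
    have cong : ∀ k ≤ r, k ≡ x [MOD d] → P₀ k = false := by
      intro k hk hkx
      rcases le_total k x with hle | hle
      · obtain ⟨i, hi⟩ := (Nat.modEq_iff_dvd' hle).1 hkx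
        exact (down i k (by omega)).1
      · obtain ⟨i, hi⟩ := (Nat.modEq_iff_dvd' hle).1 hkx.symm
        have : k = x + d * i := by omega
        rw [this] at hk ⊢
        exact up' i hk
    have conv : ∀ k ≤ r, P₀ k = false → k ≡ x [MOD d] := by
      intro k hk hPk
      by_contra hne
      rcases le_total x k with hle | hle
      · have hm : (k - x) % d ≠ 0 := fun h0 =>
          hne ((Nat.modEq_iff_dvd' hle).2 (Nat.dvd_of_mod_eq_zero h0)).symm
        have hlt := Nat.mod_lt (k - x) dpos
        have hdm := Nat.div_add_mod (k - x) d
        refine hmin _ hlt ⟨Nat.pos_of_ne_zero hm, x + d * ((k - x) / d), by omega,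
          up' _ (by omega), ?_⟩
        have : x + d * ((k - x) / d) + (k - x) % d = k := by omega
        rwa [this]
      · have hm : (x - k) % d ≠ 0 := fun h0 =>
          hne ((Nat.modEq_iff_dvd' hle).2 (Nat.dvd_of_mod_eq_zero h0))
        have hlt := Nat.mod_lt (x - k) dpos
        have hdm := Nat.div_add_mod (x - k) d
        refine hmin _ hlt ⟨Nat.pos_of_ne_zero hm, k, by omega, hPk, ?_⟩
        exact (down ((x - k) / d) _ (by omega)).1
    refine ⟨d, 1, -(x : ZMod d), dpos, by omega, fun k hk => ?_⟩
    rw [one_mul, ← sub_eq_add_neg, sub_ne_zero, Ne, ZMod.natCast_eq_natCast_iff]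
    rw [← Bool.not_eq_false]
    exact not_congr ⟨conv k hk, cong k hk⟩
  · refine ⟨r + 1, 1, -(b : ZMod (r + 1)), by omega, by omega, fun k hk => ?_⟩
    rw [one_mul, ← sub_eq_add_neg, sub_ne_zero, Ne, ZMod.natCast_eq_natCast_iff,
      ← Bool.not_eq_false]
    refine not_congr ⟨fun hPk => ?_, fun hkb => ?_⟩
    · push Not at h1
      rcases lt_trichotomy k b with hlt | rfl | hlt
      · exact absurd (by rwa [Nat.add_sub_cancel' hlt.le])
          (h1 (b - k) (by omega) k (by omega) hPk)
      · rfl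
      · exact absurd (by rwa [Nat.add_sub_cancel' hlt.le])
          (h1 (k - b) (by omega) b (by omega) hPb)
    · have := Nat.ModEq.eq_of_lt_of_lt hkb (by omega) (by omega)
      rwa [this]

/-- The codewords of `C` vanishing outside `T`. -/
def supportedOn {E A : Type*} [AddCommGroup A] (C : AddSubgroup (E → A)) (T : Finset E) :
    AddSubgroup (E → A) where
  carrier := {c | c ∈ C ∧ ∀ e ∉ T, c e = 0}
  zero_mem' := ⟨C.zero_mem, fun _ _ => rfl⟩
  add_mem' := fun ha hb => ⟨C.add_mem ha.1 hb.1, fun e he => by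
    rw [Pi.add_apply, ha.2 e he, hb.2 e he, add_zero]⟩
  neg_mem' := fun ha => ⟨C.neg_mem ha.1, fun e he => by
    rw [Pi.neg_apply, ha.2 e he, neg_zero]⟩

/-- Setting the coordinates in `T` to zero. -/
def eraseOn {E A : Type*} [DecidableEq E] [AddCommGroup A] (T : Finset E) :
    (E → A) →+ (E → A) where
  toFun c := fun e => if e ∈ T then 0 else c e
  map_zero' := by ext e; simp
  map_add' a b := by ext e; by_cases h : e ∈ T <;> simp [h]

open Classical in
/-- The total `u`-weight of the support of `c`. -/
noncomputable def suppWeight {E A : Type*} [Fintype E] [AddCommGroup A] (u : E → ℝ) (c : E → A) :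
    ℝ :=
  ∑ e with c e ≠ 0, u e

open Classical in
/-- The coordinates on which some codeword of `C` is nonzero. -/
noncomputable def codeSupport {E A : Type*} [Fintype E] [AddCommGroup A]
    (C : AddSubgroup (E → A)) : Finset E :=
  Finset.univ.filter fun e => ∃ c ∈ C, c e ≠ 0

section Code

variable {E A : Type*} [AddCommGroup A]

theorem mem_supportedOn {C : AddSubgroup (E → A)} {T : Finset E} {c : E → A} :
    c ∈ supportedOn C T ↔ c ∈ C ∧ ∀ e ∉ T, c e = 0 := Iff.rfl

theorem supportedOn_le (C : AddSubgroup (E → A)) (T : Finset E) : supportedOn C T ≤ C :=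
  fun _ h => h.1

theorem supportedOn_mono (C : AddSubgroup (E → A)) : Monotone (supportedOn C) :=
  fun _ _ h _ hc => ⟨hc.1, fun e he => hc.2 e fun h' => he (h h')⟩

theorem supportedOn_empty (C : AddSubgroup (E → A)) : supportedOn C ∅ = ⊥ := by
  ext c
  simp only [mem_supportedOn, AddSubgroup.mem_bot, Finset.notMem_empty, not_false_eq_true,
    forall_const]
  refine ⟨fun h => funext h.2, ?_⟩
  rintro rfl
  exact ⟨C.zero_mem, fun _ => rfl⟩

theorem card_mul_relIndex_of_le {G : Type*} [AddGroup G] {H K : AddSubgroup G} (h : H ≤ K) :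
    Nat.card H * H.relIndex K = Nat.card K := by
  rw [← AddSubgroup.relIndex_bot_left, AddSubgroup.relIndex_mul_relIndex _ _ _ bot_le h,
    AddSubgroup.relIndex_bot_left]

theorem two_mul_card_le_of_lt {G : Type*} [AddGroup G] [Finite G] {H K : AddSubgroup G}
    (h : H < K) : 2 * Nat.card H ≤ Nat.card K := by
  rw [← card_mul_relIndex_of_le h.le, mul_comm]
  refine Nat.mul_le_mul_left _ ?_
  have h0 : H.relIndex K ≠ 0 := AddSubgroup.index_ne_zero_of_finite
  have h1 : H.relIndex K ≠ 1 := fun h1 => h.not_ge (AddSubgroup.relIndex_eq_one.1 h1)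
  omega

theorem card_supportedOn_mul_card_map_eraseOn [DecidableEq E] (C : AddSubgroup (E → A))
    (T : Finset E) :
    Nat.card (supportedOn C T) * Nat.card (C.map (eraseOn T)) = Nat.card C := by
  have : supportedOn C T = (eraseOn T).ker ⊓ C := by
    ext c
    simp only [AddSubgroup.mem_inf, mem_supportedOn, AddMonoidHom.mem_ker, eraseOn,
      AddMonoidHom.coe_mk, ZeroHom.coe_mk, funext_iff, Pi.zero_apply, ite_eq_left_iff]
    exact and_comm
  rw [← AddSubgroup.relIndex_ker, ← AddSubgroup.inf_relIndex_right, ← this]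
  exact card_mul_relIndex_of_le (supportedOn_le C T)

variable [Fintype E]

theorem supportedOn_univ (C : AddSubgroup (E → A)) : supportedOn C Finset.univ = C := by
  ext c
  simp [mem_supportedOn]

theorem suppWeight_add_sum_vanishing {u : E → ℝ} {C : AddSubgroup (E → A)} {c : E → A}
    (hc : c ∈ C) [DecidablePred fun e => c e = 0] :
    suppWeight u c + ∑ e ∈ codeSupport C with c e = 0, u e = ∑ e ∈ codeSupport C, u e := by
  classical
  rw [← Finset.sum_filter_add_sum_filter_not (codeSupport C) (fun e => c e = 0), add_comm]
  congr 1
  · rw [suppWeight]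
    refine Finset.sum_congr ?_ fun _ _ => rfl
    ext e
    simp only [codeSupport, Finset.mem_filter, Finset.mem_univ, true_and]
    exact ⟨fun h => ⟨⟨c, hc, h⟩, h⟩, fun h => h.2⟩

variable [Finite A]

theorem card_supportedOn_mul_le [DecidableEq E] (C : AddSubgroup (E → A)) (S T : Finset E) :
    Nat.card (supportedOn C S) * Nat.card (supportedOn C T) ≤
      Nat.card (supportedOn C (S ∪ T)) * Nat.card (supportedOn C (S ∩ T)) := by
  have hinf : supportedOn C (S ∩ T) = supportedOn C S ⊓ supportedOn C T := by
    ext c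
    simp only [AddSubgroup.mem_inf, mem_supportedOn, Finset.mem_inter]
    constructor
    · rintro ⟨h1, h2⟩
      exact ⟨⟨h1, fun e he => h2 e fun h => he h.1⟩, ⟨h1, fun e he => h2 e fun h => he h.2⟩⟩
    · rintro ⟨⟨h1, h2⟩, -, h3⟩
      refine ⟨h1, fun e he => ?_⟩
      by_cases hS : e ∈ S
      · exact h3 e fun h => he ⟨hS, h⟩
      · exact h2 e hS
  have hS := supportedOn_mono C (Finset.subset_union_left (s₁ := S) (s₂ := T))
  have hT := supportedOn_mono C (Finset.subset_union_right (s₁ := S) (s₂ := T))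
  rw [← card_mul_relIndex_of_le hS,
    ← card_mul_relIndex_of_le (supportedOn_mono C (Finset.inter_subset_right (s₁ := S) (s₂ := T)))]
  conv_lhs => rw [hinf, AddSubgroup.inf_relIndex_right, ← hinf]
  have := AddSubgroup.relIndex_le_of_le_right (H := supportedOn C S) hT
    AddSubgroup.index_ne_zero_of_finite
  nlinarith [Nat.zero_le (Nat.card (supportedOn C S) * Nat.card (supportedOn C (S ∩ T)))]

theorem one_le_natCast_card (C : AddSubgroup (E → A)) : (1 : ℝ) ≤ Nat.card C := by
  exact_mod_cast Nat.card_pos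

theorem logb_card_nonneg (C : AddSubgroup (E → A)) : 0 ≤ Real.logb 2 (Nat.card C) :=
  Real.logb_nonneg one_lt_two (one_le_natCast_card C)

open Classical in
/-- Karger-style bound on the number of codewords of small weight. -/
theorem card_light_le (u : E → ℝ) (hu : ∀ e, 0 ≤ u e) (t : ℕ) :
    ∀ (k : ℕ) (C : AddSubgroup (E → A)), Nat.card C = k →
      (∀ H ≤ C, Real.logb 2 (Nat.card H) ≤ ∑ e ∈ codeSupport H, u e) →
      (Set.ncard {c : E → A | c ∈ C ∧ suppWeight u c ≤ t} : ℝ) ≤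
        4 ^ t * (1 + Real.logb 2 (Nat.card C)) ^ (2 * t) := by
  intro k
  induction k using Nat.strong_induction_on with
  | _ k ih =>
  intro C hk hC
  set ℓ := Real.logb 2 (Nat.card C) with hℓ
  have hℓ0 : 0 ≤ ℓ := logb_card_nonneg C
  rcases le_or_gt ℓ (2 * t) with hle | hgt
  · have h1 : (Set.ncard {c : E → A | c ∈ C ∧ suppWeight u c ≤ t} : ℝ) ≤ Nat.card C := by
      exact_mod_cast Set.ncard_le_ncard
        (show {c : E → A | c ∈ C ∧ suppWeight u c ≤ t} ⊆ (C : Set (E → A)) from fun c hc => hc.1)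
        (Set.toFinite _)
    have h2 : (Nat.card C : ℝ) ≤ 4 ^ t := by
      have := (Real.logb_le_iff_le_rpow one_lt_two (by linarith [one_le_natCast_card C])).1 hle
      refine this.trans_eq ?_
      rw [Real.rpow_mul (by norm_num), Real.rpow_natCast]
      norm_num
    have h3 : (1 : ℝ) ≤ (1 + ℓ) ^ (2 * t) := one_le_pow₀ (by linarith)
    nlinarith [pow_pos (show (0 : ℝ) < 4 by norm_num) t]
  · set us := ∑ e ∈ codeSupport C, u e with hus
    have hus' : ℓ ≤ us := hC C le_rfl
    have ht0 : (0 : ℝ) ≤ t := Nat.cast_nonneg t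
    have hℓpos : 0 < ℓ := by linarith
    set light : Finset (E → A) := (Set.toFinite {c : E → A | c ∈ C ∧ suppWeight u c ≤ t}).toFinset
      with hlight
    have hN : (Set.ncard {c : E → A | c ∈ C ∧ suppWeight u c ≤ t} : ℝ) = light.card := by
      rw [hlight, Set.ncard_eq_toFinset_card _]
    rw [hN]
    set N : ℝ := (light.card : ℝ) with hNdef
    set B : ℝ := 4 ^ t * ℓ ^ (2 * t) with hB
    have hB0 : 0 ≤ B := by positivity
    have step : ∀ e ∈ codeSupport C, ((light.filter fun c => c e = 0).card : ℝ) ≤ B := by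
      intro e he
      set D := supportedOn C (Finset.univ.erase e) with hD
      have hlt : D < C := by
        refine lt_of_le_of_ne (supportedOn_le _ _) fun h => ?_
        obtain ⟨c, hc, hce⟩ := (Finset.mem_filter.1 he).2
        rw [← h] at hc
        exact hce (hc.2 e (by simp))
      have hcard := two_mul_card_le_of_lt hlt
      have hpos : 0 < Nat.card D := Nat.card_pos
      have h1 := ih (Nat.card D) (by omega) D rfl fun H hH => hC H (hH.trans hlt.le)
      have h2 : 1 + Real.logb 2 (Nat.card D) ≤ ℓ := by
        rw [← Real.logb_self_eq_one (b := 2) one_lt_two,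
          ← Real.logb_mul (by norm_num) (by positivity)]
        exact Real.logb_le_logb_of_le one_lt_two (by positivity) (by exact_mod_cast hcard)
      have h0 := logb_card_nonneg D
      calc ((light.filter fun c => c e = 0).card : ℝ)
          = (Set.ncard {c : E → A | c ∈ D ∧ suppWeight u c ≤ t} : ℝ) := by
            rw [← Set.ncard_coe_finset]
            congr 2
            ext c
            simp only [hlight, Finset.coe_filter, Set.Finite.mem_toFinset, Set.mem_ofPred_eq, hD,
              mem_supportedOn, Finset.mem_erase, Finset.mem_univ, and_true, not_not]
            constructor
            · rintro ⟨⟨h1, h2⟩, h3⟩; exact ⟨⟨h1, fun e' he' => he' ▸ h3⟩, h2⟩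
            · rintro ⟨⟨h1, h2⟩, h3⟩; exact ⟨⟨h1, h3⟩, h2 e rfl⟩
        _ ≤ 4 ^ t * (1 + Real.logb 2 (Nat.card D)) ^ (2 * t) := h1
        _ ≤ B := by rw [hB]; gcongr
    have dc : ∑ e ∈ codeSupport C, u e * ((light.filter fun c => c e = 0).card : ℝ) =
        ∑ c ∈ light, ∑ e ∈ codeSupport C with c e = 0, u e := by
      simp_rw [Finset.sum_filter]
      rw [Finset.sum_comm]
      refine Finset.sum_congr rfl fun e _ => ?_
      rw [← Finset.sum_filter, Finset.sum_const, nsmul_eq_mul, mul_comm]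
    have upper : ∑ e ∈ codeSupport C, u e * ((light.filter fun c => c e = 0).card : ℝ) ≤
        us * B := by
      rw [hus, Finset.sum_mul]
      exact Finset.sum_le_sum fun e he => mul_le_mul_of_nonneg_left (step e he) (hu e)
    have lower : N * (us - t) ≤
        ∑ c ∈ light, ∑ e ∈ codeSupport C with c e = 0, u e := by
      rw [hNdef, ← nsmul_eq_mul]
      refine Finset.card_nsmul_le_sum _ _ _ fun c hc => ?_
      obtain ⟨hcC, hct⟩ : c ∈ C ∧ suppWeight u c ≤ t := by simpa [hlight] using hc
      have := suppWeight_add_sum_vanishing (u := u) hcC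
      linarith
    have h1 : N * (us - t) ≤ us * B := by linarith
    have h2 : N ≤ B * (1 + 2 * t / ℓ) := by
      have hN' : N ≤ B * (1 + 2 * t / us) := by
        have hpos : 0 < us - t := by linarith
        have : us * B ≤ B * (1 + 2 * t / us) * (us - t) := by
          have huspos : 0 < us := by linarith
          have : (1 + 2 * t / us) * (us - t) = us + t * (us - 2 * t) / us := by
            field_simp; ring
          have h3 : 0 ≤ t * (us - 2 * t) / us :=
            div_nonneg (mul_nonneg ht0 (by linarith)) huspos.le
          rw [mul_assoc, this]
          nlinarith
        exact le_of_mul_le_mul_right (h1.trans this) hpos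
      refine hN'.trans (mul_le_mul_of_nonneg_left ?_ hB0)
      gcongr
    refine h2.trans ?_
    have h3 : 1 + 2 * t / ℓ ≤ (1 + 1 / ℓ) ^ (2 * t) := by
      have := one_add_mul_le_pow (a := 1 / ℓ) (by linarith [one_div_pos.2 hℓpos]) (2 * t)
      refine le_trans (le_of_eq ?_) this
      push_cast; ring
    calc B * (1 + 2 * t / ℓ) ≤ B * (1 + 1 / ℓ) ^ (2 * t) := mul_le_mul_of_nonneg_left h3 hB0
      _ = 4 ^ t * (1 + ℓ) ^ (2 * t) := by
        rw [hB, mul_assoc, ← mul_pow]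
        congr 2
        field_simp
        ring

end Code

section Sampling

variable {E : Type*} [Fintype E] [DecidableEq E]

/-- The mean of `F` over a random subset containing each `e` independently with
probability `p e`. -/
noncomputable def bernoulliMean (p : E → ℝ) (F : Finset E → ℝ) : ℝ :=
  ∑ S : Finset E, ((∏ e ∈ S, p e) * ∏ e ∈ Finset.univ \ S, (1 - p e)) * F S

theorem bernoulliMean_prod (p : E → ℝ) (φ ψ : E → ℝ) :
    bernoulliMean p (fun S => ∏ e, if e ∈ S then φ e else ψ e) =
      ∏ e, (p e * φ e + (1 - p e) * ψ e) := by
  rw [Finset.prod_add, Finset.powerset_univ, bernoulliMean]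
  refine Finset.sum_congr rfl fun S _ => ?_
  rw [Finset.prod_mul_distrib, Finset.prod_mul_distrib, mul_mul_mul_comm]
  congr 1
  rw [Finset.prod_ite]
  congr 2
  · ext; simp
  · ext; simp

theorem bernoulliMean_add (p : E → ℝ) (F G : Finset E → ℝ) :
    bernoulliMean p (fun S => F S + G S) = bernoulliMean p F + bernoulliMean p G := by
  simp only [bernoulliMean, mul_add, Finset.sum_add_distrib]

theorem bernoulliMean_sum {ι : Type*} (p : E → ℝ) (I : Finset ι) (F : ι → Finset E → ℝ) :
    bernoulliMean p (fun S => ∑ i ∈ I, F i S) = ∑ i ∈ I, bernoulliMean p (F i) := by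
  simp only [bernoulliMean, Finset.mul_sum]
  exact Finset.sum_comm

theorem bernoulliMean_const_mul (p : E → ℝ) (a : ℝ) (F : Finset E → ℝ) :
    bernoulliMean p (fun S => a * F S) = a * bernoulliMean p F := by
  simp only [bernoulliMean, Finset.mul_sum]
  exact Finset.sum_congr rfl fun S _ => by ring

theorem exists_lt_of_bernoulliMean_lt {p : E → ℝ} (hp0 : ∀ e, 0 ≤ p e) (hp1 : ∀ e, p e ≤ 1)
    {F : Finset E → ℝ} {a : ℝ} (h : bernoulliMean p F < a) : ∃ S, F S < a := by
  by_contra! hcon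
  have h1 : bernoulliMean p (fun _ => a * 1) = a := by
    rw [bernoulliMean_const_mul]
    have := bernoulliMean_prod p (fun _ => 1) (fun _ => 1)
    simp only [ite_self, Finset.prod_const_one, mul_one, add_sub_cancel] at this
    rw [this, mul_one]
  refine absurd h (not_lt.2 ?_)
  rw [← h1]
  refine Finset.sum_le_sum fun S _ => mul_le_mul_of_nonneg_left (by simpa using hcon S) ?_
  exact mul_nonneg (Finset.prod_nonneg fun e _ => hp0 e)
    (Finset.prod_nonneg fun e _ => sub_nonneg.2 (hp1 e))

theorem bernoulliMean_two_pow_card_le (p : E → ℝ) (hp0 : ∀ e, 0 ≤ p e) :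
    bernoulliMean p (fun S => 2 ^ S.card) ≤ Real.exp (∑ e, p e) := by
  have h : ∀ S : Finset E, (2 : ℝ) ^ S.card = ∏ e, if e ∈ S then (2 : ℝ) else 1 := by
    intro S
    rw [Finset.prod_ite]
    simp
  simp only [h]
  rw [bernoulliMean_prod p (fun _ => 2) (fun _ => 1), Real.exp_sum]
  refine Finset.prod_le_prod (fun e _ => by linarith [hp0 e]) fun e _ => ?_
  linarith [Real.add_one_le_exp (p e)]

/-- One-coordinate moment generating function bound behind the Chernoff estimate. -/
theorem bernoulli_exp_le {u ρ ε s : ℝ} (hρ : 0 < ρ) (hu : 0 ≤ u) (hε1 : ε < 1) (hε : 0 < ε)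
    (hs : |s| = ε / 2) :
    min 1 (ρ * u) * Real.exp (ρ * (s * (u / min 1 (ρ * u) - u) - ε ^ 2 / 2 * u)) +
      (1 - min 1 (ρ * u)) * Real.exp (ρ * (s * (0 - u) - ε ^ 2 / 2 * u)) ≤
      Real.exp (-(ρ * ε ^ 2 / 4 * u)) := by
  have hs2 : s ^ 2 = ε ^ 2 / 4 := by rw [← sq_abs, hs]; ring
  have hexp : Real.exp s ≤ 1 + s + ε ^ 2 / 4 := by
    have := (abs_le.1 (Real.abs_exp_sub_one_sub_id_le (x := s) (by rw [hs]; linarith))).2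
    linarith
  have hρu : 0 ≤ ρ * u := by positivity
  rcases le_total 1 (ρ * u) with h | h
  · rw [min_eq_left h]
    simp only [div_one, sub_self, mul_zero, zero_sub, one_mul, zero_mul, add_zero]
    apply Real.exp_le_exp.2
    nlinarith [mul_nonneg hρu (sq_nonneg ε)]
  · rw [min_eq_right h]
    rcases hu.eq_or_lt with rfl | hu
    · simp
    have e1 : ρ * (s * (u / (ρ * u) - u) - ε ^ 2 / 2 * u) =
        s + (ρ * u) * (-s - ε ^ 2 / 2) := by
      field_simp
      ring
    have e2 : ρ * (s * (0 - u) - ε ^ 2 / 2 * u) = (ρ * u) * (-s - ε ^ 2 / 2) := by ring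
    rw [e1, e2, Real.exp_add]
    set p := ρ * u
    calc p * (Real.exp s * Real.exp (p * (-s - ε ^ 2 / 2))) +
          (1 - p) * Real.exp (p * (-s - ε ^ 2 / 2))
        = (p * (Real.exp s - 1) + 1) * Real.exp (p * (-s - ε ^ 2 / 2)) := by ring
      _ ≤ Real.exp (p * (Real.exp s - 1)) * Real.exp (p * (-s - ε ^ 2 / 2)) := by
        gcongr
        exact Real.add_one_le_exp _
      _ = Real.exp (p * (Real.exp s - 1 - s - ε ^ 2 / 2)) := by
        rw [← Real.exp_add]; congr 1; ring
      _ ≤ _ := by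
        apply Real.exp_le_exp.2
        have : p * (Real.exp s - 1 - s - ε ^ 2 / 2) ≤ p * (-(ε ^ 2 / 4)) :=
          mul_le_mul_of_nonneg_left (by linarith) hρu
        refine this.trans_eq ?_
        simp only [p]; ring

theorem bernoulliMean_exp_le {u : E → ℝ} {ρ ε s : ℝ} (hρ : 0 < ρ) (hu : ∀ e, 0 ≤ u e)
    (hε : 0 < ε) (hε1 : ε < 1) (hs : |s| = ε / 2) (F : Finset E) :
    bernoulliMean (fun e => min 1 (ρ * u e)) (fun S => Real.exp (ρ *
      (s * ∑ e ∈ F, ((if e ∈ S then u e / min 1 (ρ * u e) else 0) - u e) -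
        ε ^ 2 / 2 * ∑ e ∈ F, u e))) ≤ Real.exp (-(ρ * ε ^ 2 / 4 * ∑ e ∈ F, u e)) := by
  have h : ∀ S : Finset E, Real.exp (ρ *
      (s * ∑ e ∈ F, ((if e ∈ S then u e / min 1 (ρ * u e) else 0) - u e) -
        ε ^ 2 / 2 * ∑ e ∈ F, u e)) = ∏ e, if e ∈ S
          then (if e ∈ F then
            Real.exp (ρ * (s * (u e / min 1 (ρ * u e) - u e) - ε ^ 2 / 2 * u e)) else 1)
          else (if e ∈ F then Real.exp (ρ * (s * (0 - u e) - ε ^ 2 / 2 * u e)) else 1) := by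
    intro S
    rw [Finset.mul_sum, Finset.mul_sum, ← Finset.sum_sub_distrib, Finset.mul_sum, Real.exp_sum,
      ← Finset.prod_subset (Finset.subset_univ F)]
    · refine Finset.prod_congr rfl fun e he => ?_
      simp only [he, if_true]
      split_ifs <;> rfl
    · intro e _ he
      simp [he]
  simp only [h]
  rw [bernoulliMean_prod, Finset.mul_sum, ← Finset.sum_neg_distrib, Real.exp_sum,
    ← Finset.prod_subset (Finset.subset_univ F)]
  · refine Finset.prod_le_prod (fun e he => ?_) fun e he => ?_
    · have h0 : 0 ≤ min 1 (ρ * u e) := le_min zero_le_one (mul_nonneg hρ.le (hu e))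
      have h1 : 0 ≤ 1 - min 1 (ρ * u e) := sub_nonneg.2 (min_le_left _ _)
      simp only [he, if_true]
      positivity
    · simp only [he, if_true]
      exact bernoulli_exp_le hρ (hu e) hε1 hε hs
  · intro e _ he
    simp [he]

end Sampling

section Code

variable {E A : Type*} [AddCommGroup A] [Fintype E] [Finite A]

theorem logb_card_map_eraseOn_le [DecidableEq E] {u : E → ℝ} (hu : ∀ e, 0 ≤ u e)
    {C : AddSubgroup (E → A)} {T : Finset E}
    (hdom : ∀ S, Real.logb 2 (Nat.card (supportedOn C S)) ≤ ∑ e ∈ S, u e)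
    (htight : ∑ e ∈ T, u e = Real.logb 2 (Nat.card (supportedOn C T)))
    (H : AddSubgroup (E → A)) (hH : H ≤ C.map (eraseOn T)) :
    Real.logb 2 (Nat.card H) ≤ ∑ e ∈ codeSupport H, u e := by
  classical
  set K := H.comap (eraseOn T) ⊓ C with hK
  have h1 : K.map (eraseOn T) = H := by
    ext c
    constructor
    · rintro ⟨d, hd, rfl⟩
      exact hd.1
    · intro hc
      obtain ⟨d, hd, rfl⟩ := hH hc
      exact ⟨d, ⟨hc, hd⟩, rfl⟩
  have h2 : supportedOn K T = supportedOn C T := by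
    ext c
    simp only [mem_supportedOn, hK, AddSubgroup.mem_inf, AddSubgroup.mem_comap]
    refine ⟨fun h => ⟨h.1.2, h.2⟩, fun h => ⟨⟨?_, h.1⟩, h.2⟩⟩
    have : eraseOn T c = 0 := by
      ext e
      simpa [eraseOn] using h.2 e
    rw [this]
    exact H.zero_mem
  have h3 : K ≤ supportedOn C (codeSupport H ∪ T) := by
    intro c hc
    refine ⟨hc.2, fun e he => ?_⟩
    by_contra hne
    simp only [Finset.mem_union, not_or] at he
    refine he.1 (Finset.mem_filter.2 ⟨Finset.mem_univ _, eraseOn T c, hc.1, ?_⟩)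
    simpa [eraseOn, he.2] using hne
  have h4 := card_supportedOn_mul_card_map_eraseOn K T
  rw [h1, h2] at h4
  have h5 : Real.logb 2 (Nat.card K) ≤ ∑ e ∈ codeSupport H ∪ T, u e := by
    refine le_trans ?_ (hdom _)
    refine Real.logb_le_logb_of_le one_lt_two (by linarith [one_le_natCast_card K]) ?_
    exact_mod_cast AddSubgroup.card_le_of_le h3
  rw [← h4, Nat.cast_mul, Real.logb_mul (by linarith [one_le_natCast_card (supportedOn C T)])
    (by linarith [one_le_natCast_card H])] at h5
  have h6 : ∑ e ∈ codeSupport H ∪ T, u e ≤ ∑ e ∈ codeSupport H, u e + ∑ e ∈ T, u e := by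
    rw [← Finset.sum_union_inter]
    linarith [Finset.sum_nonneg fun e (_ : e ∈ codeSupport H ∩ T) => hu e]
  linarith

theorem one_le_suppWeight {u : E → ℝ} {C : AddSubgroup (E → A)}
    (hC : ∀ H ≤ C, Real.logb 2 (Nat.card H) ≤ ∑ e ∈ codeSupport H, u e) {c : E → A}
    (hc : c ∈ C) (hc0 : c ≠ 0) : 1 ≤ suppWeight u c := by
  classical
  have hle : AddSubgroup.zmultiples c ≤ C := by simpa using hc
  have h1 := hC _ hle
  have h2 : codeSupport (AddSubgroup.zmultiples c) = Finset.univ.filter fun e => c e ≠ 0 := by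
    ext e
    simp only [codeSupport, Finset.mem_filter, Finset.mem_univ, true_and]
    constructor
    · rintro ⟨d, ⟨k, rfl⟩, hd⟩ h
      simp [h] at hd
    · exact fun h => ⟨c, AddSubgroup.mem_zmultiples c, h⟩
  have h3 : 2 ≤ Nat.card (AddSubgroup.zmultiples c) := by
    have : (⊥ : AddSubgroup (E → A)) < AddSubgroup.zmultiples c :=
      bot_lt_iff_ne_bot.2 fun h => hc0 (AddSubgroup.zmultiples_eq_bot.1 h)
    simpa using two_mul_card_le_of_lt this
  have h4 : 1 ≤ Real.logb 2 (Nat.card (AddSubgroup.zmultiples c)) := by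
    rw [Real.le_logb_iff_rpow_le one_lt_two
      (by linarith [one_le_natCast_card (AddSubgroup.zmultiples c)])]
    simpa using (by exact_mod_cast h3 :
      (2 : ℝ) ≤ Nat.card (AddSubgroup.zmultiples c))
  rw [suppWeight]
  rw [h2] at h1
  exact h4.trans h1

open Classical in
theorem sum_rpow_suppWeight_le {u : E → ℝ} (hu : ∀ e, 0 ≤ u e) {C : AddSubgroup (E → A)}
    (hC : ∀ H ≤ C, Real.logb 2 (Nat.card H) ≤ ∑ e ∈ codeSupport H, u e) {L D : ℝ}
    (hL : Real.logb 2 (Nat.card C) ≤ L) (hD : 8 * (1 + L) ^ 2 ≤ D) (W : Finset (E → A))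
    (hW : ∀ c ∈ W, c ∈ C ∧ c ≠ 0) :
    ∑ c ∈ W, D ^ (-(2 * suppWeight u c)) ≤ 8 * (1 + L) ^ 2 / D := by
  have hL0 : 0 ≤ L := (logb_card_nonneg C).trans hL
  have hD1 : 1 ≤ D := by nlinarith
  set M := 4 * (1 + L) ^ 2 with hM
  have hM0 : 0 ≤ M := by positivity
  set x := M / D with hx
  have hx0 : 0 ≤ x := by positivity
  have hx2 : x ≤ 1 / 2 := by
    rw [hx, div_le_iff₀ (by linarith)]; linarith
  have hceil : ∀ c ∈ W, D ^ (-(2 * suppWeight u c)) ≤ (1 / D) ^ ⌈suppWeight u c⌉₊ := by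
    intro c hc
    have h1 := one_le_suppWeight hC (hW c hc).1 (hW c hc).2
    rw [one_div, inv_pow, ← Real.rpow_natCast, ← Real.rpow_neg (by linarith)]
    refine Real.rpow_le_rpow_of_exponent_le hD1 (neg_le_neg ?_)
    linarith [Nat.ceil_lt_add_one (show 0 ≤ suppWeight u c by linarith)]
  refine (Finset.sum_le_sum hceil).trans ?_
  set m := W.sup fun c => ⌈suppWeight u c⌉₊ with hm
  have hmaps : ∀ c ∈ W, ⌈suppWeight u c⌉₊ ∈ (Finset.range m).image (· + 1) := by
    intro c hc
    have h1 : 0 < ⌈suppWeight u c⌉₊ := Nat.ceil_pos.2 (by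
      linarith [one_le_suppWeight hC (hW c hc).1 (hW c hc).2])
    have h2 : ⌈suppWeight u c⌉₊ ≤ m := Finset.le_sup (f := fun c => ⌈suppWeight u c⌉₊) hc
    simp only [Finset.mem_image, Finset.mem_range]
    exact ⟨⌈suppWeight u c⌉₊ - 1, by omega, by omega⟩
  rw [← Finset.sum_fiberwise_of_maps_to hmaps, Finset.sum_image (by simp)]
  calc ∑ i ∈ Finset.range m, ∑ c ∈ W with ⌈suppWeight u c⌉₊ = i + 1, (1 / D) ^ ⌈suppWeight u c⌉₊
      ≤ ∑ i ∈ Finset.range m, x * (1 / 2) ^ i := by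
        refine Finset.sum_le_sum fun i _ => ?_
        rw [Finset.sum_congr rfl (g := fun _ => (1 / D) ^ (i + 1))
          (fun c hc => by rw [(Finset.mem_filter.1 hc).2]), Finset.sum_const, nsmul_eq_mul]
        have hcount : ((W.filter fun c => ⌈suppWeight u c⌉₊ = i + 1).card : ℝ) ≤ M ^ (i + 1) := by
          have h1 := card_light_le u hu (i + 1) _ C rfl hC
          have h2 : ((W.filter fun c => ⌈suppWeight u c⌉₊ = i + 1).card : ℝ) ≤
              (Set.ncard {c : E → A | c ∈ C ∧ suppWeight u c ≤ ((i + 1 : ℕ) : ℝ)} : ℝ) := by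
            rw [← Set.ncard_coe_finset]
            refine Nat.cast_le.2 (Set.ncard_le_ncard (fun c hc => ?_) (Set.toFinite _))
            have hc := Finset.mem_filter.1 (Finset.mem_coe.1 hc)
            exact ⟨(hW c hc.1).1, hc.2 ▸ Nat.le_ceil _⟩
          refine h2.trans (h1.trans ?_)
          rw [hM, mul_pow, ← pow_mul]
          have := logb_card_nonneg C
          gcongr
        calc _ ≤ M ^ (i + 1) * (1 / D) ^ (i + 1) := by gcongr
          _ = x * x ^ i := by rw [← mul_pow, ← pow_succ', hx, mul_one_div]
          _ ≤ x * (1 / 2) ^ i := by gcongr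
    _ = x * ∑ i ∈ Finset.range m, (1 / 2) ^ i := by rw [Finset.mul_sum]
    _ ≤ x * 2 := mul_le_mul_of_nonneg_left (sum_geometric_two_le m) hx0
    _ = 8 * (1 + L) ^ 2 / D := by rw [hx, hM]; ring

end Code

section Sparsifier

variable {E A : Type*} [AddCommGroup A] [Fintype E] [Finite A]

open Classical in
/-- The distinct tight upper level sets form a chain of length at most `log₂ |C| + 1`. -/
theorem card_levelSets_le {w z : E → ℝ} (hw : ∀ e, 0 < w e) {C : AddSubgroup (E → A)}
    (htight : ∀ θ : ℝ, ∑ e with θ < z e, w e * z e =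
      Real.logb 2 (Nat.card (supportedOn C (Finset.univ.filter fun e => θ < z e)))) :
    (((Finset.univ : Finset (Finset E)).filter fun T =>
      ∃ θ : ℝ, 0 ≤ θ ∧ T = Finset.univ.filter fun e => θ < z e).card : ℝ) ≤
      1 + Real.logb 2 (Nat.card C) := by
  set 𝒯 := (Finset.univ : Finset (Finset E)).filter fun T =>
      ∃ θ : ℝ, 0 ≤ θ ∧ T = Finset.univ.filter fun e => θ < z e with h𝒯
  have hstrict : ∀ θ θ' : ℝ, 0 ≤ θ → θ ≤ θ' →
      (Finset.univ.filter fun e => θ < z e) ≠ (Finset.univ.filter fun e => θ' < z e) →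
      Nat.log 2 (Nat.card (supportedOn C (Finset.univ.filter fun e => θ' < z e))) <
        Nat.log 2 (Nat.card (supportedOn C (Finset.univ.filter fun e => θ < z e))) := by
    intro θ θ' hθ hle hne
    have hsub : (Finset.univ.filter fun e => θ' < z e) ⊂ Finset.univ.filter fun e => θ < z e := by
      refine lt_of_le_of_ne (fun e he => ?_) (Ne.symm hne)
      simp only [Finset.mem_filter, Finset.mem_univ, true_and] at he ⊢
      linarith
    have hlt : supportedOn C (Finset.univ.filter fun e => θ' < z e) <
        supportedOn C (Finset.univ.filter fun e => θ < z e) := by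
      refine lt_of_le_of_ne (supportedOn_mono C hsub.1) fun heq => ?_
      have h1 := htight θ
      rw [← heq, ← htight θ'] at h1
      obtain ⟨e, he, he'⟩ := Finset.exists_of_ssubset hsub
      refine absurd h1 (ne_of_gt (Finset.sum_lt_sum_of_subset hsub.1 he he' ?_ ?_))
      · exact mul_pos (hw e) (hθ.trans_lt (Finset.mem_filter.1 he).2)
      · intro j hj _
        exact (mul_pos (hw j) (hθ.trans_lt (Finset.mem_filter.1 hj).2)).le
    have h2 := two_mul_card_le_of_lt hlt
    have hpos : 0 < Nat.card (supportedOn C (Finset.univ.filter fun e => θ' < z e)) :=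
      Nat.card_pos
    refine Nat.lt_of_succ_le ?_
    rw [Nat.succ_eq_add_one, ← Nat.log_mul_base one_lt_two hpos.ne', mul_comm]
    exact Nat.log_mono_right h2
  have hcard : 𝒯.card ≤ (Finset.range (Nat.log 2 (Nat.card C) + 1)).card := by
    refine Finset.card_le_card_of_injOn (fun T => Nat.log 2 (Nat.card (supportedOn C T))) ?_ ?_
    · intro T _
      simp only [Finset.coe_range, Set.mem_Iio]
      exact Nat.lt_succ_of_le (Nat.log_mono_right (AddSubgroup.card_le_of_le (supportedOn_le C T)))
    · intro T hT T' hT' heq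
      obtain ⟨θ, hθ, rfl⟩ := (Finset.mem_filter.1 hT).2
      obtain ⟨θ', hθ', rfl⟩ := (Finset.mem_filter.1 hT').2
      by_contra hne
      rcases le_total θ θ' with hle | hle
      · exact (hstrict θ θ' hθ hle hne).ne' heq
      · exact (hstrict θ' θ hθ' hle (Ne.symm hne)).ne heq
  rw [Finset.card_range] at hcard
  have h1 : (Nat.log 2 (Nat.card C) : ℝ) ≤ Real.logb 2 (Nat.card C) := by
    rw [Real.le_logb_iff_rpow_le one_lt_two (by linarith [one_le_natCast_card C]),
      Real.rpow_natCast]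
    exact_mod_cast Nat.pow_log_le_self 2 Nat.card_pos.ne'
  have h2 : (𝒯.card : ℝ) ≤ Nat.log 2 (Nat.card C) + 1 := by exact_mod_cast hcard
  linarith

open Classical in
theorem logb_card_supportedOn_supermodular (C : AddSubgroup (E → A)) (S T : Finset E) :
    Real.logb 2 (Nat.card (supportedOn C S)) + Real.logb 2 (Nat.card (supportedOn C T)) ≤
      Real.logb 2 (Nat.card (supportedOn C (S ∪ T))) +
        Real.logb 2 (Nat.card (supportedOn C (S ∩ T))) := by
  have h := fun T => (zero_lt_one.trans_le (one_le_natCast_card (supportedOn C T)))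
  rw [← Real.logb_mul (h _).ne' (h _).ne', ← Real.logb_mul (h _).ne' (h _).ne']
  refine Real.logb_le_logb_of_le one_lt_two (mul_pos (h _) (h _)) ?_
  exact_mod_cast card_supportedOn_mul_le C S T

open Classical in
/-- Sampling with probabilities `min 1 (ρ u)` preserves every `u`-weight outside every tight upper
level set, simultaneously, for suitable `ρ`. -/
theorem exists_sample {w z : E → ℝ} (hw : ∀ e, 0 < w e) (hz : ∀ e, 0 ≤ z e)
    {C : AddSubgroup (E → A)}
    (hdom : ∀ S, Real.logb 2 (Nat.card (supportedOn C S)) ≤ ∑ e ∈ S, w e * z e)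
    (htight : ∀ θ : ℝ, ∑ e with θ < z e, w e * z e =
      Real.logb 2 (Nat.card (supportedOn C (Finset.univ.filter fun e => θ < z e))))
    {ε ρ : ℝ} (hε : 0 < ε) (hε1 : ε < 1)
    (hρ : ρ = 8 * Real.log (64 * (1 + Real.logb 2 (Nat.card C)) ^ 3) / ε ^ 2) :
    ∃ S : Finset E, (S.card : ℝ) ≤ 1 + 2 * (ρ * ∑ e, w e * z e) ∧
      ∀ θ : ℝ, 0 ≤ θ → ∀ c ∈ C,
        |∑ e with c e ≠ 0 ∧ z e ≤ θ,
          ((if e ∈ S then w e * z e / min 1 (ρ * (w e * z e)) else 0) - w e * z e)| ≤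
          ε * ∑ e with c e ≠ 0 ∧ z e ≤ θ, w e * z e := by
  set u : E → ℝ := fun e => w e * z e with hu_def
  have hu : ∀ e, 0 ≤ u e := fun e => mul_nonneg (hw e).le (hz e)
  set L := Real.logb 2 (Nat.card C) with hL
  have hL0 : 0 ≤ L := logb_card_nonneg C
  set D := 64 * (1 + L) ^ 3 with hDdef
  have hone : (1 : ℝ) ≤ (1 + L) := by linarith
  have hD64 : 64 ≤ D := by linarith [one_le_pow₀ hone (n := 3)]
  have hlogD : 0 < Real.log D := Real.log_pos (by linarith)
  have hρ0 : 0 < ρ := by rw [hρ]; positivity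
  set p : E → ℝ := fun e => min 1 (ρ * u e) with hp
  have hp0 : ∀ e, 0 ≤ p e := fun e => le_min zero_le_one (mul_nonneg hρ0.le (hu e))
  have hp1 : ∀ e, p e ≤ 1 := fun e => min_le_left _ _
  set 𝒯 := (Finset.univ : Finset (Finset E)).filter fun T =>
      ∃ θ : ℝ, 0 ≤ θ ∧ T = Finset.univ.filter fun e => θ < z e with h𝒯
  have h𝒯card : (𝒯.card : ℝ) ≤ 1 + L := card_levelSets_le hw htight
  let W : Finset E → Finset (E → A) := fun T =>
    (Set.toFinite {c : E → A | c ∈ C.map (eraseOn T) ∧ c ≠ 0}).toFinset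
  have hW : ∀ T c, c ∈ W T ↔ c ∈ C.map (eraseOn T) ∧ c ≠ 0 := by
    intro T c
    simp [W]
  let Y : (E → A) → Finset E → ℝ := fun c S =>
    ∑ e with c e ≠ 0, ((if e ∈ S then u e / p e else 0) - u e)
  let X : ℝ → (E → A) → Finset E → ℝ := fun s c S =>
    Real.exp (ρ * (s * Y c S - ε ^ 2 / 2 * suppWeight u c))
  have hX0 : ∀ s c S, 0 ≤ X s c S := fun _ _ _ => (Real.exp_pos _).le
  have hXmean : ∀ s, |s| = ε / 2 → ∀ c, bernoulliMean p (X s c) ≤ D ^ (-(2 * suppWeight u c)) := by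
    intro s hs c
    refine (bernoulliMean_exp_le hρ0 hu hε hε1 hs _).trans_eq ?_
    rw [Real.rpow_def_of_pos (by linarith)]
    congr 1
    rw [hρ, suppWeight]
    field_simp
    ring
  have hTsum : ∀ T ∈ 𝒯, ∑ c ∈ W T, D ^ (-(2 * suppWeight u c)) ≤ 1 / (8 * (1 + L)) := by
    intro T hT
    obtain ⟨θ, hθ, rfl⟩ := (Finset.mem_filter.1 hT).2
    refine (sum_rpow_suppWeight_le hu (logb_card_map_eraseOn_le hu hdom (htight θ))
      (L := L) ?_ ?_ _ fun c hc => (hW _ c).1 hc).trans ?_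
    · have h1 := one_le_natCast_card (C.map (eraseOn (Finset.univ.filter fun e => θ < z e)))
      refine Real.logb_le_logb_of_le one_lt_two (by linarith) ?_
      have := card_supportedOn_mul_card_map_eraseOn C (Finset.univ.filter fun e => θ < z e)
      have h2 : 0 < Nat.card (supportedOn C (Finset.univ.filter fun e => θ < z e)) := Nat.card_pos
      exact_mod_cast this ▸ Nat.le_mul_of_pos_left _ h2
    · have : (1 + L) ^ 2 ≤ (1 + L) ^ 3 := pow_le_pow_right₀ hone (by norm_num)
      nlinarith [sq_nonneg (1 + L)]
    · rw [hDdef]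
      apply le_of_eq
      field_simp
      norm_num
  let F : Finset E → ℝ := fun S => 1 / 2 * Real.exp (-∑ e, p e) * 2 ^ S.card +
    ∑ T ∈ 𝒯, ∑ c ∈ W T, (X (ε / 2) c S + X (-(ε / 2)) c S)
  have hs1 : |ε / 2| = ε / 2 := abs_of_pos (by linarith)
  have hs2 : |-(ε / 2)| = ε / 2 := by rw [abs_neg, hs1]
  have hFmean : bernoulliMean p F < 1 := by
    have h1 : bernoulliMean p (fun S => 1 / 2 * Real.exp (-∑ e, p e) * 2 ^ S.card) ≤ 1 / 2 := by
      rw [bernoulliMean_const_mul]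
      calc _ ≤ 1 / 2 * Real.exp (-∑ e, p e) * Real.exp (∑ e, p e) := by
            gcongr
            exact bernoulliMean_two_pow_card_le p hp0
        _ = 1 / 2 := by rw [mul_assoc, ← Real.exp_add]; simp
    have h2 : bernoulliMean p
        (fun S => ∑ T ∈ 𝒯, ∑ c ∈ W T, (X (ε / 2) c S + X (-(ε / 2)) c S)) ≤ 1 / 4 := by
      rw [bernoulliMean_sum]
      calc _ ≤ ∑ T ∈ 𝒯, 2 * (1 / (8 * (1 + L))) := by
            refine Finset.sum_le_sum fun T hT => ?_
            rw [bernoulliMean_sum]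
            refine le_trans ?_ (mul_le_mul_of_nonneg_left (hTsum T hT) zero_le_two)
            rw [Finset.mul_sum]
            refine Finset.sum_le_sum fun c _ => ?_
            rw [bernoulliMean_add]
            linarith [hXmean _ hs1 c, hXmean _ hs2 c]
        _ = 𝒯.card * (2 * (1 / (8 * (1 + L)))) := by rw [Finset.sum_const, nsmul_eq_mul]
        _ ≤ (1 + L) * (2 * (1 / (8 * (1 + L)))) := by gcongr
        _ = 1 / 4 := by field_simp; norm_num
    have h3 : bernoulliMean p F = _ := bernoulliMean_add p _ _
    rw [h3]
    linarith
  obtain ⟨S, hS⟩ := exists_lt_of_bernoulliMean_lt hp0 hp1 hFmean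
  have hsumnn : 0 ≤ ∑ T ∈ 𝒯, ∑ c ∈ W T, (X (ε / 2) c S + X (-(ε / 2)) c S) :=
    Finset.sum_nonneg fun T _ => Finset.sum_nonneg fun c _ => add_nonneg (hX0 _ _ _) (hX0 _ _ _)
  refine ⟨S, ?_, ?_⟩
  · have h1 : 1 / 2 * Real.exp (-∑ e, p e) * 2 ^ S.card < 1 := by
      simp only [F] at hS; linarith
    have hps : ∑ e, p e ≤ ρ * ∑ e, u e := by
      rw [Finset.mul_sum]
      exact Finset.sum_le_sum fun e _ => min_le_right _ _
    have h2 : (2 : ℝ) ^ S.card = Real.exp (S.card * Real.log 2) := by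
      rw [Real.exp_nat_mul, Real.exp_log two_pos]
    have h3 : (1 / 2 : ℝ) = Real.exp (-Real.log 2) := by
      rw [Real.exp_neg, Real.exp_log two_pos, one_div]
    rw [h2, h3, ← Real.exp_add, ← Real.exp_add, Real.exp_lt_one_iff] at h1
    have hlog : 1 / 2 < Real.log 2 := by linarith [Real.log_two_gt_d9]
    have hps0 : 0 ≤ ∑ e, p e := Finset.sum_nonneg fun e _ => hp0 e
    by_contra! hcon
    have h4 : ((S.card : ℝ) - 1) * (1 / 2) ≤ ((S.card : ℝ) - 1) * Real.log 2 :=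
      mul_le_mul_of_nonneg_left hlog.le (by linarith)
    linarith
  · intro θ hθ c hc
    set T := Finset.univ.filter fun e => θ < z e with hT
    have hT𝒯 : T ∈ 𝒯 := Finset.mem_filter.2 ⟨Finset.mem_univ _, θ, hθ, rfl⟩
    have hfil : (Finset.univ.filter fun e => c e ≠ 0 ∧ z e ≤ θ) =
        Finset.univ.filter fun e => eraseOn T c e ≠ 0 := by
      ext e
      simp only [Finset.mem_filter, Finset.mem_univ, true_and, eraseOn, hT, AddMonoidHom.coe_mk,
        ZeroHom.coe_mk]
      by_cases h : θ < z e
      · simp [h]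
      · simp [h, not_lt.1 h]
    rw [hfil]
    by_cases h0 : eraseOn T c = 0
    · simp [h0]
    have hmem : eraseOn T c ∈ W T := (hW _ _).2 ⟨⟨c, hc, rfl⟩, h0⟩
    have hterm : X (ε / 2) (eraseOn T c) S + X (-(ε / 2)) (eraseOn T c) S < 1 := by
      have h1 := Finset.single_le_sum
        (f := fun c => X (ε / 2) c S + X (-(ε / 2)) c S)
        (fun c _ => add_nonneg (hX0 _ _ _) (hX0 _ _ _)) hmem
      have h2 := Finset.single_le_sum
        (f := fun T => ∑ c ∈ W T, (X (ε / 2) c S + X (-(ε / 2)) c S))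
        (fun T _ => Finset.sum_nonneg fun c _ => add_nonneg (hX0 _ _ _) (hX0 _ _ _)) hT𝒯
      have h3 : 0 ≤ 1 / 2 * Real.exp (-∑ e, p e) * 2 ^ S.card := by positivity
      simp only [F] at hS h1 h2
      linarith
    have hbound : ∀ s, X s (eraseOn T c) S < 1 →
        s * Y (eraseOn T c) S < ε ^ 2 / 2 * suppWeight u (eraseOn T c) := by
      intro s hs
      simp only [X, Real.exp_lt_one_iff] at hs
      by_contra! hcon
      exact absurd hs (not_lt.2 (mul_nonneg hρ0.le (by linarith)))
    have b1 := hbound (ε / 2) (by linarith [hX0 (-(ε / 2)) (eraseOn T c) S])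
    have b2 := hbound (-(ε / 2)) (by linarith [hX0 (ε / 2) (eraseOn T c) S])
    change |Y (eraseOn T c) S| ≤ ε * suppWeight u (eraseOn T c)
    rw [abs_le]
    have hhalf : 0 < ε / 2 := by linarith
    constructor
    · refine le_of_mul_le_mul_left ?_ hhalf
      linarith
    · refine le_of_mul_le_mul_left ?_ hhalf
      linarith

open Classical in
/-- Near-linear sparsifiers for additive codes. -/
theorem exists_code_sparsifier {w : E → ℝ} (hw : ∀ e, 0 < w e) (C : AddSubgroup (E → A))
    {ε : ℝ} (hε : 0 < ε) (hε1 : ε < 1) :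
    ∃ (S : Finset E) (w' : E → ℝ), (∀ e, 0 ≤ w' e) ∧
      (S.card : ℝ) ≤ 1 + 2 * (8 * Real.log (64 * (1 + Real.logb 2 (Nat.card C)) ^ 3) / ε ^ 2 *
        Real.logb 2 (Nat.card C)) ∧
      ∀ c ∈ C, |∑ e with c e ≠ 0, ((if e ∈ S then w' e else 0) - w e)| ≤
        ε * ∑ e with c e ≠ 0, w e := by
  obtain ⟨z, hz, hdom, htight⟩ := exists_density_tight w Finset.univ
    (fun T => Real.logb 2 (Nat.card (supportedOn C T))) (fun e _ => hw e)
    (by simp [supportedOn_empty])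
    (fun S T h => Real.logb_le_logb_of_le one_lt_two
      (by linarith [one_le_natCast_card (supportedOn C S)])
      (by exact_mod_cast AddSubgroup.card_le_of_le (supportedOn_mono C h)))
    (logb_card_supportedOn_supermodular C)
  simp only [Finset.mem_univ, forall_const, Finset.subset_univ] at hz hdom
  set ρ := 8 * Real.log (64 * (1 + Real.logb 2 (Nat.card C)) ^ 3) / ε ^ 2 with hρ
  obtain ⟨S, hScard, hS⟩ := exists_sample hw hz hdom htight hε hε1 hρ
  have htotal : ∑ e, w e * z e = Real.logb 2 (Nat.card C) := by
    have := htight (-1)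
    rwa [Finset.filter_true_of_mem fun e _ => by linarith [hz e], supportedOn_univ] at this
  have hρ0 : 0 ≤ ρ := by
    have h1 := one_le_pow₀ (show 1 ≤ 1 + Real.logb 2 (Nat.card C) by
      linarith [logb_card_nonneg C]) (n := 3)
    have : 0 ≤ Real.log (64 * (1 + Real.logb 2 (Nat.card C)) ^ 3) :=
      Real.log_nonneg (by linarith)
    positivity
  refine ⟨S, fun e => w e / min 1 (ρ * (w e * z e)), fun e => ?_, by rwa [htotal] at hScard, ?_⟩
  · exact div_nonneg (hw e).le (le_min zero_le_one
      (mul_nonneg hρ0 (mul_nonneg (hw e).le (hz e))))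
  intro c hc
  have hzpos : ∀ e ∈ Finset.univ.filter fun e => c e ≠ 0, 0 < z e := by
    intro e he
    refine lt_of_le_of_ne (hz e) fun h0 => ?_
    have hce := (Finset.mem_filter.1 he).2
    set T := Finset.univ.filter fun e => 0 < z e with hT
    have h1 := one_le_suppWeight (logb_card_map_eraseOn_le
      (fun e => mul_nonneg (hw e).le (hz e)) hdom (htight 0)) (c := eraseOn T c) ⟨c, hc, rfl⟩
      (fun h => by
        have := congrFun h e
        simp only [eraseOn, hT, ← h0, AddMonoidHom.coe_mk, ZeroHom.coe_mk, Finset.mem_filter,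
          lt_irrefl, and_false, if_false, Pi.zero_apply] at this
        exact hce this)
    have h2 : suppWeight (fun e => w e * z e) (eraseOn T c) = 0 := by
      refine Finset.sum_eq_zero fun i hi => ?_
      have hi' : i ∉ T := fun h => (Finset.mem_filter.1 hi).2 (by simp [eraseOn, h])
      have : z i = 0 := le_antisymm (by simpa [hT] using hi') (hz i)
      simp [this]
    linarith
  have key : ∀ σ : ℝ, |σ| = 1 →
      0 ≤ ∑ e with c e ≠ 0, (ε * w e + σ * ((if e ∈ S then
        w e / min 1 (ρ * (w e * z e)) else 0) - w e)) := by
    intro σ hσ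
    have habel := sum_mul_nonneg_of_upper_sums_nonneg
      (fun e => ε * (w e * z e) + σ * ((if e ∈ S then
        w e * z e / min 1 (ρ * (w e * z e)) else 0) - w e * z e))
      (Finset.univ.filter fun e => c e ≠ 0) (fun e => (z e)⁻¹)
      (fun e he => inv_nonneg.2 (hz e)) (fun τ => by
        obtain ⟨θ, hθ, heq⟩ : ∃ θ : ℝ, 0 ≤ θ ∧
            ((Finset.univ.filter fun e => c e ≠ 0).filter fun e => τ ≤ (z e)⁻¹) =
              Finset.univ.filter fun e => c e ≠ 0 ∧ z e ≤ θ := by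
          rcases le_or_gt τ 0 with hτ | hτ
          · refine ⟨∑ e, z e, Finset.sum_nonneg fun e _ => hz e, ?_⟩
            rw [Finset.filter_filter]
            ext e
            simp only [Finset.mem_filter, Finset.mem_univ, true_and]
            refine and_congr_right fun _ => iff_of_true (hτ.trans (inv_nonneg.2 (hz e))) ?_
            exact Finset.single_le_sum (fun e _ => hz e) (Finset.mem_univ e)
          · refine ⟨τ⁻¹, (inv_pos.2 hτ).le, ?_⟩
            rw [Finset.filter_filter]
            ext e
            simp only [Finset.mem_filter, Finset.mem_univ, true_and]
            refine and_congr_right fun hce => ?_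
            exact le_inv_comm₀ hτ (hzpos e (by simpa using hce))
        rw [heq, Finset.sum_add_distrib, ← Finset.mul_sum, ← Finset.mul_sum]
        have h1 := hS θ hθ c hc
        have h2 := neg_abs_le (σ * ∑ e with c e ≠ 0 ∧ z e ≤ θ,
          ((if e ∈ S then w e * z e / min 1 (ρ * (w e * z e)) else 0) - w e * z e))
        rw [abs_mul, hσ, one_mul] at h2
        linarith)
    refine habel.trans_eq (Finset.sum_congr rfl fun e he => ?_)
    have hne := (hzpos e he).ne'
    split_ifs
    · rw [mul_div_right_comm]
      field_simp
    · field_simp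
      ring
  have k1 := key 1 abs_one
  have k2 := key (-1) (by simp)
  rw [Finset.sum_add_distrib, ← Finset.mul_sum, ← Finset.mul_sum] at k1 k2
  rw [abs_le]
  constructor <;> linarith

end Sparsifier

section CSP

/-- The affine codewords `j ↦ α ∑ₖ b (t j k) + β s` attached to the constraint tuples `t`. -/
def affineCode {E : Type*} {n r q : ℕ} (α β : ZMod q) (t : E → Fin r → Fin n) :
    (Fin n → ZMod q) × ZMod q →+ (E → ZMod q) where
  toFun x j := α * ∑ k, x.1 (t j k) + β * x.2
  map_zero' := by ext; simp
  map_add' x y := by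
    ext
    simp only [Prod.fst_add, Prod.snd_add, Pi.add_apply, Finset.sum_add_distrib]
    ring

theorem logb_card_affineCode_le {E : Type*} {n r q : ℕ} [NeZero q] (α β : ZMod q)
    (t : E → Fin r → Fin n) :
    Real.logb 2 (Nat.card (affineCode α β t).range) ≤ (n + 1) * Real.logb 2 q := by
  have hcard : Nat.card (affineCode α β t).range ≤ q ^ (n + 1) := by
    have h := Finite.card_range_le (affineCode α β t)
    rw [← AddMonoidHom.coe_range] at h
    refine h.trans_eq ?_
    simp [pow_succ]
  have hpos : 0 < Nat.card (affineCode α β t).range :=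
    Nat.pos_of_ne_zero (Nat.card_ne_zero.2 ⟨⟨0⟩, Set.finite_range (affineCode α β t)⟩)
  calc Real.logb 2 (Nat.card (affineCode α β t).range)
      ≤ Real.logb 2 ((q : ℝ) ^ (n + 1)) :=
        Real.logb_le_logb_of_le one_lt_two (by exact_mod_cast hpos) (by exact_mod_cast hcard)
    _ = (n + 1) * Real.logb 2 q := by rw [Real.logb_pow]; push_cast; ring

theorem sparsifier_size_le {n r L ε : ℝ} (hn : 1 ≤ n) (hr : 1 ≤ r) (hε : 0 < ε) (hε1 : ε < 1)
    (hL0 : 0 ≤ L) (hL : L ≤ 2 * n * Real.logb 2 (2 * r)) :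
    1 + 2 * (8 * Real.log (64 * (1 + L) ^ 3) / ε ^ 2 * L) ≤
      500 * n * Real.logb 2 (2 * r) ^ 2 * Real.logb 2 (2 * n * r / ε) / ε ^ 2 := by
  have hnr : 1 ≤ n * r := one_le_mul_of_one_le_of_one_le hn hr
  set l := Real.logb 2 (2 * r) with hl
  set M := Real.logb 2 (2 * n * r / ε) with hM
  have hl1 : 1 ≤ l := by
    rw [hl, Real.le_logb_iff_rpow_le one_lt_two (by linarith), Real.rpow_one]; linarith
  have hnrM : Real.logb 2 (2 * n * r) ≤ M := by
    refine Real.logb_le_logb_of_le one_lt_two (by nlinarith) ?_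
    rw [le_div_iff₀ hε]
    nlinarith
  have hnr1 : 1 ≤ Real.logb 2 (2 * n * r) := by
    rw [Real.le_logb_iff_rpow_le one_lt_two (by nlinarith), Real.rpow_one]; nlinarith
  have hl2 : l ≤ 2 * r := by
    have h1 := Real.log_le_sub_one_of_pos (show 0 < r by linarith)
    have h2 : l = 1 + Real.log r / Real.log 2 := by
      rw [hl, Real.logb_mul two_ne_zero (by linarith), Real.logb_self_eq_one one_lt_two, Real.logb]
    have h3 : 1 / 2 < Real.log 2 := by linarith [Real.log_two_gt_d9]
    have h4 : Real.log r / Real.log 2 ≤ 2 * (r - 1) := by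
      rw [div_le_iff₀ (by linarith)]
      nlinarith
    linarith
  have hL5 : 1 + L ≤ 5 * (n * r) := by nlinarith
  have hlog : Real.log (64 * (1 + L) ^ 3) ≤ 15 * M := by
    have h1 : 64 * (1 + L) ^ 3 ≤ (2 * n * r) ^ 15 := by
      have h2 : (1 + L) ^ 3 ≤ (5 * (n * r)) ^ 3 := by gcongr
      have h3 : (n * r) ^ 3 ≤ (n * r) ^ 15 := pow_le_pow_right₀ hnr (by norm_num)
      have h4 : (2 * n * r) ^ 15 = 2 ^ 15 * (n * r) ^ 15 := by ring
      have h5 : (5 * (n * r)) ^ 3 = 125 * (n * r) ^ 3 := by ring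
      have h6 : 0 ≤ (n * r) ^ 15 := by positivity
      linarith
    have h2 : Real.log (64 * (1 + L) ^ 3) ≤ 15 * Real.log (2 * n * r) := by
      refine (Real.log_le_log (by positivity) h1).trans_eq ?_
      rw [Real.log_pow]
      norm_num
    have h3 : Real.log (2 * n * r) ≤ Real.logb 2 (2 * n * r) := by
      have h4 : 0 ≤ Real.log (2 * n * r) := Real.log_nonneg (by nlinarith)
      rw [Real.logb, le_div_iff₀ (Real.log_pos one_lt_two)]
      nlinarith [Real.log_two_lt_d9]
    linarith
  have hM1 : 1 ≤ M := hnr1.trans hnrM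
  have hε2 : 0 < ε ^ 2 := by positivity
  rw [le_div_iff₀ hε2]
  have e1 : (1 + 2 * (8 * Real.log (64 * (1 + L) ^ 3) / ε ^ 2 * L)) * ε ^ 2 =
      ε ^ 2 + 16 * (Real.log (64 * (1 + L) ^ 3) * L) := by
    field_simp
    ring
  have e2 : Real.log (64 * (1 + L) ^ 3) * L ≤ 15 * M * (2 * n * l) := by
    refine mul_le_mul hlog hL hL0 (by linarith)
  have e3 : ε ^ 2 ≤ 1 := by nlinarith
  have e4 : n * l * M ≤ n * l ^ 2 * M := by
    have : l ≤ l ^ 2 := by nlinarith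
    gcongr
  have e5 : 1 ≤ n * l ^ 2 * M :=
    one_le_mul_of_one_le_of_one_le (one_le_mul_of_one_le_of_one_le hn (one_le_pow₀ hl1)) hM1
  rw [e1]
  nlinarith

end CSP

/-- near-linear size sparsifiers for CSPs over symmetric periodic
Boolean predicates. -/
theorem stmt_12 :
    ∃ K c : ℝ, 0 < K ∧ 0 < c ∧
      ∀ (r : ℕ), 1 ≤ r →
      ∀ (P : (Fin r → Bool) → Bool) (P₀ : ℕ → Bool),
        (∀ x : Fin r → Bool, P x = P₀ ((Finset.univ.filter fun i => x i = true).card)) →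
        (∀ k₁ k₂ k₃ : ℕ, k₁ ≤ r → k₂ ≤ r → k₃ ≤ r →
          P₀ k₁ = false → P₀ k₂ = false →
          ((k₃ : ℤ) = 2 * (k₂ : ℤ) - (k₁ : ℤ) ∨ (k₃ : ℤ) = 2 * (k₁ : ℤ) - (k₂ : ℤ)) →
          P₀ k₃ = false) →
      ∀ ε : ℝ, 0 < ε → ε < 1 → ∀ n : ℕ, 1 ≤ n →
      ∀ (m : ℕ) (w : Fin m → ℝ) (t : Fin m → Fin r → Fin n), (∀ j, 0 ≤ w j) →
      ∃ (S : Finset (Fin m)) (w' : Fin m → ℝ),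
        (∀ j ∈ S, 0 ≤ w' j) ∧
        (S.card : ℝ) ≤ K * n * (Real.logb 2 (2 * (r : ℝ))) ^ 2 *
          (Real.logb 2 (2 * (n : ℝ) * (r : ℝ) / ε)) ^ c / ε ^ 2 ∧
        ∀ a : Fin n → Bool,
          (1 - ε) * cspVal P w t a ≤ cspValOn P S w' t a ∧
          cspValOn P S w' t a ≤ (1 + ε) * cspVal P w t a := by
  classical
  refine ⟨500, 1, by norm_num, one_pos, ?_⟩
  intro r hr P P₀ hP hper ε hε hε1 n hn m w t hw
  obtain ⟨q, α, β, hq1, hq, hαβ⟩ := exists_affine_zmod_of_periodic r hr P₀ hper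
  have : NeZero q := ⟨by omega⟩
  let t' : {j : Fin m // 0 < w j} → Fin r → Fin n := fun j => t j
  obtain ⟨S, w', hw', hcard, hS⟩ := exists_code_sparsifier
    (w := fun j : {j : Fin m // 0 < w j} => w j) (fun j => j.2) (affineCode α β t').range hε hε1
  have hn1 : (1 : ℝ) ≤ n := by exact_mod_cast hn
  have hr1 : (1 : ℝ) ≤ r := by exact_mod_cast hr
  refine ⟨S.map (Function.Embedding.subtype _), fun j => if h : 0 < w j then w' ⟨j, h⟩ else 0,
    fun j _ => ?_, ?_, fun a => ?_⟩
  · dsimp only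
    split_ifs
    exacts [hw' _, le_rfl]
  · rw [Finset.card_map, Real.rpow_one]
    refine hcard.trans (sparsifier_size_le hn1 hr1 hε hε1 (logb_card_nonneg _) ?_)
    refine (logb_card_affineCode_le α β t').trans ?_
    refine mul_le_mul (by linarith) ?_ (Real.logb_nonneg one_lt_two (by exact_mod_cast hq1))
      (by linarith)
    exact Real.logb_le_logb_of_le one_lt_two (by exact_mod_cast hq1) (by exact_mod_cast hq)
  · set c := affineCode α β t' (fun i => if a i then 1 else 0, 1) with hc
    have hPc : ∀ j : {j : Fin m // 0 < w j}, P (fun k => a (t j k)) = true ↔ c j ≠ 0 := by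
      intro j
      rw [hP, hαβ _ ((Finset.card_le_univ _).trans_eq (Fintype.card_fin r))]
      simp [hc, affineCode, t', Finset.sum_boole]
    have hval : cspVal P w t a = ∑ j with c j ≠ 0, w j := by
      rw [cspVal, Finset.sum_filter, ← Finset.sum_filter_of_ne (p := fun j => 0 < w j)
        fun j _ h => (hw j).lt_of_ne' (left_ne_zero_of_mul h),
        Finset.sum_subtype (p := fun j => 0 < w j) _ (by simp)]
      exact Finset.sum_congr rfl fun j _ => by simp only [← hPc, mul_ite, mul_one, mul_zero]
    have hvalOn : cspValOn P (S.map (Function.Embedding.subtype _))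
        (fun j => if h : 0 < w j then w' ⟨j, h⟩ else 0) t a =
        ∑ j with c j ≠ 0, if j ∈ S then w' j else 0 := by
      rw [cspValOn, Finset.sum_map, Finset.sum_filter,
        ← Finset.sum_subset (Finset.subset_univ S) fun j _ hj => by simp [hj]]
      refine Finset.sum_congr rfl fun j hj => ?_
      by_cases h : c j = 0 <;> simp [hj, j.2, h, hPc]
    have hmain : |cspValOn P (S.map (Function.Embedding.subtype _))
        (fun j => if h : 0 < w j then w' ⟨j, h⟩ else 0) t a - cspVal P w t a| ≤
        ε * cspVal P w t a := by
      rw [hval, hvalOn, ← Finset.sum_sub_distrib]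
      convert hS c ⟨_, rfl⟩
    rw [abs_le] at hmain
    constructor <;> linarith [hmain.1, hmain.2]
end

section
/- Let r ≥ 1 and let a, b ∈ {0,1}^r with a ≠ b. Then there exists a polynomial L in r variables over the field 𝔽₂ of total degree at most r−1 such that for every y ∈ {0,1}^r (with coordinates viewed as elements of 𝔽₂), the evaluation L(y) is nonzero if and only if y = a or y = b. -/
open MvPolynomial in
/-- An affine form in the `i`-th and `j`-th variables; when `a i ≠ b i` and `j ≠ i`, it is nonzero
at `y` exactly when `(y i, y j)` is `(a i, a j)` or `(b i, b j)`. -/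
noncomputable def twoPointForm {σ : Type*} (a b : σ → Bool) (i j : σ) :
    MvPolynomial σ (ZMod 2) :=
  X j + C (if a j then 0 else 1) + C (if a j = b j then 0 else 1) * (X i + C (if a i then 1 else 0))

open MvPolynomial in
theorem totalDegree_twoPointForm_le {σ : Type*} (a b : σ → Bool) (i j : σ) :
    (twoPointForm a b i j).totalDegree ≤ 1 := by
  unfold twoPointForm
  refine (totalDegree_add _ _).trans
    (max_le ((totalDegree_add _ _).trans (by split_ifs <;> simp)) ?_)
  refine (totalDegree_mul _ _).trans ?_
  rw [totalDegree_C, zero_add]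
  exact (totalDegree_add _ _).trans (by split_ifs <;> simp)

open MvPolynomial in
theorem eval_twoPointForm_ne_zero_iff {σ : Type*} {a b : σ → Bool} {i : σ} (hi : a i ≠ b i)
    (j : σ) (y : σ → Bool) :
    eval (fun k => if y k then (1 : ZMod 2) else 0) (twoPointForm a b i j) ≠ 0 ↔
      (y i = a i → y j = a j) ∧ (y i = b i → y j = b j) := by
  simp only [twoPointForm, map_add, map_mul, eval_X, eval_C]
  generalize a i = p, b i = q, y i = s, a j = t, b j = u, y j = v at *
  revert p q s t u v
  decide

/-- for any two distinct points a, b of the Boolean cube there is a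
polynomial over 𝔽₂ of total degree at most r−1 that is nonzero exactly on {a, b}. -/
theorem stmt_13 (r : ℕ) (hr : 1 ≤ r) (a b : Fin r → Bool) (hab : a ≠ b) :
    ∃ L : MvPolynomial (Fin r) (ZMod 2),
      L.totalDegree ≤ r - 1 ∧
      ∀ y : Fin r → Bool,
        (MvPolynomial.eval (fun i => if y i then (1 : ZMod 2) else 0) L ≠ 0 ↔
          (y = a ∨ y = b)) := by
  obtain ⟨i, hi⟩ := Function.ne_iff.mp hab
  refine ⟨∏ j ∈ Finset.univ.erase i, twoPointForm a b i j, ?_, fun y => ?_⟩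
  · refine (MvPolynomial.totalDegree_finsetProd _ _).trans
      ((Finset.sum_le_card_nsmul _ _ 1 fun j _ => totalDegree_twoPointForm_le a b i j).trans ?_)
    simp
  · simp only [map_prod, Finset.prod_ne_zero_iff, eval_twoPointForm_ne_zero_iff hi,
      Finset.mem_erase, Finset.mem_univ, and_true]
    constructor
    · intro h
      have hy : y i = a i ∨ y i = b i := by
        revert hi
        generalize a i = p, b i = q, y i = s
        revert p q s
        decide
      refine hy.imp (fun hy => funext fun j => ?_) (fun hy => funext fun j => ?_)
      · by_cases hj : j = i
        · exact hj ▸ hy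
        · exact (h j hj).1 hy
      · by_cases hj : j = i
        · exact hj ▸ hy
        · exact (h j hj).2 hy
    · rintro (rfl | rfl) j -
      · exact ⟨fun _ => rfl, fun h => absurd h hi⟩
      · exact ⟨fun h => absurd h.symm hi, fun _ => rfl⟩
end
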